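/- Local uniform convergence of the rescaled solution to the stationary profile: let m ∈ (m_s, 1), let u be a radial energy solution of the fast diffusion equation with exponent m and extinction time T > 0, let w be its rescaled solution, and let V be a stationary profile for the same m and T. Then for every compact set K ⊂ [0,∞), sup_{r ∈ K} | w(r,τ)^m − V(r) | → 0 as τ → ∞. -/

import Mathlib

open MeasureTheory Set Filter Topology

/-- Membership in the radial energy space `H¹_rad` on hyperbolic space `ℍ^N`:
`v` is locally absolutely continuous on `(0,∞)` (expressed via the fundamental theorem
of calculus for its a.e. derivative) and both `v` and `v'` are square-integrable with
respect to the weight `(sinh s)^(N-1)`. -/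
def MemH1rad (N : ℕ) (v : ℝ → ℝ) : Prop :=
  (∀ a b : ℝ, 0 < a → a ≤ b → v b - v a = ∫ s in a..b, deriv v s) ∧
  MeasureTheory.IntegrableOn (fun s => (v s) ^ 2 * Real.sinh s ^ (N - 1)) (Set.Ioi 0) ∧
  MeasureTheory.IntegrableOn (fun s => (deriv v s) ^ 2 * Real.sinh s ^ (N - 1)) (Set.Ioi 0)

/-- The squared `H¹` norm `‖v‖_2² + ‖v'‖_2²` with weight `(sinh s)^(N-1)`. -/
noncomputable def H1normSq (N : ℕ) (v : ℝ → ℝ) : ℝ :=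
  (∫ s in Set.Ioi (0:ℝ), (v s) ^ 2 * Real.sinh s ^ (N - 1)) +
  (∫ s in Set.Ioi (0:ℝ), (deriv v s) ^ 2 * Real.sinh s ^ (N - 1))

/-- A radial energy solution of the fast diffusion equation `u_t = Δ(u^m)` on `ℍ^N`,
with exponent `m`, extinction time `T` (initial datum `u(·,0)`). -/
structure IsRadialEnergySolution (N : ℕ) (m T : ℝ) (u : ℝ → ℝ → ℝ) : Prop where
  continuousOn : ContinuousOn (fun p : ℝ × ℝ => u p.1 p.2) (Set.Ici 0 ×ˢ Set.Icc 0 T)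
  nonneg : ∀ r ∈ Set.Ici (0:ℝ), ∀ t ∈ Set.Icc (0:ℝ) T, 0 ≤ u r t
  smooth : ContDiffOn ℝ (⊤ : ℕ∞) (fun p : ℝ × ℝ => u p.1 p.2) (Set.Ici 0 ×ˢ Set.Ioo 0 T)
  pos : ∀ r ∈ Set.Ici (0:ℝ), ∀ t ∈ Set.Ioo (0:ℝ) T, 0 < u r t
  pde : ∀ r > (0:ℝ), ∀ t ∈ Set.Ioo (0:ℝ) T,
    deriv (fun τ => u r τ) t
      = deriv (deriv (fun ρ => u ρ t ^ m)) r
        + ((N : ℝ) - 1) * (Real.cosh r / Real.sinh r) * deriv (fun ρ => u ρ t ^ m) r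
  neumann : ∀ t ∈ Set.Ioo (0:ℝ) T, deriv (fun ρ => u ρ t ^ m) 0 = 0
  extinction : ∀ r ∈ Set.Ici (0:ℝ), u r T = 0
  energy : ∀ t ∈ Set.Ioo (0:ℝ) T, MemH1rad N (fun ρ => u ρ t ^ m)
  energy_bdd : ∀ ε ∈ Set.Ioo (0:ℝ) T, ∃ C : ℝ, ∀ t ∈ Set.Ico ε T,
    H1normSq N (fun ρ => u ρ t ^ m) ≤ C
  init_bdd : ∃ M : ℝ, ∀ r ∈ Set.Ici (0:ℝ), u r 0 ≤ M
  init_nonzero : ∃ r ∈ Set.Ici (0:ℝ), u r 0 ≠ 0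
  init_energy : MemH1rad N (fun ρ => u ρ 0 ^ m)

/-- A stationary profile for the fast diffusion equation: a smooth positive radial
energy solution of `-ΔV = V^(1/m)/((1-m)T)` on `ℍ^N`, decaying like `e^{-(N-1)r}`
together with all of its derivatives. -/
structure IsStationaryProfile (N : ℕ) (m T : ℝ) (V : ℝ → ℝ) : Prop where
  smooth : ContDiffOn ℝ (⊤ : ℕ∞) V (Set.Ici 0)
  pos : ∀ r ∈ Set.Ici (0:ℝ), 0 < V r
  deriv_zero : deriv V 0 = 0
  mem : MemH1rad N V
  ode : ∀ r > (0:ℝ),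
    deriv (deriv V) r + ((N : ℝ) - 1) * (Real.cosh r / Real.sinh r) * deriv V r
      + V r ^ (1 / m) / ((1 - m) * T) = 0
  asymp : ∃ l > (0:ℝ), ∀ k : ℕ,
    Filter.Tendsto (fun r => Real.exp (((N : ℝ) - 1) * r) * iteratedDeriv k V r)
      Filter.atTop (nhds ((-1 : ℝ) ^ k * ((N : ℝ) - 1) ^ k * l))

/-- The rescaled solution `w(r,τ) = e^{τ/((1-m)T)} u(r, T - T e^{-τ/T})`. -/
noncomputable def rescaled (m T : ℝ) (u : ℝ → ℝ → ℝ) (r τ : ℝ) : ℝ :=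
  Real.exp (τ / ((1 - m) * T)) * u r (T - T * Real.exp (-τ / T))

section
open Real
notation "IP" => Ioi (0:ℝ)
variable {N : ℕ} {r : ℝ} {t : ℝ}
lemma mI {a : ℝ} : MeasurableSet (Ioi a) := measurableSet_Ioi
/-- weight -/
noncomputable def Pw (N : ℕ) (r : ℝ) : ℝ := sinh r ^ (N - 1)
/-- Green function -/
noncomputable def Sg (N : ℕ) (r : ℝ) : ℝ := ∫ x in Ioi r, (Pw N x)⁻¹
lemma Pw_pos (hr : 0 < r) : 0 < Pw N r := pow_pos (sinh_pos_iff.2 hr) _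
lemma Pw_cont (N : ℕ) : Continuous (Pw N) := continuous_sinh.pow _
lemma Pw_nonneg (hr : 0 ≤ r) : 0 ≤ Pw N r := pow_nonneg (sinh_nonneg_iff.2 hr) _
lemma Pw_mono {x y : ℝ} (hx : 0 ≤ x) (hxy : x ≤ y) : Pw N x ≤ Pw N y :=
  pow_le_pow_left₀ (sinh_nonneg_iff.2 hx) (sinh_le_sinh.2 hxy) _
lemma Pw_zero (hN : 2 ≤ N) : Pw N 0 = 0 := by
  unfold Pw; rw [sinh_zero]; exact zero_pow (by omega)
lemma sinh_grow {r x : ℝ} (hr : 0 < r) (hx : r ≤ x) : sinh r * exp (x - r) ≤ sinh x := by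
  have h : x = r + (x - r) := by ring
  conv_rhs => rw [h, sinh_add]
  rw [← cosh_add_sinh (x - r)]
  have h1 : sinh r ≤ cosh r := (sinh_lt_cosh r).le
  have h2 : 0 ≤ sinh (x - r) := sinh_nonneg_iff.2 (by linarith)
  nlinarith
lemma Pw_grow (hN : 2 ≤ N) {r x : ℝ} (hr : 0 < r) (hx : r ≤ x) :
    Pw N r * exp (x - r) ≤ Pw N x := by
  have h0 := sinh_pos_iff.2 hr
  have h1 : (1:ℝ) ≤ exp (x - r) := one_le_exp (by linarith)
  calc Pw N r * exp (x - r) ≤ Pw N r * exp (x - r) ^ (N - 1) := by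
        gcongr
        · exact (Pw_pos hr).le
        · exact le_self_pow₀ h1 (by omega)
    _ = (sinh r * exp (x - r)) ^ (N - 1) := by unfold Pw; rw [mul_pow]
    _ ≤ Pw N x := pow_le_pow_left₀ (by positivity) (sinh_grow hr hx) _
lemma Pw_hasDeriv (hN : 2 ≤ N) (hr : 0 < r) :
    HasDerivAt (Pw N) (((N : ℝ) - 1) * (cosh r / sinh r) * Pw N r) r := by
  have h0 := sinh_pos_iff.2 hr
  have := (hasDerivAt_sinh r).pow (N - 1)
  refine this.congr_deriv ?_
  obtain ⟨k, rfl⟩ : ∃ k, N = k + 2 := ⟨N - 2, by omega⟩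
  simp only [Pw, Nat.add_succ_sub_one]
  push_cast
  field_simp
  simp [pow_succ]
  ring
lemma PwInv_le (hN : 2 ≤ N) {r x : ℝ} (hr : 0 < r) (hx : r ≤ x) :
    (Pw N x)⁻¹ ≤ (Pw N r)⁻¹ * exp r * exp (-1 * x) := by
  have h := Pw_grow hN hr hx
  have h0 := Pw_pos (N := N) hr
  have h1 : (Pw N r)⁻¹ * exp r * exp (-1 * x) = (Pw N r * exp (x - r))⁻¹ := by
    rw [mul_inv, ← exp_neg, mul_assoc, ← exp_add]; congr 2; ring
  rw [h1]
  exact inv_anti₀ (by positivity) h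
lemma PwInv_cont : ContinuousOn (fun x => (Pw N x)⁻¹) IP :=
  (Pw_cont N).continuousOn.inv₀ fun x hx => (Pw_pos hx).ne'
lemma PwInv_int (hN : 2 ≤ N) (hr : 0 < r) :
    IntegrableOn (fun x => (Pw N x)⁻¹) (Ioi r) := by
  refine Integrable.mono' ((integrableOn_exp_mul_Ioi (a := -1) (by norm_num) r).const_mul ((Pw N r)⁻¹ * exp r)) ?_ ?_
  · exact (PwInv_cont.mono (Ioi_subset_Ioi hr.le)).aestronglyMeasurable mI
  · filter_upwards [ae_restrict_mem mI] with x hx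
    rw [norm_of_nonneg (inv_nonneg.2 (Pw_nonneg (hr.le.trans (le_of_lt hx))))]
    exact PwInv_le hN hr (le_of_lt hx)
lemma Sg_le (hN : 2 ≤ N) (hr : 0 < r) : Sg N r ≤ (Pw N r)⁻¹ := by
  have := setIntegral_mono_on (PwInv_int hN hr)
    ((integrableOn_exp_mul_Ioi (a := -1) (by norm_num) r).const_mul ((Pw N r)⁻¹ * exp r)) mI
    (fun x hx => PwInv_le hN hr (le_of_lt hx))
  refine this.trans ?_
  rw [integral_const_mul, integral_exp_mul_Ioi (by norm_num)]
  rw [show -exp (-1 * r) / -1 = exp (-r) by simp, mul_assoc, ← exp_add]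
  simp
lemma Sg_sub (hN : 2 ≤ N) {r x : ℝ} (hr : 0 < r) (hx : 0 < x) :
    Sg N r - Sg N x = ∫ y in r..x, (Pw N y)⁻¹ := by
  wlog h : r ≤ x generalizing r x
  · rw [intervalIntegral.integral_symm, ← this hx hr (by linarith)]; ring
  rw [intervalIntegral.integral_of_le h, Sg, Sg, ← Ioc_union_Ioi_eq_Ioi h,
    setIntegral_union (by
      rw [Set.disjoint_left]; intro y hy hy'; exact absurd hy' (not_lt.2 hy.2)) mI
      ((PwInv_int hN hr).mono_set Ioc_subset_Ioi_self) (PwInv_int hN hx)]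
  ring
lemma Sg_hasDeriv (hN : 2 ≤ N) (hr : 0 < r) : HasDerivAt (Sg N) (-(Pw N r)⁻¹) r := by
  have h1 : HasDerivAt (fun x => Sg N r - ∫ y in r..x, (Pw N y)⁻¹) (-(Pw N r)⁻¹) r := by
    have : ContinuousAt (fun x => (Pw N x)⁻¹) r := PwInv_cont.continuousAt (Ioi_mem_nhds hr)
    have := intervalIntegral.integral_hasDerivAt_right (f := fun x => (Pw N x)⁻¹) (a := r) (b := r)
      (by simp) (PwInv_cont.stronglyMeasurableAtFilter isOpen_Ioi r hr) this
    exact this.const_sub _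
  refine h1.congr_of_eventuallyEq ?_
  filter_upwards [Ioi_mem_nhds hr] with x hx
  rw [← Sg_sub hN hr hx]; ring
lemma Sg_cont (hN : 2 ≤ N) : ContinuousOn (Sg N) IP := fun _ hx =>
  (Sg_hasDeriv hN hx).continuousAt.continuousWithinAt
lemma Sg_strictAnti (hN : 2 ≤ N) : StrictAntiOn (Sg N) IP := by
  refine strictAntiOn_of_deriv_neg (convex_Ioi 0) (Sg_cont hN) fun x hx => ?_
  rw [interior_Ioi] at hx
  rw [(Sg_hasDeriv hN hx).deriv]
  have := Pw_pos (N := N) hx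
  simp only [Left.neg_neg_iff]; positivity
lemma Sg_nonneg (hr : 0 < r) : 0 ≤ Sg N r :=
  setIntegral_nonneg mI fun _ hx => inv_nonneg.2 (Pw_pos (hr.trans hx)).le
lemma Sg_pos (hN : 2 ≤ N) (hr : 0 < r) : 0 < Sg N r :=
  (Sg_nonneg (r := r + 1) (by linarith)).trans_lt
    (Sg_strictAnti hN hr (show (0:ℝ) < r + 1 by linarith) (by linarith))
lemma Pw_Sg_le (hN : 2 ≤ N) (hr : 0 < r) : Pw N r * Sg N r ≤ 1 := by
  have h := Sg_le hN hr
  have h0 := Pw_pos (N := N) hr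
  calc _ ≤ Pw N r * (Pw N r)⁻¹ := by gcongr
    _ = 1 := mul_inv_cancel₀ h0.ne'
lemma Sg_exp (hN : 2 ≤ N) : ∃ C > 0, ∀ r ≥ 1, Sg N r ≤ C * exp (-1 * r) := by
  refine ⟨(Pw N 1)⁻¹ * exp 1, ?_, fun r hr => ?_⟩
  · have := Pw_pos (N := N) one_pos; positivity
  · exact (Sg_le hN (by linarith)).trans (PwInv_le hN one_pos hr)
lemma Sg_tendsto (hN : 2 ≤ N) : Tendsto (Sg N) atTop (𝓝 0) := by
  obtain ⟨C, hC, h⟩ := Sg_exp hN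
  have h2 : Tendsto (fun r => C * exp (-1 * r)) atTop (𝓝 (C * 0)) := by
    refine Tendsto.const_mul _ ?_
    refine tendsto_exp_atBot.comp ?_
    exact tendsto_id.const_mul_atTop_of_neg (by norm_num)
  rw [mul_zero] at h2
  refine squeeze_zero' ?_ ?_ h2
  · filter_upwards [eventually_ge_atTop 1] with r hr using Sg_nonneg (by linarith)
  · filter_upwards [eventually_ge_atTop 1] with r hr using h r hr
lemma le_sinh (hr : 0 ≤ r) : r ≤ sinh r := self_le_sinh_iff.2 hr
lemma sinh_le_two (hr : 0 ≤ r) (h1 : r ≤ 1) : sinh r ≤ 2 * r := by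
  rw [sinh_eq]
  have h3 : exp r ≤ 1 + r + r ^ 2 := by
    have := abs_exp_sub_one_sub_id_le (x := r) (by rw [abs_of_nonneg hr]; exact h1)
    have := abs_le.1 this
    linarith
  have h4 : 1 - r ≤ exp (-r) := by have := add_one_le_exp (-r); linarith
  nlinarith
/-- choice of exponent -/
lemma beta_exists (hN : 2 ≤ N) {p : ℝ} (hp : 1 < p) (hsub : ((N:ℝ) - 2) * p < N + 2) :
    ∃ β : ℝ, 0 < β ∧ (N:ℝ) - 2 < β ∧ β * (p + 1) < 2 * N ∧ β * (p - 1) < 4 ∧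
      (3 ≤ N → β < 2 * ((N:ℝ) - 2)) ∧ (N = 2 → β * p < 4) := by
  have hN' : (2:ℝ) ≤ N := by exact_mod_cast hN
  set g := (N:ℝ) + 2 - ((N:ℝ) - 2) * p with hg
  have hgpos : 0 < g := by linarith
  refine ⟨(N:ℝ) - 2 + min (g / (2 * (p + 1))) (1/2), ?_, ?_, ?_, ?_, ?_, ?_⟩
  all_goals
    have e1 : 0 < min (g / (2 * (p + 1))) (1/2) := lt_min (by positivity) (by norm_num)
    have e2 : min (g / (2 * (p + 1))) (1/2) ≤ 1/2 := min_le_right _ _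
    have e3 : min (g / (2 * (p + 1))) (1/2) * (p + 1) ≤ g / 2 := by
      calc _ ≤ (g / (2 * (p + 1))) * (p + 1) := by gcongr; exact min_le_left _ _
        _ = g / 2 := by field_simp
    set e := min (g / (2 * (p + 1))) (1/2) with he
  · linarith
  · linarith
  · nlinarith
  · nlinarith
  · intro h
    have : (3:ℝ) ≤ N := by exact_mod_cast h
    linarith
  · intro h
    subst h
    push_cast at *
    nlinarith
lemma Sg_near (hN : 2 ≤ N) {β : ℝ} (hβ : 0 < β) (hβ2 : (N:ℝ) - 2 < β) :
    ∃ C > 0, ∀ r, 0 < r → r ≤ 1 → Sg N r ≤ C * r ^ (-β) := by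
  refine ⟨Sg N 1 + 1 / β, by have := Sg_nonneg (N := N) one_pos; positivity, fun r hr h1 => ?_⟩
  have hb : ∀ x ∈ Icc r 1, (Pw N x)⁻¹ ≤ x ^ (-β - 1) := by
    intro x hx
    have hx0 : 0 < x := hr.trans_le hx.1
    have : x ^ (N - 1) ≤ Pw N x := pow_le_pow_left₀ hx0.le (le_sinh hx0.le) _
    calc (Pw N x)⁻¹ ≤ (x ^ (N - 1))⁻¹ := inv_anti₀ (by positivity) this
      _ = x ^ (-((N:ℝ) - 1)) := by
        rw [rpow_neg hx0.le, ← rpow_natCast]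
        congr 2
        rw [Nat.cast_sub (by omega)]; simp
      _ ≤ x ^ (-β - 1) := rpow_le_rpow_of_exponent_ge hx0 hx.2 (by linarith)
  have hne : (-β - 1) ≠ -1 := by linarith
  have h0 : (0:ℝ) ∉ uIcc r 1 := by rw [uIcc_of_le h1]; simp; exact hr
  have h3 : ∫ y in r..1, (Pw N y)⁻¹ ≤ ∫ y in r..1, y ^ (-β - 1) := by
    refine intervalIntegral.integral_mono_on h1 ?_ ?_ hb
    · refine ContinuousOn.intervalIntegrable (PwInv_cont.mono ?_)
      rw [uIcc_of_le h1]; intro x hx; exact hr.trans_le hx.1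
    · exact intervalIntegral.intervalIntegrable_rpow (Or.inr h0)
  rw [integral_rpow (Or.inr ⟨by linarith, h0⟩)] at h3
  have h4 := Sg_sub hN hr one_pos
  have h5 : (1:ℝ) ≤ r ^ (-β) := one_le_rpow_of_pos_of_le_one_of_nonpos hr h1 (by linarith)
  have h6 : ((1:ℝ) ^ (-β - 1 + 1) - r ^ (-β - 1 + 1)) / (-β - 1 + 1) = (r ^ (-β) - 1) / β := by
    rw [show -β - 1 + 1 = -β by ring, one_rpow, div_neg, ← neg_div]; ring
  rw [h6] at h3
  have h7 : (r ^ (-β) - 1) / β ≤ 1 / β * r ^ (-β) := by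
    rw [div_le_iff₀ hβ]; field_simp; linarith
  have h8 : Sg N 1 ≤ Sg N 1 * r ^ (-β) := le_mul_of_one_le_right (Sg_nonneg one_pos) h5
  linarith
lemma Sg_atZero (hN : 2 ≤ N) : Tendsto (Sg N) (𝓝[>] 0) atTop := by
  have key : ∀ r, 0 < r → r ≤ 1 → (1 / 2 ^ (N - 1)) * (- log r) ≤ Sg N r := by
    intro r hr h1
    have hb : ∀ x ∈ Icc r 1, (1 / 2 ^ (N - 1)) * x⁻¹ ≤ (Pw N x)⁻¹ := by
      intro x hx
      have hx0 : 0 < x := hr.trans_le hx.1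
      have : Pw N x ≤ 2 ^ (N - 1) * x := by
        calc Pw N x ≤ (2 * x) ^ (N - 1) := pow_le_pow_left₀ (sinh_nonneg_iff.2 hx0.le) (sinh_le_two hx0.le hx.2) _
          _ = 2 ^ (N - 1) * x ^ (N - 1) := mul_pow _ _ _
          _ ≤ 2 ^ (N - 1) * x := by
            gcongr; exact pow_le_of_le_one hx0.le hx.2 (by omega)
      calc _ = (2 ^ (N - 1) * x)⁻¹ := by rw [mul_inv]; simp
        _ ≤ _ := inv_anti₀ (Pw_pos hx0) this
    have h0 : (0:ℝ) ∉ uIcc r 1 := by rw [uIcc_of_le h1]; simp; exact hr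
    have h3 : ∫ y in r..1, (1 / 2 ^ (N - 1)) * y⁻¹ ≤ ∫ y in r..1, (Pw N y)⁻¹ := by
      refine intervalIntegral.integral_mono_on h1 ?_ ?_ hb
      · exact (ContinuousOn.intervalIntegrable (continuousOn_inv₀.mono fun x hx hx0 => h0 (by rw [mem_singleton_iff] at hx0; rwa [hx0] at hx))).const_mul _
      · refine ContinuousOn.intervalIntegrable (PwInv_cont.mono ?_)
        rw [uIcc_of_le h1]; intro x hx; exact hr.trans_le hx.1
    rw [intervalIntegral.integral_const_mul, integral_inv h0, one_div r, log_inv, ← Sg_sub hN hr one_pos] at h3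
    have := Sg_nonneg (N := N) one_pos
    linarith
  refine tendsto_atTop_mono' _ ?_ ((tendsto_neg_atBot_atTop.comp tendsto_log_nhdsGT_zero).const_mul_atTop (show (0:ℝ) < 1 / 2 ^ (N - 1) by positivity))
  filter_upwards [Ioc_mem_nhdsGT (show (0:ℝ) < 1 by norm_num)] with r hr using key r hr.1 hr.2
lemma k1_int (hN : 2 ≤ N) {p : ℝ} (hp : 1 < p) (hsub : ((N:ℝ) - 2) * p < N + 2) :
    IntegrableOn (fun r => Pw N r * Sg N r ^ ((p + 1) / 2)) IP := by
  obtain ⟨β, hβ, hβ1, hβ2, -⟩ := beta_exists hN hp hsub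
  have hN' : (2:ℝ) ≤ N := by exact_mod_cast hN
  have hmeas : ContinuousOn (fun r => Pw N r * Sg N r ^ ((p + 1) / 2)) IP :=
    (Pw_cont N).continuousOn.mul ((Sg_cont hN).rpow_const fun x hx => Or.inl (Sg_pos hN hx).ne')
  rw [← Ioc_union_Ioi_eq_Ioi (zero_le_one (α := ℝ))]
  refine IntegrableOn.union ?_ ?_
  · obtain ⟨C, hC, h⟩ := Sg_near hN hβ hβ1
    have hi : IntegrableOn (fun x : ℝ => 2 ^ (N - 1) * C ^ ((p + 1) / 2) * x ^ ((N:ℝ) - 1 - β * (p + 1) / 2)) (Ioc 0 1) := by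
      have := (intervalIntegral.intervalIntegrable_rpow' (a := 0) (b := 1)
        (r := (N:ℝ) - 1 - β * (p + 1) / 2) (by linarith)).const_mul (2 ^ (N - 1) * C ^ ((p + 1) / 2))
      rwa [intervalIntegrable_iff_integrableOn_Ioc_of_le zero_le_one] at this
    refine Integrable.mono' hi ((hmeas.mono Ioc_subset_Ioi_self).aestronglyMeasurable measurableSet_Ioc) ?_
    filter_upwards [ae_restrict_mem measurableSet_Ioc] with x hx
    have hx0 := hx.1
    have hs := Sg_pos hN hx0
    have hP := Pw_pos (N := N) hx0
    rw [norm_of_nonneg (by positivity)]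
    have e1 : Pw N x ≤ 2 ^ (N - 1) * x ^ ((N:ℝ) - 1) := by
      calc Pw N x ≤ (2 * x) ^ (N - 1) := pow_le_pow_left₀ (sinh_nonneg_iff.2 hx0.le) (sinh_le_two hx0.le hx.2) _
        _ = 2 ^ (N - 1) * x ^ (N - 1) := mul_pow _ _ _
        _ = _ := by
          rw [← rpow_natCast x]
          congr 2
          rw [Nat.cast_sub (by omega)]; simp
    have e2 : Sg N x ^ ((p + 1) / 2) ≤ C ^ ((p + 1) / 2) * x ^ (-(β * (p + 1) / 2)) := by
      calc _ ≤ (C * x ^ (-β)) ^ ((p + 1) / 2) := rpow_le_rpow hs.le (h x hx0 hx.2) (by linarith)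
        _ = _ := by
          rw [mul_rpow hC.le (by positivity), ← rpow_mul hx0.le]
          congr 2; ring
    calc _ ≤ (2 ^ (N - 1) * x ^ ((N:ℝ) - 1)) * (C ^ ((p + 1) / 2) * x ^ (-(β * (p + 1) / 2))) := by gcongr
      _ = _ := by
        rw [sub_eq_add_neg ((N:ℝ) - 1), rpow_add hx0]; ring
  · obtain ⟨C, hC, h⟩ := Sg_exp hN
    have hi := (integrableOn_exp_mul_Ioi (a := -((p - 1) / 2)) (by linarith) 1).const_mul (C ^ ((p - 1) / 2))
    refine Integrable.mono' hi ((hmeas.mono (Ioi_subset_Ioi zero_le_one)).aestronglyMeasurable mI) ?_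
    filter_upwards [ae_restrict_mem mI] with x hx
    have hx1 : (1:ℝ) < x := hx
    have hx0 : (0:ℝ) < x := by linarith
    have hs := Sg_pos hN hx0
    have hP := Pw_pos (N := N) hx0
    rw [norm_of_nonneg (by positivity)]
    rw [show (p + 1) / 2 = 1 + (p - 1) / 2 by ring, rpow_add hs, rpow_one, ← mul_assoc]
    calc _ ≤ 1 * (C * exp (-1 * x)) ^ ((p - 1) / 2) := by
          gcongr
          · exact Pw_Sg_le hN hx0
          · exact h x hx1.le
      _ = _ := by
        rw [one_mul, mul_rpow hC.le (exp_pos _).le, ← exp_mul]; congr 2; ring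
lemma Pp (N : ℕ) (hr : 0 < r) : 0 < Pw N r := Pw_pos hr
end

section
open Real
variable {N : ℕ} {r : ℝ} {t : ℝ}
/-- truncation radii -/
noncomputable def rl (n : ℕ) : ℝ := 1 / ((n:ℝ) + 1)
/-- truncation radii -/
noncomputable def rr (n : ℕ) : ℝ := (n:ℝ) + 1
lemma rl_pos (n : ℕ) : 0 < rl n := by unfold rl; positivity
lemma rl_le (n : ℕ) : rl n ≤ rr n := by
  unfold rl rr
  have : (0:ℝ) ≤ n := by positivity
  rw [div_le_iff₀ (by positivity)]; nlinarith
lemma rr_pos (n : ℕ) : 0 < rr n := by unfold rr; positivity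
lemma rl_tendsto : Tendsto rl atTop (𝓝[>] 0) :=
  tendsto_nhdsWithin_iff.2 ⟨tendsto_one_div_add_atTop_nhds_zero_nat, Eventually.of_forall rl_pos⟩
lemma rr_tendsto : Tendsto rr atTop atTop :=
  tendsto_atTop_add_const_right _ _ tendsto_natCast_atTop_atTop
lemma cov : AECover (volume.restrict IP) atTop (fun n : ℕ => Ioc (rl n) (rr n)) where
  ae_eventually_mem := by
    filter_upwards [ae_restrict_mem mI] with x hx
    have h1 := (tendsto_nhdsWithin_iff.1 rl_tendsto).1.eventually_lt_const hx
    filter_upwards [h1, rr_tendsto.eventually_ge_atTop x] with n h1 h2 using ⟨h1, h2⟩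
  measurableSet := fun _ => measurableSet_Ioc
lemma Ioc_sub_Ioi {ρ R : ℝ} (h : 0 < ρ) : Ioc ρ R ⊆ IP := fun _ hx => h.trans hx.1
lemma uIcc_sub_Ioi {ρ R : ℝ} (h : 0 < ρ) (h2 : 0 < R) : uIcc ρ R ⊆ IP := fun _ hx =>
  (lt_min h h2).trans_le hx.1
lemma ii_of_cont {f : ℝ → ℝ} (hc : ContinuousOn f IP) {ρ R : ℝ} (h : 0 < ρ) (h2 : 0 < R) :
    IntervalIntegrable f volume ρ R := (hc.mono (uIcc_sub_Ioi h h2)).intervalIntegrable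
lemma trunc_eq (f : ℝ → ℝ) (n : ℕ) :
    ∫ x in Ioc (rl n) (rr n), f x ∂(volume.restrict IP) = ∫ x in (rl n)..(rr n), f x := by
  rw [intervalIntegral.integral_of_le (rl_le n), Measure.restrict_restrict measurableSet_Ioc,
    inter_eq_left.2 (Ioc_sub_Ioi (rl_pos n))]
lemma tendsto_trunc {f : ℝ → ℝ} (hf : IntegrableOn f IP) :
    Tendsto (fun n : ℕ => ∫ x in (rl n)..(rr n), f x) atTop (𝓝 (∫ x in IP, f x)) := by
  simpa only [trunc_eq] using cov.integral_tendsto_of_countably_generated hf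
lemma int_of_bdd {f : ℝ → ℝ} (hc : ContinuousOn f IP) (h0 : ∀ x > 0, 0 ≤ f x) {C : ℝ}
    (hb : ∀ n : ℕ, ∫ x in (rl n)..(rr n), f x ≤ C) :
    IntegrableOn f IP ∧ ∫ x in IP, f x ≤ C := by
  have h : IntegrableOn f IP := by
    refine cov.integrable_of_integral_norm_bounded C (fun n => ?_) (Eventually.of_forall fun n => ?_)
    · rw [IntegrableOn, Measure.restrict_restrict measurableSet_Ioc,
        inter_eq_left.2 (Ioc_sub_Ioi (rl_pos n)), ← IntegrableOn,
        ← intervalIntegrable_iff_integrableOn_Ioc_of_le (rl_le n)]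
      exact ii_of_cont hc (rl_pos n) (rr_pos n)
    · rw [trunc_eq]
      refine le_trans (le_of_eq ?_) (hb n)
      refine intervalIntegral.integral_congr fun x hx => ?_
      exact norm_of_nonneg (h0 x (uIcc_sub_Ioi (rl_pos n) (rr_pos n) hx))
  exact ⟨h, le_of_tendsto' (tendsto_trunc h) hb⟩
lemma trunc_le {f : ℝ → ℝ} (hf : IntegrableOn f IP) (h0 : ∀ x > 0, 0 ≤ f x) {ρ R : ℝ}
    (h : 0 ≤ ρ) (h2 : ρ ≤ R) : ∫ x in ρ..R, f x ≤ ∫ x in IP, f x := by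
  rw [intervalIntegral.integral_of_le h2]
  refine setIntegral_mono_set hf ?_ ?_
  · filter_upwards [ae_restrict_mem mI] with x hx using h0 x hx
  · exact (show Ioc ρ R ⊆ IP from fun x hx => h.trans_lt hx.1).eventuallyLE
/-- mass function -/
noncomputable def Mm (N : ℕ) (a : ℝ → ℝ) (r : ℝ) : ℝ := ∫ x in (0:ℝ)..r, Pw N x * a x
lemma sqS_cont (hN : 2 ≤ N) : ContinuousOn (fun x => √(Sg N x)) IP :=
  (Sg_cont hN).sqrt
lemma Mint (hN : 2 ≤ N) {a : ℝ → ℝ} (ha : ContinuousOn a IP) (h0 : ∀ x > 0, 0 ≤ a x)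
    (hi : IntegrableOn (fun x => Pw N x * a x * √(Sg N x)) IP) (hr : 0 ≤ r) :
    IntervalIntegrable (fun x => Pw N x * a x) volume 0 r := by
  rcases hr.eq_or_lt with rfl | hr
  · simp
  rw [intervalIntegrable_iff_integrableOn_Ioc_of_le hr.le]
  refine Integrable.mono' ((hi.mono_set (fun x hx => hx.1 : Ioc 0 r ⊆ IP)).const_mul (√(Sg N r))⁻¹) ?_ ?_
  · exact (((Pw_cont N).continuousOn.mul ha).mono (fun x hx => hx.1)).aestronglyMeasurable measurableSet_Ioc
  · filter_upwards [ae_restrict_mem measurableSet_Ioc] with x hx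
    have hP := Pp N hx.1
    have hs := sqrt_pos.2 (Sg_pos hN hr)
    have hss : √(Sg N r) ≤ √(Sg N x) := sqrt_le_sqrt ((Sg_strictAnti hN).antitoneOn hx.1 hr hx.2)
    have hax := h0 x hx.1
    rw [norm_of_nonneg (by positivity), inv_mul_eq_div, le_div_iff₀ hs]
    gcongr
lemma M_deriv {a : ℝ → ℝ} (ha : ContinuousOn a IP) (hr : 0 < r)
    (hi : IntervalIntegrable (fun x => Pw N x * a x) volume 0 r) :
    HasDerivAt (Mm N a) (Pw N r * a r) r := by
  have hc : ContinuousOn (fun x => Pw N x * a x) IP := (Pw_cont N).continuousOn.mul ha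
  exact intervalIntegral.integral_hasDerivAt_right hi (hc.stronglyMeasurableAtFilter isOpen_Ioi r hr)
    (hc.continuousAt (Ioi_mem_nhds hr))
lemma M_nonneg {a : ℝ → ℝ} (h0 : ∀ x > 0, 0 ≤ a x) (hr : 0 ≤ r) : 0 ≤ Mm N a r := by
  unfold Mm
  rw [intervalIntegral.integral_of_le hr]
  exact setIntegral_nonneg measurableSet_Ioc fun x hx => mul_nonneg (Pw_nonneg hx.1.le) (h0 x hx.1)
lemma M_incr (hN : 2 ≤ N) {a : ℝ → ℝ} (ha : ContinuousOn a IP) (h0 : ∀ x > 0, 0 ≤ a x)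
    (hi : IntegrableOn (fun x => Pw N x * a x * √(Sg N x)) IP) {q r : ℝ} (hq : 0 ≤ q) (hr : 0 < r) (hqr : q ≤ r) :
    (Mm N a r - Mm N a q) * √(Sg N r) ≤ ∫ x in q..r, Pw N x * a x * √(Sg N x) := by
  unfold Mm
  have i1 := Mint hN ha h0 hi hq
  have i2 := Mint hN ha h0 hi hr.le
  rw [intervalIntegral.integral_interval_sub_left i2 i1, ← intervalIntegral.integral_mul_const,
    intervalIntegral.integral_of_le hqr, intervalIntegral.integral_of_le hqr]
  have hsub : Ioc q r ⊆ IP := fun x hx => hq.trans_lt hx.1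
  refine setIntegral_mono_on ?_ (hi.mono_set hsub) measurableSet_Ioc fun x hx => ?_
  · refine Integrable.mul_const ?_ _
    have := (i1.symm.trans i2)
    rwa [intervalIntegrable_iff_integrableOn_Ioc_of_le hqr] at this
  · have hP := Pp N (hsub hx)
    have hax := h0 x (hsub hx)
    have hss : √(Sg N r) ≤ √(Sg N x) := sqrt_le_sqrt ((Sg_strictAnti hN).antitoneOn (hsub hx) hr hx.2)
    gcongr
lemma M_le (hN : 2 ≤ N) {a : ℝ → ℝ} (ha : ContinuousOn a IP) (h0 : ∀ x > 0, 0 ≤ a x)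
    (hi : IntegrableOn (fun x => Pw N x * a x * √(Sg N x)) IP) (hr : 0 < r) :
    Mm N a r * √(Sg N r) ≤ ∫ x in IP, Pw N x * a x * √(Sg N x) := by
  have h := M_incr hN ha h0 hi le_rfl hr hr.le
  have h2 := trunc_le hi (fun x hx => mul_nonneg (mul_nonneg (Pw_nonneg (le_of_lt hx)) (h0 x hx)) (sqrt_nonneg _)) le_rfl hr.le
  have : Mm N a 0 = 0 := by simp [Mm]
  rw [this, sub_zero] at h
  exact h.trans h2
lemma M_zero (hN : 2 ≤ N) {a : ℝ → ℝ} (ha : ContinuousOn a IP) (h0 : ∀ x > 0, 0 ≤ a x)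
    (hi : IntegrableOn (fun x => Pw N x * a x * √(Sg N x)) IP) :
    Tendsto (fun r => Mm N a r * √(Sg N r)) (𝓝[>] 0) (𝓝 0) := by
  have hii : IntegrableOn (fun x => Pw N x * a x * √(Sg N x)) (Icc 0 1) := by
    rw [integrableOn_Icc_iff_integrableOn_Ioc]
    exact hi.mono_set (fun x hx => hx.1)
  have hc := intervalIntegral.continuousOn_primitive_interval (a := (0:ℝ)) (b := 1) (μ := volume)
    (f := fun x => Pw N x * a x * √(Sg N x)) (by rwa [uIcc_of_le zero_le_one])
  have hc0 := hc 0 (by simp)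
  rw [ContinuousWithinAt, intervalIntegral.integral_same, uIcc_of_le zero_le_one] at hc0
  have hc1 := hc0.mono_left (nhdsWithin_mono _ (Ioc_subset_Icc_self (a := (0:ℝ)) (b := 1)))
  rw [nhdsWithin_Ioc_eq_nhdsGT (zero_lt_one (α := ℝ))] at hc1
  refine squeeze_zero' ?_ ?_ hc1
  · filter_upwards [self_mem_nhdsWithin] with r hr using mul_nonneg (M_nonneg h0 (le_of_lt hr)) (sqrt_nonneg _)
  · filter_upwards [self_mem_nhdsWithin] with r hr
    have h := M_incr hN ha h0 hi le_rfl hr (le_of_lt hr)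
    rwa [show Mm N a 0 = 0 by simp [Mm], sub_zero] at h
lemma sqS_tendsto (hN : 2 ≤ N) : Tendsto (fun r => √(Sg N r)) atTop (𝓝 0) := by
  simpa using (Sg_tendsto hN).sqrt
lemma M_infty (hN : 2 ≤ N) {a : ℝ → ℝ} (ha : ContinuousOn a IP) (h0 : ∀ x > 0, 0 ≤ a x)
    (hi : IntegrableOn (fun x => Pw N x * a x * √(Sg N x)) IP) :
    Tendsto (fun r => Mm N a r * √(Sg N r)) atTop (𝓝 0) := by
  set F := fun x => Pw N x * a x * √(Sg N x) with hF
  have hF0 : ∀ x > 0, 0 ≤ F x := fun x hx => mul_nonneg (mul_nonneg (Pw_nonneg (le_of_lt hx)) (h0 x hx)) (sqrt_nonneg _)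
  have hlim := intervalIntegral_tendsto_integral_Ioi 0 hi tendsto_id
  rw [Metric.tendsto_atTop]
  intro ε hε
  obtain ⟨q, hq⟩ := (hlim.eventually (lt_mem_nhds (show (∫ x in IP, F x) - ε / 2 < ∫ x in IP, F x by linarith))).and
    (eventually_gt_atTop 0) |>.exists
  have hq0 : 0 < q := hq.2
  have h2 := (sqS_tendsto hN).const_mul (Mm N a q)
  rw [mul_zero] at h2
  obtain ⟨B, hB⟩ := (h2.eventually (gt_mem_nhds (show (0:ℝ) < ε / 2 by linarith))).exists_forall_of_atTop
  refine ⟨max B q, fun r hr => ?_⟩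
  have hr1 := hB r (le_of_max_le_left hr)
  have hr2 : q ≤ r := le_of_max_le_right hr
  have hr0 : 0 < r := hq0.trans_le hr2
  have h := M_incr hN ha h0 hi hq0.le hr0 hr2
  have h3 := trunc_le hi hF0 le_rfl hr0.le
  have hI : ∀ y, 0 ≤ y → IntervalIntegrable F volume 0 y := fun y hy => by
    rw [intervalIntegrable_iff_integrableOn_Ioc_of_le hy]; exact hi.mono_set (fun x hx => hx.1)
  have h4 := intervalIntegral.integral_interval_sub_left (hI r hr0.le) (hI q hq0.le)
  have h5 : (∫ x in IP, F x) - ε / 2 < ∫ x in (0:ℝ)..q, F x := hq.1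
  rw [dist_eq, sub_zero, abs_of_nonneg (mul_nonneg (M_nonneg h0 hr0.le) (sqrt_nonneg _))]
  rw [sub_mul] at h
  linarith
lemma M_sq (hN : 2 ≤ N) {a : ℝ → ℝ} (ha : ContinuousOn a IP) (h0 : ∀ x > 0, 0 ≤ a x)
    (hi : IntegrableOn (fun x => Pw N x * a x * √(Sg N x)) IP) :
    IntegrableOn (fun r => Mm N a r ^ 2 * (Pw N r)⁻¹) IP ∧
    ∫ r in IP, Mm N a r ^ 2 * (Pw N r)⁻¹ ≤ 3 * (∫ x in IP, Pw N x * a x * √(Sg N x)) ^ 2 := by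
  set F := fun x => Pw N x * a x * √(Sg N x) with hF
  set I := ∫ x in IP, F x with hI
  have hF0 : ∀ x > 0, 0 ≤ F x := fun x hx => mul_nonneg (mul_nonneg (Pw_nonneg (le_of_lt hx)) (h0 x hx)) (sqrt_nonneg _)
  have hd : ∀ r > 0, HasDerivAt (Mm N a) (Pw N r * a r) r := fun r hr => M_deriv ha hr (Mint hN ha h0 hi (le_of_lt hr))
  have hMc : ContinuousOn (Mm N a) IP := fun r hr => (hd r hr).continuousAt.continuousWithinAt
  have hPa : ContinuousOn (fun x => Pw N x * a x) IP := (Pw_cont N).continuousOn.mul ha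
  have hFc : ContinuousOn F IP := hPa.mul (sqS_cont hN)
  have hg : ContinuousOn (fun r => Mm N a r ^ 2 * (Pw N r)⁻¹) IP := (hMc.pow 2).mul PwInv_cont
  have hI0 : 0 ≤ I := setIntegral_nonneg mI hF0
  have hsM : ∀ r > 0, Sg N r * Mm N a r ^ 2 ≤ I ^ 2 := fun r hr => by
    have h1 := M_le hN ha h0 hi hr
    have h2 : 0 ≤ Mm N a r * √(Sg N r) := mul_nonneg (M_nonneg h0 (le_of_lt hr)) (sqrt_nonneg _)
    calc Sg N r * Mm N a r ^ 2 = (Mm N a r * √(Sg N r)) ^ 2 := by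
          rw [mul_pow, sq_sqrt (Sg_nonneg hr)]; ring
      _ ≤ _ := pow_le_pow_left₀ h2 h1 2
  have hQ : ContinuousOn (fun x => -(Pw N x)⁻¹ * Mm N a x ^ 2 + Sg N x * (2 * Mm N a x * (Pw N x * a x))) IP :=
    (PwInv_cont.neg.mul (hMc.pow 2)).add ((Sg_cont hN).mul ((continuousOn_const.mul hMc).mul hPa))
  refine int_of_bdd hg (fun x hx => mul_nonneg (sq_nonneg _) (inv_nonneg.2 (Pw_pos hx).le)) fun n => ?_
  have hk : ∫ x in (rl n)..(rr n), (-(Pw N x)⁻¹ * Mm N a x ^ 2 + Sg N x * (2 * Mm N a x * (Pw N x * a x)))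
      = Sg N (rr n) * Mm N a (rr n) ^ 2 - Sg N (rl n) * Mm N a (rl n) ^ 2 := by
    refine intervalIntegral.integral_eq_sub_of_hasDerivAt (f := fun x => Sg N x * Mm N a x ^ 2) (fun x hx => ?_) ?_
    · have hx0 := uIcc_sub_Ioi (rl_pos n) (rr_pos n) hx
      refine ((Sg_hasDeriv hN hx0).mul ((hd x hx0).pow 2)).congr_deriv ?_
      simp
    · exact ii_of_cont hQ (rl_pos n) (rr_pos n)
  have hle : ∫ x in (rl n)..(rr n), Mm N a x ^ 2 * (Pw N x)⁻¹ ≤ ∫ x in (rl n)..(rr n),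
      (2 * I * F x - (-(Pw N x)⁻¹ * Mm N a x ^ 2 + Sg N x * (2 * Mm N a x * (Pw N x * a x)))) := by
    refine intervalIntegral.integral_mono_on (rl_le n) (ii_of_cont hg (rl_pos n) (rr_pos n))
      (ii_of_cont ?_ (rl_pos n) (rr_pos n)) fun x hx => ?_
    · exact (continuousOn_const.mul hFc).sub hQ
    · have hx0 : 0 < x := (rl_pos n).trans_le hx.1
      have h1 := mul_le_mul_of_nonneg_right (M_le hN ha h0 hi hx0) (hF0 x hx0)
      have h2 : Mm N a x * √(Sg N x) * F x = Sg N x * (Mm N a x * (Pw N x * a x)) := by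
        have := mul_self_sqrt (Sg_nonneg (N := N) hx0)
        simp only [hF]
        linear_combination Mm N a x * Pw N x * a x * this
      rw [h2] at h1
      change _ ≤ I * F x at h1
      linarith
  rw [intervalIntegral.integral_sub (ii_of_cont (f := fun x => 2 * I * F x) (continuousOn_const.mul hFc) (rl_pos n) (rr_pos n))
    (ii_of_cont hQ (rl_pos n) (rr_pos n)),
    hk, intervalIntegral.integral_const_mul] at hle
  have h5 := trunc_le hi hF0 (rl_pos n).le (rl_le n)
  have h6 := hsM _ (rl_pos n)
  have h7 : 0 ≤ Sg N (rr n) * Mm N a (rr n) ^ 2 := mul_nonneg (Sg_nonneg (rr_pos n)) (sq_nonneg _)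
  have h8 := mul_le_mul_of_nonneg_left h5 (show 0 ≤ 2 * I by linarith)
  change _ ≤ 2 * I * I at h8
  linarith
lemma Sp_cont (hN : 2 ≤ N) (q : ℝ) : ContinuousOn (fun x => Sg N x ^ q) IP :=
  (Sg_cont hN).rpow_const fun x hx => Or.inl (Sg_pos hN hx).ne'
lemma Sp_eq (hN : 2 ≤ N) (p : ℝ) {x : ℝ} (hx : 0 < x) :
    Pw N x * Sg N x ^ (p / 2) * √(Sg N x) = Pw N x * Sg N x ^ ((p + 1) / 2) := by
  rw [sqrt_eq_rpow, mul_assoc, ← rpow_add (Sg_pos hN hx)]; congr 2; ring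
lemma Sp_int (hN : 2 ≤ N) {p : ℝ} (hp : 1 < p) (hsub : ((N:ℝ) - 2) * p < N + 2) :
    IntegrableOn (fun x => Pw N x * Sg N x ^ (p / 2) * √(Sg N x)) IP :=
  (k1_int hN hp hsub).congr_fun (fun _ hx => (Sp_eq hN p hx).symm) mI
/-- dominating mass -/
noncomputable def Aa (N : ℕ) (p : ℝ) : ℝ → ℝ := Mm N (fun x => Sg N x ^ (p / 2))
lemma M_hold (hN : 2 ≤ N) {m : ℝ} (hm : 0 < m) {u : ℝ → ℝ}
    (hk : IntegrableOn (fun r => Pw N r * Sg N r ^ ((1 / m + 1) / 2)) IP)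
    (hc : ContinuousOn u IP) (h0 : ∀ x > 0, 0 ≤ u x)
    (hf : IntegrableOn (fun x => Pw N x * u x ^ (m + 1)) IP) {f : ℝ} (hf0 : 0 < f)
    (hfe : ∫ x in IP, Pw N x * u x ^ (m + 1) = f) :
    IntegrableOn (fun x => Pw N x * u x * √(Sg N x)) IP ∧
    ∫ x in IP, Pw N x * u x * √(Sg N x) ≤
      f ^ (1 / (m + 1)) * (1 + ∫ r in IP, Pw N r * Sg N r ^ ((1 / m + 1) / 2)) := by
  set L := f ^ (1 / (m + 1)) with hL
  have hL0 : 0 < L := by positivity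
  have hb : ∀ x ∈ Ioi (0:ℝ), Pw N x * u x * √(Sg N x) ≤
      L * (Pw N x * u x ^ (m + 1) / f + Pw N x * Sg N x ^ ((1 / m + 1) / 2)) := by
    intro x hx
    have hs := Sg_pos hN hx
    have hP := Pp N hx
    have hu := h0 x hx
    have hpq : (m + 1).HolderConjugate (1 / m + 1) := by
      rw [holderConjugate_iff]; refine ⟨by linarith, ?_⟩; field_simp; ring
    have hy := young_inequality_of_nonneg (div_nonneg hu hL0.le) (sqrt_nonneg (Sg N x)) hpq
    have e1 : (u x / L) ^ (m + 1) = u x ^ (m + 1) / f := by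
      rw [div_rpow hu hL0.le, hL, ← rpow_mul hf0.le]; congr 1
      rw [one_div_mul_cancel (by linarith), rpow_one]
    have e2 : √(Sg N x) ^ (1 / m + 1) = Sg N x ^ ((1 / m + 1) / 2) := by
      rw [sqrt_eq_rpow, ← rpow_mul hs.le]; congr 1; ring
    rw [e1, e2] at hy
    have hm1 : 0 < 1 / m := by positivity
    have i1 : u x ^ (m + 1) / f / (m + 1) ≤ u x ^ (m + 1) / f := div_le_self (by positivity) (by linarith)
    have i2 : Sg N x ^ ((1 / m + 1) / 2) / (1 / m + 1) ≤ Sg N x ^ ((1 / m + 1) / 2) :=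
      div_le_self (by positivity) (by linarith)
    calc Pw N x * u x * √(Sg N x) = L * Pw N x * (u x / L * √(Sg N x)) := by field_simp
      _ ≤ L * Pw N x * (u x ^ (m + 1) / f + Sg N x ^ ((1 / m + 1) / 2)) := by gcongr; linarith
      _ = _ := by ring
  have hint : IntegrableOn (fun x => L * (Pw N x * u x ^ (m + 1) / f + Pw N x * Sg N x ^ ((1 / m + 1) / 2))) IP :=
    ((hf.div_const f).add hk).const_mul L
  have hi : IntegrableOn (fun x => Pw N x * u x * √(Sg N x)) IP := by
    refine Integrable.mono' hint ((((Pw_cont N).continuousOn.mul hc).mul (sqS_cont hN)).aestronglyMeasurable mI) ?_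
    filter_upwards [ae_restrict_mem mI] with x hx
    rw [norm_of_nonneg (mul_nonneg (mul_nonneg (Pw_pos hx).le (h0 x hx)) (sqrt_nonneg _))]
    exact hb x hx
  refine ⟨hi, (setIntegral_mono_on hi hint mI hb).trans (le_of_eq ?_)⟩
  rw [integral_const_mul, integral_add (hf.div_const f) hk, integral_div, hfe, div_self hf0.ne']
end

section
open Real
variable {N : ℕ} {r : ℝ} {t : ℝ}
lemma CS_diff (hN : 2 ≤ N) {y g : ℝ → ℝ} (hd : ∀ r > 0, HasDerivAt y (g r) r)
    (hg : ContinuousOn g IP) (hi : IntegrableOn (fun x => Pw N x * g x ^ 2) IP) {r q : ℝ}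
    (hr : 0 < r) (hq : r ≤ q) :
    (y r - y q) ^ 2 ≤ (∫ x in IP, Pw N x * g x ^ 2) * (Sg N r - Sg N q) := by
  rcases hq.eq_or_lt with rfl | hq'
  · simp
  have hq0 := hr.trans_le hq
  have hS : 0 < Sg N r - Sg N q := sub_pos.2 (Sg_strictAnti hN hr hq0 hq')
  set S := Sg N r - Sg N q with hSd
  have hS2 : S = ∫ x in r..q, (Pw N x)⁻¹ := Sg_sub hN hr hq0
  have hy : y q - y r = ∫ x in r..q, g x :=
    (intervalIntegral.integral_eq_sub_of_hasDerivAt (fun x hx => hd x (uIcc_sub_Ioi hr hq0 hx)) (ii_of_cont hg hr hq0)).symm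
  set l := (y r - y q) / S with hl
  have hPg : ContinuousOn (fun x => Pw N x * g x ^ 2) IP := (Pw_cont N).continuousOn.mul (hg.pow 2)
  have h1 : 0 ≤ ∫ x in r..q, (Pw N x * g x ^ 2 + 2 * l * g x + l ^ 2 * (Pw N x)⁻¹) := by
    refine intervalIntegral.integral_nonneg hq fun x hx => ?_
    have hP := Pp N (hr.trans_le hx.1)
    have : Pw N x * g x ^ 2 + 2 * l * g x + l ^ 2 * (Pw N x)⁻¹ = Pw N x * (g x + l * (Pw N x)⁻¹) ^ 2 := by
      field_simp; ring
    rw [this]; positivity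
  have i1 := ii_of_cont hPg hr hq0
  have i2 : IntervalIntegrable (fun x => 2 * l * g x) volume r q := (ii_of_cont hg hr hq0).const_mul _
  have i3 : IntervalIntegrable (fun x => l ^ 2 * (Pw N x)⁻¹) volume r q := (ii_of_cont PwInv_cont hr hq0).const_mul _
  rw [intervalIntegral.integral_add (i1.add i2) i3, intervalIntegral.integral_add i1 i2,
    intervalIntegral.integral_const_mul, intervalIntegral.integral_const_mul, ← hy, ← hS2] at h1
  have h2 := trunc_le hi (fun x hx => mul_nonneg (Pw_pos hx).le (sq_nonneg _)) hr.le hq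
  have h3 : 2 * l * (y q - y r) + l ^ 2 * S = - (y r - y q) ^ 2 / S := by rw [hl]; field_simp; ring
  have h4 : (y r - y q) ^ 2 / S ≤ ∫ x in IP, Pw N x * g x ^ 2 := by
    have : -(y r - y q) ^ 2 / S = - ((y r - y q) ^ 2 / S) := by ring
    linarith
  rwa [div_le_iff₀ hS] at h4
lemma y_inf {y g : ℝ → ℝ} (hd : ∀ r > 0, HasDerivAt y (g r) r)
    (hg : ContinuousOn g IP) (hi : IntegrableOn (fun x => Pw N x * g x ^ 2) IP)
    (hi2 : IntegrableOn (fun x => Pw N x * y x ^ 2) IP) : Tendsto y atTop (𝓝 0) := by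
  have hyc : ContinuousOn y IP := fun r hr => (hd r hr).continuousAt.continuousWithinAt
  have hsub : Ioi (1:ℝ) ⊆ IP := Ioi_subset_Ioi zero_le_one
  have hP1 := Pp N one_pos
  have h := tendsto_zero_of_hasDerivAt_of_integrableOn_Ioi (f := fun x => y x ^ 2) (f' := fun x => 2 * y x * g x) (a := 1)
    (fun x hx => ((hd x (hsub hx)).pow 2).congr_deriv (by simp)) ?_ ?_
  · have := h.sqrt
    simp only [sqrt_sq_eq_abs, sqrt_zero] at this
    exact tendsto_zero_iff_abs_tendsto_zero _ |>.2 this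
  · refine Integrable.mono' (((hi.add hi2).mono_set hsub).const_mul (Pw N 1)⁻¹)
      ((((continuousOn_const.mul hyc).mul hg).mono hsub).aestronglyMeasurable mI) ?_
    filter_upwards [ae_restrict_mem mI] with x hx
    have hP : Pw N 1 ≤ Pw N x := Pw_mono zero_le_one (le_of_lt hx)
    rw [inv_mul_eq_div, le_div_iff₀ hP1, norm_eq_abs, abs_mul, abs_mul, abs_two]
    simp only [Pi.add_apply]
    have : 2 * |y x| * |g x| ≤ g x ^ 2 + y x ^ 2 := by
      nlinarith [sq_abs (y x), sq_abs (g x), sq_nonneg (|y x| - |g x|)]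
    nlinarith [sq_nonneg (y x), sq_nonneg (g x)]
  · refine Integrable.mono' ((hi2.mono_set hsub).const_mul (Pw N 1)⁻¹)
      (((hyc.pow 2).mono hsub).aestronglyMeasurable mI) ?_
    filter_upwards [ae_restrict_mem mI] with x hx
    have hP : Pw N 1 ≤ Pw N x := Pw_mono zero_le_one (le_of_lt hx)
    rw [inv_mul_eq_div, le_div_iff₀ hP1, norm_eq_abs]
    simp only [abs_pow, sq_abs]
    nlinarith [sq_nonneg (y x)]
lemma y_sq_le (hN : 2 ≤ N) {y g : ℝ → ℝ} (hd : ∀ r > 0, HasDerivAt y (g r) r)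
    (hg : ContinuousOn g IP) (hi : IntegrableOn (fun x => Pw N x * g x ^ 2) IP)
    (h0 : Tendsto y atTop (𝓝 0)) (hr : 0 < r) :
    y r ^ 2 ≤ (∫ x in IP, Pw N x * g x ^ 2) * Sg N r := by
  have h1 : Tendsto (fun q => (y r - y q) ^ 2) atTop (𝓝 ((y r - 0) ^ 2)) := (h0.const_sub _).pow 2
  have h2 : Tendsto (fun q => (∫ x in IP, Pw N x * g x ^ 2) * (Sg N r - Sg N q)) atTop
    (𝓝 ((∫ x in IP, Pw N x * g x ^ 2) * (Sg N r - 0))) := ((Sg_tendsto hN).const_sub _).const_mul _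
  rw [sub_zero] at h1 h2
  refine le_of_tendsto_of_tendsto h1 h2 ?_
  filter_upwards [eventually_ge_atTop r] with q hq using CS_diff hN hd hg hi hr hq
/-- the facts about the solution which are used later -/
structure FDFlow (N : ℕ) (m T : ℝ) (u g ut : ℝ → ℝ → ℝ) : Prop where
  upos : ∀ r > 0, ∀ t ∈ Ioo 0 T, 0 < u r t
  ucont : ContinuousOn (fun q : ℝ × ℝ => u q.1 q.2) (IP ×ˢ Ioo 0 T)
  gcont : ContinuousOn (fun q : ℝ × ℝ => g q.1 q.2) (IP ×ˢ Ioo 0 T)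
  utcont : ContinuousOn (fun q : ℝ × ℝ => ut q.1 q.2) (IP ×ˢ Ioo 0 T)
  bd : ∀ t1 t2 R : ℝ, 0 < t1 → t2 < T → ∃ C, ∀ r ∈ Ioc 0 R, ∀ t ∈ Icc t1 t2,
    u r t ≤ C ∧ |g r t| ≤ C ∧ |ut r t| ≤ C
  lbd : ∀ t R : ℝ, t ∈ Ioo 0 T → ∃ c > 0, ∀ r ∈ Ioc 0 R, c ≤ u r t
  vr : ∀ r > 0, ∀ t ∈ Ioo 0 T, HasDerivAt (fun x => u x t ^ m) (g r t) r
  uder : ∀ r > 0, ∀ t ∈ Ioo 0 T, HasDerivAt (fun τ => u r τ) (ut r t) t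
  Pg : ∀ r > 0, ∀ t ∈ Ioo 0 T, HasDerivAt (fun x => Pw N x * g x t) (Pw N r * ut r t) r
  gint : ∀ t ∈ Ioo 0 T, IntegrableOn (fun x => Pw N x * g x t ^ 2) IP
  Dbd : ∀ ε ∈ Ioo 0 T, ∃ C, ∀ t ∈ Ico ε T, ∫ x in IP, Pw N x * g x t ^ 2 ≤ C
  vinf : ∀ t ∈ Ioo 0 T, Tendsto (fun r => u r t ^ m) atTop (𝓝 0)
  uT : ∀ r > 0, Tendsto (fun t => u r t) (𝓝[<] T) (𝓝 0)
lemma flow_exists (hN : 2 ≤ N) {m T : ℝ} (hT : 0 < T) {u : ℝ → ℝ → ℝ}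
    (hu : IsRadialEnergySolution N m T u) : ∃ g ut, FDFlow N m T u g ut := by
  set S : Set (ℝ × ℝ) := Ici 0 ×ˢ Ioo 0 T with hS
  have hSu : UniqueDiffOn ℝ S := (uniqueDiffOn_Ici 0).prod isOpen_Ioo.uniqueDiffOn
  set U : ℝ × ℝ → ℝ := fun q => u q.1 q.2 with hU
  set W : ℝ × ℝ → ℝ := fun q => u q.1 q.2 ^ m with hW
  have hUs : ContDiffOn ℝ (⊤ : ℕ∞) U S := hu.smooth
  have hWs : ContDiffOn ℝ (⊤ : ℕ∞) W S := hUs.rpow_const_of_ne fun q hq => (hu.pos q.1 hq.1 q.2 hq.2).ne'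
  have hUc := hUs.continuousOn_fderivWithin hSu (by simp)
  have hWc := hWs.continuousOn_fderivWithin hSu (by simp)
  have hsub : (IP ×ˢ Ioo 0 T : Set (ℝ × ℝ)) ⊆ S := prod_mono Ioi_subset_Ici_self le_rfl
  have hnh : ∀ r > 0, ∀ t ∈ Ioo 0 T, S ∈ 𝓝 (r, t) := fun r hr t ht =>
    mem_of_superset (prod_mem_nhds (Ioi_mem_nhds hr) (isOpen_Ioo.mem_nhds ht)) hsub
  set g : ℝ → ℝ → ℝ := fun r t => fderivWithin ℝ W S (r, t) (1, 0) with hg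
  set ut : ℝ → ℝ → ℝ := fun r t => fderivWithin ℝ U S (r, t) (0, 1) with hut
  have hgc : ContinuousOn (fun q : ℝ × ℝ => g q.1 q.2) S := hWc.clm_apply continuousOn_const
  have hutc : ContinuousOn (fun q : ℝ × ℝ => ut q.1 q.2) S := hUc.clm_apply continuousOn_const
  have hvr : ∀ r > 0, ∀ t ∈ Ioo 0 T, HasDerivAt (fun x => u x t ^ m) (g r t) r := fun r hr t ht => by
    have h1 : HasFDerivAt W (fderivWithin ℝ W S (r, t)) (r, t) :=
      ((hWs.differentiableOn (by simp)) (r, t) (hsub ⟨hr, ht⟩)).hasFDerivWithinAt.hasFDerivAt (hnh r hr t ht)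
    exact HasFDerivAt.comp_hasDerivAt (f := fun x => (x, t)) (l := W) r h1 ((hasDerivAt_id r).prodMk (hasDerivAt_const r t))
  have huder : ∀ r > 0, ∀ t ∈ Ioo 0 T, HasDerivAt (fun τ => u r τ) (ut r t) t := fun r hr t ht => by
    have h1 : HasFDerivAt U (fderivWithin ℝ U S (r, t)) (r, t) :=
      ((hUs.differentiableOn (by simp)) (r, t) (hsub ⟨hr, ht⟩)).hasFDerivWithinAt.hasFDerivAt (hnh r hr t ht)
    exact HasFDerivAt.comp_hasDerivAt (f := fun x => (r, x)) (l := U) t h1 ((hasDerivAt_const t r).prodMk (hasDerivAt_id t))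
  have hgE : ∀ t ∈ Ioo 0 T, ∀ r > 0, deriv (fun x => u x t ^ m) r = g r t := fun t ht r hr => (hvr r hr t ht).deriv
  have hgct : ∀ t ∈ Ioo 0 T, ContinuousOn (fun x => g x t) IP := fun t ht =>
    hgc.comp (f := fun x => (x, t)) (by fun_prop) fun x hx => ⟨le_of_lt (show (0:ℝ) < x from hx), ht⟩
  have hint : ∀ t ∈ Ioo 0 T, IntegrableOn (fun x => Pw N x * g x t ^ 2) IP := fun t ht =>
    (hu.energy t ht).2.2.congr_fun (fun x hx => by simp only [hgE t ht x hx, Pw]; ring) mI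
  refine ⟨g, ut, ⟨fun r hr t ht => hu.pos r (le_of_lt (show (0:ℝ) < r from hr)) t ht, hUs.continuousOn.mono hsub, hgc.mono hsub, hutc.mono hsub, ?_, ?_, hvr, huder, ?_, hint, ?_, ?_, ?_⟩⟩
  · intro t1 t2 R h1 h2
    have hK : IsCompact (Icc 0 R ×ˢ Icc t1 t2 : Set (ℝ × ℝ)) := isCompact_Icc.prod isCompact_Icc
    have hKS : (Icc 0 R ×ˢ Icc t1 t2 : Set (ℝ × ℝ)) ⊆ S := fun q hq =>
      ⟨hq.1.1, h1.trans_le hq.2.1, hq.2.2.trans_lt h2⟩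
    obtain ⟨C1, hC1⟩ := hK.exists_bound_of_continuousOn (hUs.continuousOn.mono hKS)
    obtain ⟨C2, hC2⟩ := hK.exists_bound_of_continuousOn (hgc.mono hKS)
    obtain ⟨C3, hC3⟩ := hK.exists_bound_of_continuousOn (hutc.mono hKS)
    refine ⟨max C1 (max C2 C3), fun r hr t ht => ?_⟩
    have hm : (r, t) ∈ (Icc 0 R ×ˢ Icc t1 t2 : Set (ℝ × ℝ)) := ⟨⟨hr.1.le, hr.2⟩, ht⟩
    exact ⟨(le_abs_self _).trans ((hC1 _ hm).trans (le_max_left _ _)), (hC2 _ hm).trans ((le_max_left _ _).trans (le_max_right _ _)),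
      (hC3 _ hm).trans ((le_max_right _ _).trans (le_max_right _ _))⟩
  · intro t R ht
    rcases le_or_gt R 0 with hR | hR
    · exact ⟨1, one_pos, fun r hr => absurd (hr.1.trans_le hr.2) (not_lt.2 hR)⟩
    obtain ⟨x, hx, hxm⟩ := isCompact_Icc.exists_isMinOn (nonempty_Icc.2 hR.le)
      (hUs.continuousOn.comp (f := fun x => (x, t)) (s := Icc 0 R) (by fun_prop) fun x hx => ⟨hx.1, ht⟩)
    exact ⟨u x t, hu.pos x hx.1 t ht, fun r hr => hxm ⟨hr.1.le, hr.2⟩⟩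
  · intro r hr t ht
    have hφ : ContDiffOn ℝ (⊤ : ℕ∞) (fun x => u x t ^ m) IP :=
      hWs.comp (f := fun x => (x, t)) (by fun_prop) fun x hx => ⟨le_of_lt (show (0:ℝ) < x from hx), ht⟩
    have hd : DifferentiableAt ℝ (deriv (fun x => u x t ^ m)) r :=
      ((hφ.deriv_of_isOpen (m := 1) isOpen_Ioi (WithTop.coe_le_coe.2 (le_top (a := (1 + 1 : ℕ∞))))).differentiableOn (by simp)).differentiableAt (Ioi_mem_nhds hr)
    have h1 := (Pw_hasDeriv hN hr).mul hd.hasDerivAt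
    have h2 : HasDerivAt (fun x => Pw N x * g x t) _ r := h1.congr_of_eventuallyEq (by
      filter_upwards [Ioi_mem_nhds hr] with x hx
      simp only [Pi.mul_apply, hgE t ht x hx])
    refine h2.congr_deriv ?_
    have := hu.pde r hr t ht
    rw [(huder r hr t ht).deriv] at this
    rw [this]; ring
  · intro ε hε
    obtain ⟨C, hC⟩ := hu.energy_bdd ε hε
    refine ⟨C, fun t ht => le_trans ?_ (hC t ht)⟩
    have ht' : t ∈ Ioo 0 T := ⟨hε.1.trans_le ht.1, ht.2⟩
    have e1 : ∫ x in IP, Pw N x * g x t ^ 2 = ∫ s in Ioi (0:ℝ), (deriv (fun ρ => u ρ t ^ m) s) ^ 2 * sinh s ^ (N - 1) :=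
      setIntegral_congr_fun mI fun x hx => by simp only [hgE t ht' x hx, Pw]; ring
    have e2 : 0 ≤ ∫ s in Ioi (0:ℝ), (u s t ^ m) ^ 2 * sinh s ^ (N - 1) :=
      setIntegral_nonneg mI fun x hx => mul_nonneg (sq_nonneg _) (Pw_nonneg (N := N) (le_of_lt hx))
    rw [e1, H1normSq]
    linarith
  · intro t ht
    refine y_inf (N := N) (fun r hr => hvr r hr t ht) (hgct t ht) (hint t ht) ?_
    exact (hu.energy t ht).2.1.congr_fun (fun x hx => by simp only [Pw]; ring) mI
  · intro r hr
    have h1 := hu.continuousOn.comp (f := fun t => (r, t)) (s := Icc 0 T) (by fun_prop) fun t ht => ⟨le_of_lt hr, ht⟩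
    have h2 := h1 T ⟨hT.le, le_rfl⟩
    rw [ContinuousWithinAt] at h2
    simp only [Function.comp_def, hu.extinction r (le_of_lt hr)] at h2
    rw [← nhdsWithin_Ioo_eq_nhdsLT hT]
    exact h2.mono_left (nhdsWithin_mono _ Ioo_subset_Icc_self)
end

section
open Real
variable {r : ℝ} {t : ℝ}
lemma tail_le {φ ψ : ℝ → ℝ} (hφ : IntegrableOn φ IP) (hψ : IntegrableOn ψ IP)
    (hb : ∀ x > 0, |φ x| ≤ ψ x) {ρ R : ℝ} (hρ : 0 < ρ) (hR : ρ ≤ R) :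
    |(∫ x in IP, φ x) - ∫ x in ρ..R, φ x| ≤ (∫ x in IP, ψ x) - ∫ x in ρ..R, ψ x := by
  rw [intervalIntegral.integral_of_le hR, intervalIntegral.integral_of_le hR,
    ← setIntegral_sdiff measurableSet_Ioc hφ (Ioc_sub_Ioi hρ), ← setIntegral_sdiff measurableSet_Ioc hψ (Ioc_sub_Ioi hρ)]
  rw [← norm_eq_abs]
  refine (norm_integral_le_integral_norm _).trans ?_
  exact setIntegral_mono_on (hφ.mono_set sdiff_subset).norm (hψ.mono_set sdiff_subset) (mI.diff measurableSet_Ioc)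
    fun x hx => hb x hx.1
lemma rpow_bd {x q : ℝ} (hx : 0 ≤ x) {m : ℝ} (hm : 0 < m) (h : (x ^ m) ^ 2 ≤ q) : x ≤ q ^ (1 / m / 2) := by
  have h1 : 0 ≤ x ^ m := rpow_nonneg hx m
  have h2 : ((x ^ m) ^ 2) ^ (1 / m / 2) = x := by
    rw [← rpow_natCast, ← rpow_mul hx, ← rpow_mul hx]
    rw [show m * ((2:ℕ):ℝ) * (1 / m / 2) = 1 by push_cast; field_simp, rpow_one]
  calc x = ((x ^ m) ^ 2) ^ (1 / m / 2) := h2.symm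
    _ ≤ _ := rpow_le_rpow (by positivity) h (by positivity)
section
variable {N : ℕ} {m T : ℝ} {u g ut : ℝ → ℝ → ℝ}
lemma uslice (h : FDFlow N m T u g ut) (ht : t ∈ Ioo 0 T) : ContinuousOn (fun x => u x t) IP :=
  h.ucont.comp (f := fun x => (x, t)) (by fun_prop) fun x hx => ⟨hx, ht⟩
lemma gslice (h : FDFlow N m T u g ut) (ht : t ∈ Ioo 0 T) : ContinuousOn (fun x => g x t) IP :=
  h.gcont.comp (f := fun x => (x, t)) (by fun_prop) fun x hx => ⟨hx, ht⟩
lemma utslice (h : FDFlow N m T u g ut) (ht : t ∈ Ioo 0 T) : ContinuousOn (fun x => ut x t) IP :=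
  h.utcont.comp (f := fun x => (x, t)) (by fun_prop) fun x hx => ⟨hx, ht⟩
lemma vslice (h : FDFlow N m T u g ut) (ht : t ∈ Ioo 0 T) (q : ℝ) : ContinuousOn (fun x => u x t ^ q) IP :=
  (uslice h ht).rpow_const fun x hx => Or.inl (h.upos x hx t ht).ne'
lemma v_le (hN : 2 ≤ N) (h : FDFlow N m T u g ut) (ht : t ∈ Ioo 0 T) (hr : 0 < r) :
    (u r t ^ m) ^ 2 ≤ (∫ x in IP, Pw N x * g x t ^ 2) * Sg N r :=
  y_sq_le hN (fun x hx => h.vr x hx t ht) (gslice h ht) (h.gint t ht) (h.vinf t ht) hr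
lemma u_bd (hN : 2 ≤ N) (hm : 0 < m) (h : FDFlow N m T u g ut) {ε : ℝ} (hε : ε ∈ Ioo 0 T) :
    ∃ K > 0, ∀ t ∈ Ico ε T, ∀ r > 0, u r t ≤ K * Sg N r ^ (1 / m / 2) ∧ u r t ^ m ≤ K * √(Sg N r) := by
  obtain ⟨C, hC⟩ := h.Dbd ε hε
  set C' := max C 1
  have hC' : 0 < C' := lt_max_of_lt_right one_pos
  refine ⟨max (C' ^ (1 / m / 2)) (√C'), lt_max_of_lt_right (sqrt_pos.2 hC'), fun t ht r hr => ?_⟩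
  have ht' : t ∈ Ioo 0 T := ⟨hε.1.trans_le ht.1, ht.2⟩
  have hs := Sg_pos hN hr
  have h1 : (u r t ^ m) ^ 2 ≤ C' * Sg N r := (v_le hN h ht' hr).trans (by gcongr; exact (hC t ht).trans (le_max_left _ _))
  have hu := (h.upos r hr t ht').le
  constructor
  · refine (rpow_bd hu hm h1).trans ?_
    rw [mul_rpow hC'.le hs.le]
    gcongr; exact le_max_left _ _
  · have := abs_le_sqrt h1
    rw [sqrt_mul hC'.le] at this
    refine (le_abs_self _).trans (this.trans ?_)
    gcongr; exact le_max_right _ _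
lemma dom_int (hk : IntegrableOn (fun x => Pw N x * Sg N x ^ (1 / m / 2) * √(Sg N x)) IP) {a : ℝ → ℝ} (ha : ContinuousOn a IP) {K : ℝ}
    (hb : ∀ x > 0, |a x| ≤ K * (Sg N x ^ (1 / m / 2) * √(Sg N x))) : IntegrableOn (fun x => Pw N x * a x) IP := by
  refine Integrable.mono' (hk.const_mul K) (((Pw_cont N).continuousOn.mul ha).aestronglyMeasurable mI) ?_
  filter_upwards [ae_restrict_mem mI] with x hx
  have hP := Pp N hx
  rw [norm_eq_abs, abs_mul, abs_of_pos hP]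
  calc Pw N x * |a x| ≤ Pw N x * (K * (Sg N x ^ (1 / m / 2) * √(Sg N x))) := by gcongr; exact hb x hx
    _ = _ := by ring
/-- standing integrability facts -/
lemma u_int (hN : 2 ≤ N) (hm : 0 < m) (hk : IntegrableOn (fun x => Pw N x * Sg N x ^ (1 / m / 2) * √(Sg N x)) IP)
    (h : FDFlow N m T u g ut) (ht : t ∈ Ioo 0 T) :
    IntegrableOn (fun x => Pw N x * u x t * √(Sg N x)) IP := by
  obtain ⟨K, hK, hb⟩ := u_bd hN hm h ht
  have := dom_int (m := m) hk (a := fun x => u x t * √(Sg N x)) ((uslice h ht).mul (sqS_cont hN)) (K := K) fun x hx => by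
    rw [abs_of_nonneg (mul_nonneg (h.upos x hx t ht).le (sqrt_nonneg _)), ← mul_assoc]
    gcongr; exact (hb t ⟨le_rfl, ht.2⟩ x hx).1
  simpa only [mul_assoc] using this
lemma Mu_int (hN : 2 ≤ N) (hm : 0 < m) (hk : IntegrableOn (fun x => Pw N x * Sg N x ^ (1 / m / 2) * √(Sg N x)) IP)
    (h : FDFlow N m T u g ut) (ht : t ∈ Ioo 0 T) (hr : 0 ≤ r) :
    IntervalIntegrable (fun x => Pw N x * u x t) volume 0 r :=
  Mint hN (uslice h ht) (fun x hx => (h.upos x hx t ht).le) (u_int hN hm hk h ht) hr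
lemma Mu_dr (hN : 2 ≤ N) (hm : 0 < m) (hk : IntegrableOn (fun x => Pw N x * Sg N x ^ (1 / m / 2) * √(Sg N x)) IP)
    (h : FDFlow N m T u g ut) (ht : t ∈ Ioo 0 T) (hr : 0 < r) :
    HasDerivAt (Mm N (fun x => u x t)) (Pw N r * u r t) r :=
  M_deriv (uslice h ht) hr (Mu_int hN hm hk h ht hr.le)
lemma Mm_dom (hN : 2 ≤ N) (hk : IntegrableOn (fun x => Pw N x * Sg N x ^ (1 / m / 2) * √(Sg N x)) IP)
    {a : ℝ → ℝ} {K : ℝ} (hb : ∀ x > 0, |a x| ≤ K * Sg N x ^ (1 / m / 2)) (hr : 0 < r) : |Mm N a r| ≤ K * Aa N (1 / m) r := by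
  unfold Aa Mm
  rw [← intervalIntegral.integral_const_mul, ← norm_eq_abs]
  refine intervalIntegral.norm_integral_le_of_norm_le hr.le (Eventually.of_forall fun x hx => ?_)
    ((Mint hN (Sp_cont hN _) (fun x hx => (rpow_nonneg (Sg_pos hN hx).le _)) hk hr.le).const_mul _)
  have hP := Pp N hx.1
  rw [norm_eq_abs, abs_mul, abs_of_pos hP]
  calc Pw N x * |a x| ≤ Pw N x * (K * Sg N x ^ (1 / m / 2)) := by gcongr; exact hb x hx.1
    _ = _ := by ring
lemma Mu_dt (hN : 2 ≤ N) (hm : 0 < m) (hk : IntegrableOn (fun x => Pw N x * Sg N x ^ (1 / m / 2) * √(Sg N x)) IP)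
    (h : FDFlow N m T u g ut) (ht : t ∈ Ioo 0 T) (hr : 0 < r) :
    HasDerivAt (fun τ => Mm N (fun x => u x τ) r) (Pw N r * g r t) t := by
  obtain ⟨δ, hδ, hδ2⟩ := Metric.isOpen_iff.1 isOpen_Ioo t ht
  have hsub : Icc (t - δ / 2) (t + δ / 2) ⊆ Ioo 0 T := fun x hx => hδ2 (by
    rw [Metric.mem_ball, dist_eq, abs_lt]; constructor <;> linarith [hx.1, hx.2])
  obtain ⟨C, hC⟩ := h.bd (t - δ / 2) (t + δ / 2) r (hsub ⟨le_rfl, by linarith⟩).1 (hsub ⟨by linarith, le_rfl⟩).2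
  have hnb : Icc (t - δ / 2) (t + δ / 2) ∈ 𝓝 t := Icc_mem_nhds (by linarith) (by linarith)
  have hutm : AEStronglyMeasurable (fun x => Pw N x * ut x t) (volume.restrict (uIoc 0 r)) := by
    rw [uIoc_of_le hr.le]
    exact (((Pw_cont N).continuousOn.mul (utslice h ht)).mono fun x hx => hx.1).aestronglyMeasurable measurableSet_Ioc
  have key := intervalIntegral.hasDerivAt_integral_of_dominated_loc_of_deriv_le (μ := volume) (a := 0) (b := r)
    (F := fun τ x => Pw N x * u x τ) (F' := fun τ x => Pw N x * ut x τ) (bound := fun x => Pw N r * C) hnb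
    (by
      filter_upwards [hnb] with τ hτ
      exact (Mu_int hN hm hk h (hsub hτ) hr.le).aestronglyMeasurable_restrict_uIoc)
    (Mu_int hN hm hk h ht hr.le) hutm
    (Eventually.of_forall fun x hx τ hτ => by
      rw [uIoc_of_le hr.le] at hx
      have hP := Pp N hx.1
      rw [norm_eq_abs, abs_mul, abs_of_pos hP]
      exact mul_le_mul (Pw_mono hx.1.le hx.2) (hC x hx τ hτ).2.2 (abs_nonneg _) (Pw_nonneg hr.le))
    (by simp)
    (Eventually.of_forall fun x hx τ hτ => by
      rw [uIoc_of_le hr.le] at hx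
      exact (h.uder x hx.1 τ (hsub hτ)).const_mul _)
  have e : ∫ x in (0:ℝ)..r, Pw N x * ut x t = Pw N r * g r t - 0 := by
    refine intervalIntegral.integral_eq_sub_of_hasDerivAt_of_tendsto (f := fun x => Pw N x * g x t) hr (fun x hx => h.Pg x hx.1 t ht) key.1 ?_ ?_
    · have hP0 : Tendsto (fun x => Pw N x * C) (𝓝[>] 0) (𝓝 0) := by
        have := ((Pw_cont N).mul continuous_const).continuousAt (x := (0:ℝ)) (f := fun x => Pw N x * C)
        rw [ContinuousAt, Pw_zero hN, zero_mul] at this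
        exact this.mono_left nhdsWithin_le_nhds
      refine squeeze_zero_norm' ?_ hP0
      filter_upwards [Ioc_mem_nhdsGT hr] with x hx
      rw [norm_eq_abs, abs_mul, abs_of_pos (Pw_pos hx.1)]
      exact mul_le_mul_of_nonneg_left (hC x hx t ⟨by linarith, by linarith⟩).2.1 (Pw_pos hx.1).le
    · exact (h.Pg r hr t ht).continuousAt.tendsto.mono_left nhdsWithin_le_nhds
  rw [sub_zero] at e
  rw [← e]
  exact key.2
lemma energy_gen (hN : 2 ≤ N) (hk : IntegrableOn (fun x => Pw N x * Sg N x ^ (1 / m / 2) * √(Sg N x)) IP)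
    {I : Set ℝ} (hI : IsOpen I) {a b b' M : ℝ → ℝ → ℝ} {K : ℝ} (hK : 0 ≤ K)
    (h1 : ∀ r > 0, ∀ t ∈ I, HasDerivAt (fun x => M x t) (Pw N r * a r t) r)
    (h2 : ∀ r > 0, ∀ t ∈ I, HasDerivAt (fun τ => M r τ) (Pw N r * b' r t) t)
    (h3 : ∀ r > 0, ∀ t ∈ I, HasDerivAt (fun x => b x t) (b' r t) r)
    (ca : ∀ t ∈ I, ContinuousOn (fun x => a x t) IP)
    (cb : ContinuousOn (fun q : ℝ × ℝ => b' q.1 q.2) (IP ×ˢ I))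
    (ba : ∀ r > 0, ∀ t ∈ I, |a r t| ≤ K * Sg N r ^ (1 / m / 2))
    (bb : ∀ r > 0, ∀ t ∈ I, |b r t| ≤ K * √(Sg N r))
    (bM : ∀ r > 0, ∀ t ∈ I, |M r t| ≤ K * Aa N (1 / m) r) (ht : t ∈ I) :
    HasDerivAt (fun τ => 1 / 2 * ∫ r in IP, M r τ ^ 2 * (Pw N r)⁻¹) (- ∫ r in IP, Pw N r * (a r t * b r t)) t := by
  have hsp0 : ∀ x > 0, 0 ≤ Sg N x ^ (1 / m / 2) := fun x hx => rpow_nonneg (Sg_pos hN hx).le _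
  have hAc : ContinuousOn (Aa N (1 / m)) IP := fun r hr =>
    (M_deriv (Sp_cont hN _) hr (Mint hN (Sp_cont hN _) hsp0 hk (le_of_lt hr))).continuousAt.continuousWithinAt
  have hMc : ∀ t ∈ I, ContinuousOn (fun x => M x t) IP := fun t ht r hr => (h1 r hr t ht).continuousAt.continuousWithinAt
  have hbc : ∀ t ∈ I, ContinuousOn (fun x => b x t) IP := fun t ht r hr => (h3 r hr t ht).continuousAt.continuousWithinAt
  have hb'c : ∀ t ∈ I, ContinuousOn (fun x => b' x t) IP := fun t ht =>
    cb.comp (f := fun x => (x, t)) (by fun_prop) fun x hx => ⟨hx, ht⟩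
  have hQ : ∀ t ∈ I, ContinuousOn (fun r => M r t ^ 2 * (Pw N r)⁻¹) IP := fun t ht => ((hMc t ht).pow 2).mul PwInv_cont
  have hA2 := (M_sq hN (Sp_cont hN _) hsp0 hk).1
  have hMi : ∀ t ∈ I, IntegrableOn (fun r => M r t ^ 2 * (Pw N r)⁻¹) IP := fun t ht => by
    refine Integrable.mono' (hA2.const_mul (K ^ 2)) ((hQ t ht).aestronglyMeasurable mI) ?_
    filter_upwards [ae_restrict_mem mI] with x hx
    have hP := Pp N hx
    rw [norm_of_nonneg (by positivity), ← mul_assoc, ← mul_pow]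
    have := pow_le_pow_left₀ (abs_nonneg _) (bM x hx t ht) 2
    rw [sq_abs] at this
    exact mul_le_mul_of_nonneg_right this (by positivity)
  have hab : ∀ t ∈ I, ∀ x > 0, |a x t * b x t| ≤ K ^ 2 * (Sg N x ^ (1 / m / 2) * √(Sg N x)) := fun t ht x hx => by
    rw [abs_mul]
    calc |a x t| * |b x t| ≤ (K * Sg N x ^ (1 / m / 2)) * (K * √(Sg N x)) :=
          mul_le_mul (ba x hx t ht) (bb x hx t ht) (abs_nonneg _) (mul_nonneg hK (hsp0 x hx))
      _ = _ := by ring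
  have hPab : ∀ t ∈ I, IntegrableOn (fun x => Pw N x * (a x t * b x t)) IP := fun t ht =>
    dom_int hk ((ca t ht).mul (hbc t ht)) (hab t ht)
  refine hasDerivAt_of_tendstoUniformlyOn (l := atTop) hI
    (f := fun (n : ℕ) τ => 1 / 2 * ∫ r in (rl n)..(rr n), M r τ ^ 2 * (Pw N r)⁻¹)
    (f' := fun n τ => ∫ r in (rl n)..(rr n), M r τ * b' r τ)
    (g' := fun t => - ∫ r in IP, Pw N r * (a r t * b r t)) ?_ ?_ ?_ ht
  · have hz : Tendsto (fun n : ℕ => K ^ 2 * (Aa N (1 / m) (rr n) * √(Sg N (rr n))) + K ^ 2 * (Aa N (1 / m) (rl n) * √(Sg N (rl n))) +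
        ((∫ x in IP, K ^ 2 * (Pw N x * Sg N x ^ (1 / m / 2) * √(Sg N x))) -
          ∫ x in (rl n)..(rr n), K ^ 2 * (Pw N x * Sg N x ^ (1 / m / 2) * √(Sg N x)))) atTop (𝓝 (K ^ 2 * 0 + K ^ 2 * 0 + 0)) := by
      refine Tendsto.add (Tendsto.add ?_ ?_) ?_
      · exact ((M_infty hN (Sp_cont hN _) hsp0 hk).comp rr_tendsto).const_mul _
      · exact ((M_zero hN (Sp_cont hN _) hsp0 hk).comp rl_tendsto).const_mul _
      · have := (tendsto_trunc (hk.const_mul (K ^ 2))).const_sub (∫ x in IP, K ^ 2 * (Pw N x * Sg N x ^ (1 / m / 2) * √(Sg N x)))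
        rwa [sub_self] at this
    simp only [mul_zero, add_zero] at hz
    rw [Metric.tendstoUniformlyOn_iff]
    intro ε hε
    filter_upwards [hz.eventually (gt_mem_nhds hε)] with n hn t ht
    refine lt_of_le_of_lt ?_ hn
    have hip := intervalIntegral.integral_mul_deriv_eq_deriv_mul (a := rl n) (b := rr n)
      (fun x hx => h1 x (uIcc_sub_Ioi (rl_pos n) (rr_pos n) hx) t ht) (fun x hx => h3 x (uIcc_sub_Ioi (rl_pos n) (rr_pos n) hx) t ht)
      (ii_of_cont ((Pw_cont N).continuousOn.mul (ca t ht)) (rl_pos n) (rr_pos n)) (ii_of_cont (hb'c t ht) (rl_pos n) (rr_pos n))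
    have hb1 : ∀ x > 0, |M x t * b x t| ≤ K ^ 2 * (Aa N (1 / m) x * √(Sg N x)) := fun x hx => by
      rw [abs_mul]
      calc _ ≤ (K * Aa N (1 / m) x) * (K * √(Sg N x)) := mul_le_mul (bM x hx t ht) (bb x hx t ht) (abs_nonneg _)
            (mul_nonneg hK (M_nonneg hsp0 (le_of_lt hx)))
        _ = _ := by ring
    have htl := tail_le (hPab t ht) (hk.const_mul (K ^ 2)) (fun x hx => by
      rw [abs_mul, abs_of_pos (Pw_pos hx)]
      have := mul_le_mul_of_nonneg_left (hab t ht x hx) (Pp N hx).le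
      linarith) (rl_pos n) (rl_le n)
    rw [dist_eq, hip]
    have e : ∫ x in (rl n)..(rr n), Pw N x * a x t * b x t = ∫ x in (rl n)..(rr n), Pw N x * (a x t * b x t) := by
      simp only [mul_assoc]
    rw [e]
    have hr1 := hb1 _ (rr_pos n)
    have hr2 := hb1 _ (rl_pos n)
    rw [abs_le] at *
    constructor <;> linarith [hr1.1, hr1.2, hr2.1, hr2.2, htl.1, htl.2]
  · refine Eventually.of_forall fun n t ht => ?_
    obtain ⟨δ, hδ, hδ2⟩ := Metric.isOpen_iff.1 hI t ht
    have hsub : Icc (t - δ / 2) (t + δ / 2) ⊆ I := fun x hx => hδ2 (by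
      rw [Metric.mem_ball, dist_eq, abs_lt]; constructor <;> linarith [hx.1, hx.2])
    have hnb : Icc (t - δ / 2) (t + δ / 2) ∈ 𝓝 t := Icc_mem_nhds (by linarith) (by linarith)
    have hsr := uIcc_sub_Ioi (rl_pos n) (rr_pos n)
    have hKK : IsCompact (uIcc (rl n) (rr n) ×ˢ Icc (t - δ / 2) (t + δ / 2)) := isCompact_uIcc.prod isCompact_Icc
    obtain ⟨C, hC⟩ := hKK.exists_bound_of_continuousOn (cb.mono (prod_mono hsr hsub))
    have key := intervalIntegral.hasDerivAt_integral_of_dominated_loc_of_deriv_le (μ := volume) (a := rl n) (b := rr n)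
      (F := fun τ r => 1 / 2 * (M r τ ^ 2 * (Pw N r)⁻¹)) (F' := fun τ r => M r τ * b' r τ) (x₀ := t)
      (bound := fun r => K * Aa N (1 / m) r * C) hnb
      (by
        filter_upwards [hnb] with τ hτ
        exact ((ii_of_cont (hQ τ (hsub hτ)) (rl_pos n) (rr_pos n)).const_mul _).aestronglyMeasurable_restrict_uIoc)
      ((ii_of_cont (hQ t ht) (rl_pos n) (rr_pos n)).const_mul _)
      (ii_of_cont ((hMc t ht).mul (hb'c t ht)) (rl_pos n) (rr_pos n)).aestronglyMeasurable_restrict_uIoc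
      (Eventually.of_forall fun x hx τ hτ => by
        have hx' := uIoc_subset_uIcc hx
        rw [norm_eq_abs, abs_mul]
        exact mul_le_mul (bM x (hsr hx') τ (hsub hτ)) (hC (x, τ) ⟨hx', hτ⟩) (abs_nonneg _)
          (mul_nonneg hK (M_nonneg hsp0 (le_of_lt (hsr hx')))))
      (ii_of_cont ((continuousOn_const.mul hAc).mul continuousOn_const) (rl_pos n) (rr_pos n))
      (Eventually.of_forall fun x hx τ hτ => by
        have hx' := hsr (uIoc_subset_uIcc hx)
        have hP := Pp N hx'
        refine ((((h2 x hx' τ (hsub hτ)).pow 2).mul_const _).const_mul _).congr_deriv ?_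
        field_simp; norm_num; ring)
    have := key.2
    simp only [intervalIntegral.integral_const_mul] at this
    exact this
  · intro t ht
    exact (tendsto_trunc (hMi t ht)).const_mul _
end
end

section
open Real
variable {r : ℝ} {t : ℝ}
structure FDC (N : ℕ) (m T : ℝ) (u g ut : ℝ → ℝ → ℝ) : Prop where
  hN : 2 ≤ N
  hm : 0 < m
  hm1 : m < 1
  hT : 0 < T
  hsub : ((N:ℝ) - 2) * (1 / m) < N + 2
  fl : FDFlow N m T u g ut
noncomputable def fF (N : ℕ) (m : ℝ) (u : ℝ → ℝ → ℝ) (t : ℝ) : ℝ := ∫ x in IP, Pw N x * (u x t * u x t ^ m)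
noncomputable def hH (N : ℕ) (u : ℝ → ℝ → ℝ) (t : ℝ) : ℝ :=
  1 / 2 * ∫ r in IP, Mm N (fun x => u x t) r ^ 2 * (Pw N r)⁻¹
noncomputable def dD (N : ℕ) (g : ℝ → ℝ → ℝ) (t : ℝ) : ℝ := ∫ x in IP, Pw N x * g x t ^ 2
lemma cpt_nb {I : Set ℝ} (hI : IsOpen I) (ht : t ∈ I) : ∃ δ > 0, Icc (t - δ) (t + δ) ⊆ I := by
  obtain ⟨δ, hδ, hδ2⟩ := Metric.isOpen_iff.1 hI t ht
  exact ⟨δ / 2, by positivity, fun x hx => hδ2 (by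
    rw [Metric.mem_ball, dist_eq, abs_lt]; constructor <;> linarith [hx.1, hx.2])⟩
lemma paramC {φ : ℝ → ℝ → ℝ} {J I : Set ℝ} (hI : IsOpen I)
    (hφ : ContinuousOn (fun q : ℝ × ℝ => φ q.1 q.2) (J ×ˢ I)) {ρ R : ℝ} (hsr : uIcc ρ R ⊆ J) :
    ContinuousOn (fun t => ∫ x in ρ..R, φ x t) I := by
  intro t ht
  obtain ⟨δ, hδ, hs⟩ := cpt_nb hI ht
  have hnb : Icc (t - δ) (t + δ) ∈ 𝓝 t := Icc_mem_nhds (by linarith) (by linarith)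
  obtain ⟨C, hC⟩ := (isCompact_uIcc.prod isCompact_Icc).exists_bound_of_continuousOn (hφ.mono (prod_mono hsr hs))
  have hsl : ∀ τ ∈ I, ContinuousOn (fun x => φ x τ) J := fun τ hτ =>
    hφ.comp (f := fun x => (x, τ)) (by fun_prop) fun x hx => ⟨hx, hτ⟩
  refine (intervalIntegral.continuousAt_of_dominated_interval (bound := fun _ => C) ?_ ?_ (by simp) ?_).continuousWithinAt
  · filter_upwards [hnb] with τ hτ
    exact ((hsl τ (hs hτ)).mono hsr |>.intervalIntegrable).aestronglyMeasurable_restrict_uIoc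
  · filter_upwards [hnb] with τ hτ
    exact Eventually.of_forall fun x hx => hC (x, τ) ⟨uIoc_subset_uIcc hx, hτ⟩
  · refine Eventually.of_forall fun x hx => ?_
    have : ContinuousOn (fun τ => φ x τ) I := hφ.comp (f := fun τ => (x, τ)) (by fun_prop) fun τ hτ => ⟨hsr (uIoc_subset_uIcc hx), hτ⟩
    exact this.continuousAt (hI.mem_nhds ht)
lemma paramD {φ φ' : ℝ → ℝ → ℝ} {J I : Set ℝ} (hI : IsOpen I)
    (hφ : ContinuousOn (fun q : ℝ × ℝ => φ q.1 q.2) (J ×ˢ I))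
    (hφ' : ContinuousOn (fun q : ℝ × ℝ => φ' q.1 q.2) (J ×ˢ I))
    (hd : ∀ x ∈ J, ∀ t ∈ I, HasDerivAt (fun τ => φ x τ) (φ' x t) t) {ρ R : ℝ} (hsr : uIcc ρ R ⊆ J) (ht : t ∈ I) :
    HasDerivAt (fun t => ∫ x in ρ..R, φ x t) (∫ x in ρ..R, φ' x t) t := by
  obtain ⟨δ, hδ, hs⟩ := cpt_nb hI ht
  have hnb : Icc (t - δ) (t + δ) ∈ 𝓝 t := Icc_mem_nhds (by linarith) (by linarith)
  obtain ⟨C, hC⟩ := (isCompact_uIcc.prod isCompact_Icc).exists_bound_of_continuousOn (hφ'.mono (prod_mono hsr hs))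
  have hsl : ∀ τ ∈ I, ContinuousOn (fun x => φ x τ) J := fun τ hτ =>
    hφ.comp (f := fun x => (x, τ)) (by fun_prop) fun x hx => ⟨hx, hτ⟩
  have hsl' : ∀ τ ∈ I, ContinuousOn (fun x => φ' x τ) J := fun τ hτ =>
    hφ'.comp (f := fun x => (x, τ)) (by fun_prop) fun x hx => ⟨hx, hτ⟩
  refine (intervalIntegral.hasDerivAt_integral_of_dominated_loc_of_deriv_le (μ := volume) (bound := fun _ => C) (F' := fun t x => φ' x t) hnb
    ?_ ((hsl t ht).mono hsr |>.intervalIntegrable) ((hsl' t ht).mono hsr |>.intervalIntegrable).aestronglyMeasurable_restrict_uIoc ?_ (by simp) ?_).2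
  · filter_upwards [hnb] with τ hτ
    exact ((hsl τ (hs hτ)).mono hsr |>.intervalIntegrable).aestronglyMeasurable_restrict_uIoc
  · exact Eventually.of_forall fun x hx τ hτ => hC (x, τ) ⟨uIoc_subset_uIcc hx, hτ⟩
  · exact Eventually.of_forall fun x hx τ hτ => hd x (hsr (uIoc_subset_uIcc hx)) τ (hs hτ)
section
variable {N : ℕ} {m T : ℝ} {u g ut : ℝ → ℝ → ℝ}
lemma FDC.hp (h : FDC N m T u g ut) : 1 < 1 / m := (one_lt_div h.hm).2 h.hm1
lemma FDC.hk (h : FDC N m T u g ut) : IntegrableOn (fun x => Pw N x * Sg N x ^ (1 / m / 2) * √(Sg N x)) IP :=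
  Sp_int h.hN h.hp h.hsub
lemma vcont (h : FDC N m T u g ut) (q : ℝ) : ContinuousOn (fun x : ℝ × ℝ => u x.1 x.2 ^ q) (IP ×ˢ Ioo 0 T) :=
  h.fl.ucont.rpow_const fun x hx => Or.inl (h.fl.upos x.1 hx.1 x.2 hx.2).ne'
lemma hH_deriv (h : FDC N m T u g ut) (ht : t ∈ Ioo 0 T) : HasDerivAt (hH N u) (- fF N m u t) t := by
  have hε : t / 2 ∈ Ioo 0 T := ⟨by linarith [ht.1], by linarith [ht.1, ht.2]⟩
  obtain ⟨K, hK, hb⟩ := u_bd h.hN h.hm h.fl hε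
  have hI : ∀ s ∈ Ioo (t / 2) T, s ∈ Ioo 0 T := fun s hs => ⟨hε.1.trans hs.1, hs.2⟩
  have h4 : ∀ r > 0, ∀ s ∈ Ioo (t / 2) T, |u r s| ≤ K * Sg N r ^ (1 / m / 2) := fun r hr s hs => by
    rw [abs_of_pos (h.fl.upos r hr s (hI s hs))]; exact (hb s ⟨hs.1.le, hs.2⟩ r hr).1
  exact energy_gen (m := m) h.hN h.hk (I := Ioo (t / 2) T) isOpen_Ioo (a := u) (b := fun r t => u r t ^ m) (b' := g)
    (M := fun r t => Mm N (fun x => u x t) r) (K := K) hK.le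
    (fun r hr s hs => Mu_dr h.hN h.hm h.hk h.fl (hI s hs) hr)
    (fun r hr s hs => Mu_dt h.hN h.hm h.hk h.fl (hI s hs) hr)
    (fun r hr s hs => h.fl.vr r hr s (hI s hs))
    (fun s hs => uslice h.fl (hI s hs))
    (h.fl.gcont.mono (prod_mono le_rfl hI)) h4
    (fun r hr s hs => by
      rw [abs_of_pos (rpow_pos_of_pos (h.fl.upos r hr s (hI s hs)) _)]; exact (hb s ⟨hs.1.le, hs.2⟩ r hr).2)
    (fun r hr s hs => Mm_dom h.hN h.hk (fun x hx => h4 x hx s hs) hr) ⟨by linarith [ht.1], ht.2⟩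
lemma uv_bd (h : FDC N m T u g ut) {ε : ℝ} (hε : ε ∈ Ioo 0 T) : ∃ K > 0, ∀ t ∈ Ico ε T, ∀ r > 0,
    |u r t * u r t ^ m| ≤ K * (Sg N r ^ (1 / m / 2) * √(Sg N r)) := by
  obtain ⟨K, hK, hb⟩ := u_bd h.hN h.hm h.fl hε
  refine ⟨K * K, by positivity, fun t ht r hr => ?_⟩
  have hu := h.fl.upos r hr t ⟨hε.1.trans_le ht.1, ht.2⟩
  have hs := Sg_pos h.hN hr
  rw [abs_of_pos (by positivity)]
  calc _ ≤ (K * Sg N r ^ (1 / m / 2)) * (K * √(Sg N r)) := by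
        gcongr
        exacts [(hb t ht r hr).1, (hb t ht r hr).2]
    _ = _ := by ring
lemma fF_int (h : FDC N m T u g ut) (ht : t ∈ Ioo 0 T) : IntegrableOn (fun x => Pw N x * (u x t * u x t ^ m)) IP := by
  obtain ⟨K, hK, hb⟩ := uv_bd h ht
  exact dom_int h.hk ((uslice h.fl ht).mul (vslice h.fl ht m)) (hb t ⟨le_rfl, ht.2⟩)
lemma PwSp_dom {a K : ℝ} {x : ℝ} (hx : 0 < x) (hb : |a| ≤ K * (Sg N x ^ (1 / m / 2) * √(Sg N x))) :
    ‖Pw N x * a‖ ≤ K * (Pw N x * Sg N x ^ (1 / m / 2) * √(Sg N x)) := by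
  rw [norm_eq_abs, abs_mul, abs_of_pos (Pw_pos hx)]
  have := mul_le_mul_of_nonneg_left hb (Pp N hx).le
  linarith
lemma fF_cont (h : FDC N m T u g ut) : ContinuousOn (fF N m u) (Ioo 0 T) := by
  intro t ht
  have hε : t / 2 ∈ Ioo 0 T := ⟨by linarith [ht.1], by linarith [ht.1, ht.2]⟩
  obtain ⟨K, hK, hb⟩ := uv_bd h hε
  have hnb : Ioo (t / 2) T ∈ 𝓝 t := Ioo_mem_nhds (by linarith [ht.1]) ht.2
  have hI : ∀ s ∈ Ioo (t / 2) T, s ∈ Ioo 0 T := fun s hs => ⟨hε.1.trans hs.1, hs.2⟩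
  refine ContinuousAt.continuousWithinAt (continuousAt_of_dominated (bound := fun x => K * (Pw N x * Sg N x ^ (1 / m / 2) * √(Sg N x))) ?_ ?_
    (h.hk.const_mul K) ?_)
  · filter_upwards [hnb] with s hs
    exact (fF_int h (hI s hs)).aestronglyMeasurable
  · filter_upwards [hnb] with s hs
    filter_upwards [ae_restrict_mem mI] with x hx
    exact PwSp_dom hx (hb s ⟨hs.1.le, hs.2⟩ x hx)
  · filter_upwards [ae_restrict_mem mI] with x hx
    have hu : ContinuousAt (fun s => u x s) t := (h.fl.uder x hx t ht).continuousAt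
    exact continuousAt_const.mul (hu.mul (hu.rpow_const (Or.inl (h.fl.upos x hx t ht).ne')))
lemma fF_tend (h : FDC N m T u g ut) : Tendsto (fF N m u) (𝓝[<] T) (𝓝 0) := by
  have hε : T / 2 ∈ Ioo 0 T := ⟨by linarith [h.hT], by linarith [h.hT]⟩
  obtain ⟨K, hK, hb⟩ := uv_bd h hε
  have hnb : Ioo (T / 2) T ∈ 𝓝[<] T := Ioo_mem_nhdsLT (by linarith [h.hT])
  have hI : ∀ s ∈ Ioo (T / 2) T, s ∈ Ioo 0 T := fun s hs => ⟨hε.1.trans hs.1, hs.2⟩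
  have := tendsto_integral_filter_of_dominated_convergence (μ := volume.restrict IP) (l := 𝓝[<] T) (F := fun t x => Pw N x * (u x t * u x t ^ m))
    (f := fun _ => (0:ℝ)) (bound := fun x => K * (Pw N x * Sg N x ^ (1 / m / 2) * √(Sg N x)))
    (by
      filter_upwards [hnb] with s hs
      exact (fF_int h (hI s hs)).aestronglyMeasurable)
    (by
      filter_upwards [hnb] with s hs
      filter_upwards [ae_restrict_mem mI] with x hx
      exact PwSp_dom hx (hb s ⟨hs.1.le, hs.2⟩ x hx))
    (h.hk.const_mul K) (by
      filter_upwards [ae_restrict_mem mI] with x hx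
      have h1 := h.fl.uT x hx
      have h2 := h1.rpow_const (p := m) (Or.inr h.hm.le)
      rw [zero_rpow h.hm.ne'] at h2
      simpa using (h1.mul h2).const_mul (Pw N x))
  rw [integral_zero] at this
  exact this
lemma fF_pos (h : FDC N m T u g ut) (ht : t ∈ Ioo 0 T) : 0 < fF N m u t := by
  refine (setIntegral_pos_iff_support_of_nonneg_ae ?_ (fF_int h ht)).2 ?_
  · filter_upwards [ae_restrict_mem mI] with x hx
    have := h.fl.upos x hx t ht
    have := Pp N hx
    simp only [Pi.zero_apply]; positivity
  · have : Function.support (fun x => Pw N x * (u x t * u x t ^ m)) ∩ IP = IP := by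
      refine inter_eq_right.2 fun x hx => ?_
      have := h.fl.upos x hx t ht
      have := Pp N hx
      simp only [Function.mem_support]; positivity
    rw [this]; simp
lemma Mu_nonneg (h : FDC N m T u g ut) (ht : t ∈ Ioo 0 T) (hr : 0 ≤ r) : 0 ≤ Mm N (fun x => u x t) r :=
  M_nonneg (fun x hx => (h.fl.upos x hx t ht).le) hr
lemma hH_int (h : FDC N m T u g ut) (ht : t ∈ Ioo 0 T) :
    IntegrableOn (fun r => Mm N (fun x => u x t) r ^ 2 * (Pw N r)⁻¹) IP :=
  (M_sq h.hN (uslice h.fl ht) (fun x hx => (h.fl.upos x hx t ht).le) (u_int h.hN h.hm h.hk h.fl ht)).1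
lemma hH_le (h : FDC N m T u g ut) : ∃ C > 0, ∀ t ∈ Ioo 0 T, hH N u t ^ ((m + 1) / 2) ≤ C * fF N m u t := by
  have hk' := k1_int h.hN h.hp h.hsub
  set A := 1 + ∫ x in IP, Pw N x * Sg N x ^ ((1 / m + 1) / 2) with hA
  have hA0 : 1 ≤ A := by
    have : 0 ≤ ∫ x in IP, Pw N x * Sg N x ^ ((1 / m + 1) / 2) := setIntegral_nonneg mI fun x hx =>
      mul_nonneg (Pw_nonneg (le_of_lt hx)) (rpow_nonneg (Sg_nonneg hx) _)
    linarith
  have hm := h.hm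
  refine ⟨(3 / 2 * A ^ 2) ^ ((m + 1) / 2), by positivity, fun t ht => ?_⟩
  have hf := fF_pos h ht
  have h0 : ∀ x > 0, 0 ≤ u x t := fun x hx => (h.fl.upos x hx t ht).le
  have e1 : ∀ x ∈ Ioi (0:ℝ), Pw N x * (u x t * u x t ^ m) = Pw N x * u x t ^ (m + 1) := fun x hx => by
    rw [rpow_add_one (h.fl.upos x hx t ht).ne']; ring
  have h1 := M_hold h.hN hm hk' (uslice h.fl ht) h0 ((fF_int h ht).congr_fun e1 mI) hf (by
    unfold fF; exact (setIntegral_congr_fun mI e1).symm)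
  have h2 := (M_sq h.hN (uslice h.fl ht) h0 h1.1).2
  have h3 : hH N u t ≤ (3 / 2 * A ^ 2) * (fF N m u t ^ (1 / (m + 1))) ^ 2 := by
    have h4 : 0 ≤ ∫ x in IP, Pw N x * u x t * √(Sg N x) := setIntegral_nonneg mI fun x hx =>
      mul_nonneg (mul_nonneg (Pw_nonneg (le_of_lt hx)) (h0 x hx)) (sqrt_nonneg _)
    have := pow_le_pow_left₀ h4 h1.2 2
    unfold hH
    rw [mul_pow] at this
    nlinarith
  have h4 : 0 ≤ hH N u t := mul_nonneg (by norm_num) (setIntegral_nonneg mI fun x hx =>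
    mul_nonneg (sq_nonneg _) (inv_nonneg.2 (Pw_nonneg (le_of_lt hx))))
  refine (rpow_le_rpow h4 h3 (by positivity)).trans (le_of_eq ?_)
  rw [mul_rpow (by positivity) (by positivity)]
  congr 1
  rw [← rpow_natCast, ← rpow_mul hf.le, ← rpow_mul hf.le]
  rw [show 1 / (m + 1) * ((2:ℕ):ℝ) * ((m + 1) / 2) = 1 by push_cast; field_simp, rpow_one]
lemma hH_pos (h : FDC N m T u g ut) (ht : t ∈ Ioo 0 T) : 0 < hH N u t := by
  refine mul_pos (by norm_num) ((setIntegral_pos_iff_support_of_nonneg_ae ?_ (hH_int h ht)).2 ?_)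
  · filter_upwards [ae_restrict_mem mI] with x hx
    have := Pp N hx
    simp only [Pi.zero_apply]; positivity
  · have : Function.support (fun r => Mm N (fun x => u x t) r ^ 2 * (Pw N r)⁻¹) ∩ IP = IP := by
      refine inter_eq_right.2 fun x hx => ?_
      have : 0 < Mm N (fun x => u x t) x := by
        refine intervalIntegral.intervalIntegral_pos_of_pos_on (Mu_int h.hN h.hm h.hk h.fl ht (le_of_lt hx)) (fun y hy => ?_) hx
        exact mul_pos (Pw_pos hy.1) (h.fl.upos y hy.1 t ht)
      have := Pp N hx
      simp only [Function.mem_support]; positivity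
    rw [this]; simp
lemma hH_tend (h : FDC N m T u g ut) : Tendsto (hH N u) (𝓝[<] T) (𝓝 0) := by
  obtain ⟨C, hC, hb⟩ := hH_le h
  have hm := h.hm
  have h1 : Tendsto (fun t => (C * fF N m u t) ^ (2 / (m + 1))) (𝓝[<] T) (𝓝 ((C * 0) ^ (2 / (m + 1)))) :=
    ((fF_tend h).const_mul C).rpow_const (Or.inr (by positivity))
  rw [mul_zero, zero_rpow (by positivity)] at h1
  refine tendsto_of_tendsto_of_tendsto_of_le_of_le' tendsto_const_nhds h1 ?_ ?_
  · filter_upwards [Ioo_mem_nhdsLT h.hT] with t ht using (hH_pos h ht).le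
  · filter_upwards [Ioo_mem_nhdsLT h.hT] with t ht
    have h0 := (hH_pos h ht).le
    have := rpow_le_rpow (by positivity) (hb t ht) (show 0 ≤ 2 / (m + 1) by positivity)
    rwa [← rpow_mul h0, show (m + 1) / 2 * (2 / (m + 1)) = 1 by field_simp, rpow_one] at this
/-- by parts: f = - ∫ M g -/
lemma Mg_int (h : FDC N m T u g ut) (ht : t ∈ Ioo 0 T) :
    IntegrableOn (fun r => Mm N (fun x => u x t) r * g r t) IP ∧
    ∫ r in IP, Mm N (fun x => u x t) r * g r t = - fF N m u t := by
  have hMc : ContinuousOn (Mm N (fun x => u x t)) IP := fun r hr => (Mu_dr h.hN h.hm h.hk h.fl ht hr).continuousAt.continuousWithinAt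
  have hint : IntegrableOn (fun r => Mm N (fun x => u x t) r * g r t) IP := by
    refine Integrable.mono' ((hH_int h ht).add (h.fl.gint t ht)) ((hMc.mul (gslice h.fl ht)).aestronglyMeasurable mI) ?_
    filter_upwards [ae_restrict_mem mI] with x hx
    have hP := Pp N hx
    rw [norm_eq_abs, Pi.add_apply]
    generalize Mm N (fun x => u x t) x = M
    have e : M ^ 2 * (Pw N x)⁻¹ = Pw N x * (M / Pw N x) ^ 2 := by field_simp
    have e2 : M * g x t = Pw N x * (M / Pw N x * g x t) := by field_simp
    rw [e, e2, abs_mul, abs_of_pos hP, ← mul_add]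
    gcongr
    rw [abs_le]; constructor <;> nlinarith [sq_nonneg (M / Pw N x - g x t), sq_nonneg (M / Pw N x + g x t)]
  refine ⟨hint, ?_⟩
  obtain ⟨K, hK, hb⟩ := u_bd h.hN h.hm h.fl ht
  have hb := hb t ⟨le_rfl, ht.2⟩
  have hz : ∀ l : Filter ℝ, (∀ᶠ r in l, 0 < r) → Tendsto (fun r => Mm N (fun x => u x t) r * √(Sg N r)) l (𝓝 0) →
      Tendsto (fun r => Mm N (fun x => u x t) r * u r t ^ m) l (𝓝 0) := fun l hl hM => by
    have := hM.const_mul K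
    rw [mul_zero] at this
    refine tendsto_of_tendsto_of_tendsto_of_le_of_le' tendsto_const_nhds this ?_ ?_
    · filter_upwards [hl] with r hr using mul_nonneg (Mu_nonneg h ht hr.le) (rpow_nonneg (h.fl.upos r hr t ht).le _)
    · filter_upwards [hl] with r hr
      have := mul_le_mul_of_nonneg_left (hb r hr).2 (Mu_nonneg h ht hr.le)
      linarith
  have h0 : ∀ x > 0, 0 ≤ u x t := fun x hx => (h.fl.upos x hx t ht).le
  have z1 := (hz _ (eventually_gt_atTop 0) (M_infty h.hN (uslice h.fl ht) h0 (u_int h.hN h.hm h.hk h.fl ht))).comp rr_tendsto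
  have z2 := (hz _ self_mem_nhdsWithin (M_zero h.hN (uslice h.fl ht) h0 (u_int h.hN h.hm h.hk h.fl ht))).comp rl_tendsto
  have z3 := tendsto_trunc (fF_int h ht)
  have z4 := (z1.sub z2).sub z3
  refine tendsto_nhds_unique (tendsto_trunc hint) ?_
  rw [sub_zero, zero_sub] at z4
  refine z4.congr fun n => ?_
  rw [intervalIntegral.integral_mul_deriv_eq_deriv_mul (a := rl n) (b := rr n)
      (fun x hx => Mu_dr h.hN h.hm h.hk h.fl ht (uIcc_sub_Ioi (rl_pos n) (rr_pos n) hx)) (fun x hx => h.fl.vr x (uIcc_sub_Ioi (rl_pos n) (rr_pos n) hx) t ht)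
      (ii_of_cont ((Pw_cont N).continuousOn.mul (uslice h.fl ht)) (rl_pos n) (rr_pos n)) (ii_of_cont (gslice h.fl ht) (rl_pos n) (rr_pos n))]
  simp only [Function.comp, mul_assoc]
lemma deficit (h : FDC N m T u g ut) (ht : t ∈ Ioo 0 T) (θ : ℝ) :
    IntegrableOn (fun r => Pw N r * (g r t + θ * (Mm N (fun x => u x t) r / Pw N r)) ^ 2) IP ∧
    ∫ r in IP, Pw N r * (g r t + θ * (Mm N (fun x => u x t) r / Pw N r)) ^ 2 = dD N g t - 2 * θ * fF N m u t + 2 * θ ^ 2 * hH N u t := by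
  have hi := Mg_int h ht
  have e : ∀ r ∈ Ioi (0:ℝ), Pw N r * g r t ^ 2 + 2 * θ * (Mm N (fun x => u x t) r * g r t) + θ ^ 2 * (Mm N (fun x => u x t) r ^ 2 * (Pw N r)⁻¹)
      = Pw N r * (g r t + θ * (Mm N (fun x => u x t) r / Pw N r)) ^ 2 := fun r hr => by
    have hP := Pp N hr
    field_simp; ring
  have i1 := h.fl.gint t ht
  have i2 := hi.1.const_mul (2 * θ)
  have i3 := (hH_int h ht).const_mul (θ ^ 2)
  refine ⟨((i1.add i2).add i3).congr_fun e mI, ?_⟩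
  have j1 := integral_add (i1.add i2) i3
  have j2 := integral_add i1 i2
  simp only [Pi.add_apply] at j1 j2
  rw [← setIntegral_congr_fun mI e, j1, j2, integral_const_mul, integral_const_mul, hi.2]
  unfold dD hH; ring
lemma f_sq_le (h : FDC N m T u g ut) (ht : t ∈ Ioo 0 T) : fF N m u t ^ 2 / (2 * hH N u t) ≤ dD N g t := by
  have hH0 := hH_pos h ht
  have h1 := deficit h ht (fF N m u t / (2 * hH N u t))
  have h2 : 0 ≤ ∫ r in IP, Pw N r * (g r t + fF N m u t / (2 * hH N u t) * (Mm N (fun x => u x t) r / Pw N r)) ^ 2 :=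
    setIntegral_nonneg mI fun x hx => mul_nonneg (Pw_nonneg (le_of_lt hx)) (sq_nonneg _)
  rw [h1.2] at h2
  have e : 2 * (fF N m u t / (2 * hH N u t)) * fF N m u t - 2 * (fF N m u t / (2 * hH N u t)) ^ 2 * hH N u t = fF N m u t ^ 2 / (2 * hH N u t) := by
    field_simp; ring
  linarith
end
end

section
open Real
variable {r : ℝ} {t : ℝ}
section
variable {N : ℕ} {m T : ℝ} {u g ut : ℝ → ℝ → ℝ}
lemma f_trunc (h : FDC N m T u g ut) {t1 t2 : ℝ} (ht1 : 0 < t1) (h12 : t1 ≤ t2) (ht2 : t2 < T) {ρ R : ℝ} (hρ : 0 < ρ) (hR : 0 < R) :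
    (∫ x in ρ..R, Pw N x * (u x t2 * u x t2 ^ m)) - (∫ x in ρ..R, Pw N x * (u x t1 * u x t1 ^ m)) =
    (m + 1) * ((∫ t in t1..t2, u R t ^ m * (Pw N R * g R t)) - (∫ t in t1..t2, u ρ t ^ m * (Pw N ρ * g ρ t)) -
      ∫ t in t1..t2, ∫ x in ρ..R, Pw N x * g x t ^ 2) := by
  have hsub : uIcc t1 t2 ⊆ Ioo 0 T := by
    rw [uIcc_of_le h12]; exact fun x hx => ⟨ht1.trans_le hx.1, hx.2.trans_lt ht2⟩
  have hP : ContinuousOn (fun q : ℝ × ℝ => Pw N q.1) (IP ×ˢ Ioo 0 T) := ((Pw_cont N).comp continuous_fst).continuousOn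
  have hsr := uIcc_sub_Ioi hρ hR
  have hd : ∀ t ∈ Ioo 0 T, HasDerivAt (fun t => ∫ x in ρ..R, Pw N x * (u x t * u x t ^ m)) (∫ x in ρ..R, Pw N x * ((m + 1) * u x t ^ m * ut x t)) t := fun t ht => by
    refine paramD isOpen_Ioo (φ := fun x t => Pw N x * (u x t * u x t ^ m)) (φ' := fun x t => Pw N x * ((m + 1) * u x t ^ m * ut x t))
      (hP.mul (h.fl.ucont.mul (vcont h m))) (hP.mul ((continuousOn_const.mul (vcont h m)).mul h.fl.utcont)) (fun x hx s hs => ?_) hsr ht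
    have h0 := h.fl.upos x hx s hs
    have h1 := h.fl.uder x hx s hs
    refine ((h1.mul (h1.rpow_const (p := m) (Or.inl h0.ne'))).const_mul _).congr_deriv ?_
    have : u x s ^ m = u x s ^ (m - 1) * u x s := by rw [← rpow_add_one h0.ne']; ring_nf
    rw [this]; ring
  have hvg : ∀ x > 0, ContinuousOn (fun t => u x t ^ m * (Pw N x * g x t)) (Ioo 0 T) := fun x hx =>
    ((vcont h m).mul (hP.mul h.fl.gcont)).comp (f := fun t => (x, t)) (by fun_prop) fun t ht => ⟨hx, ht⟩
  have hDc : ContinuousOn (fun t => ∫ x in ρ..R, Pw N x * g x t ^ 2) (Ioo 0 T) :=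
    paramC isOpen_Ioo (φ := fun x t => Pw N x * g x t ^ 2) (hP.mul (h.fl.gcont.pow 2)) hsr
  have hip : ∀ t ∈ Ioo 0 T, ∫ x in ρ..R, Pw N x * ((m + 1) * u x t ^ m * ut x t) =
      (m + 1) * (u R t ^ m * (Pw N R * g R t) - u ρ t ^ m * (Pw N ρ * g ρ t) - ∫ x in ρ..R, Pw N x * g x t ^ 2) := fun t ht => by
    have := intervalIntegral.integral_mul_deriv_eq_deriv_mul (a := ρ) (b := R)
      (fun x hx => h.fl.vr x (hsr hx) t ht) (fun x hx => h.fl.Pg x (hsr hx) t ht)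
      (ii_of_cont (gslice h.fl ht) hρ hR) (ii_of_cont ((Pw_cont N).continuousOn.mul (utslice h.fl ht)) hρ hR)
    have e1 : ∀ x, Pw N x * ((m + 1) * u x t ^ m * ut x t) = (m + 1) * (u x t ^ m * (Pw N x * ut x t)) := fun x => by ring
    have e2 : ∀ x, Pw N x * g x t ^ 2 = g x t * (Pw N x * g x t) := fun x => by ring
    simp only [e1, e2, intervalIntegral.integral_const_mul, this]
  have hc := ((((hvg R hR).sub (hvg ρ hρ)).sub hDc).const_smul (m + 1)).mono hsub
  have := intervalIntegral.integral_eq_sub_of_hasDerivAt (fun t ht => (hd t (hsub ht)).congr_deriv (hip t (hsub ht))) hc.intervalIntegrable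
  rw [← this, intervalIntegral.integral_const_mul, intervalIntegral.integral_sub, intervalIntegral.integral_sub]
  · exact ((hvg R hR).mono hsub).intervalIntegrable
  · exact ((hvg ρ hρ).mono hsub).intervalIntegrable
  · exact (((hvg R hR).sub (hvg ρ hρ)).mono hsub).intervalIntegrable
  · exact (hDc.mono hsub).intervalIntegrable
lemma E_zero (h : FDC N m T u g ut) {t1 t2 : ℝ} (ht1 : 0 < t1) (h12 : t1 ≤ t2) (ht2 : t2 < T) :
    Tendsto (fun ρ => ∫ t in t1..t2, u ρ t ^ m * (Pw N ρ * g ρ t)) (𝓝[>] 0) (𝓝 0) := by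
  obtain ⟨C, hC⟩ := h.fl.bd t1 t2 1 ht1 ht2
  have hP0 : Tendsto (fun x => C ^ m * (Pw N x * C) * |t2 - t1|) (𝓝[>] 0) (𝓝 0) := by
    have : Continuous (fun x => C ^ m * (Pw N x * C) * |t2 - t1|) := by have := Pw_cont N; fun_prop
    have := this.tendsto 0
    rw [Pw_zero h.hN, zero_mul, mul_zero, zero_mul] at this
    exact this.mono_left nhdsWithin_le_nhds
  refine squeeze_zero_norm' ?_ hP0
  filter_upwards [Ioc_mem_nhdsGT one_pos] with x hx
  refine intervalIntegral.norm_integral_le_of_norm_le_const fun t ht => ?_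
  rw [uIoc_of_le h12] at ht
  have h1 := hC x hx t ⟨ht.1.le, ht.2⟩
  have h0 := h.fl.upos x hx.1 t ⟨ht1.trans ht.1, ht.2.trans_lt ht2⟩
  have hP := Pp N hx.1
  rw [norm_eq_abs, abs_mul, abs_mul, abs_of_pos hP, abs_of_pos (rpow_pos_of_pos h0 m)]
  have := h.hm
  have hC0 := h0.le.trans h1.1
  gcongr
  exacts [h1.1, h1.2.1]
lemma E_freq (h : FDC N m T u g ut) {t1 t2 : ℝ} (ht1 : 0 < t1) (h12 : t1 < t2) (ht2 : t2 < T) :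
    ∃ᶠ R in atTop, ∫ t in t1..t2, u R t ^ m * (Pw N R * g R t) ≤ 0 := by
  have hsub : uIcc t1 t2 ⊆ Ioo 0 T := by
    rw [uIcc_of_le h12.le]; exact fun x hx => ⟨ht1.trans_le hx.1, hx.2.trans_lt ht2⟩
  set e : ℝ → ℝ := fun R => ∫ t in t1..t2, (u R t ^ m) ^ 2 with he
  have hsw : MapsTo (fun q : ℝ × ℝ => (q.2, q.1)) (Ioo 0 T ×ˢ IP) (IP ×ˢ Ioo 0 T) := fun q hq => ⟨hq.2, hq.1⟩
  have hv : ContinuousOn (fun q : ℝ × ℝ => u q.2 q.1 ^ m) (Ioo 0 T ×ˢ IP) := (vcont h m).comp (f := fun q : ℝ × ℝ => (q.2, q.1)) (by fun_prop) hsw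
  have hg : ContinuousOn (fun q : ℝ × ℝ => g q.2 q.1) (Ioo 0 T ×ˢ IP) := h.fl.gcont.comp (f := fun q : ℝ × ℝ => (q.2, q.1)) (by fun_prop) hsw
  have hd : ∀ R > 0, HasDerivAt e (∫ t in t1..t2, 2 * (u R t ^ m * g R t)) R := fun R hR => by
    refine paramD isOpen_Ioi (φ := fun t R => (u R t ^ m) ^ 2) (φ' := fun t R => 2 * (u R t ^ m * g R t))
      (hv.pow 2) (continuousOn_const.mul (hv.mul hg)) (fun t ht x hx => ?_) hsub hR
    refine ((h.fl.vr x hx t ht).pow 2).congr_deriv ?_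
    push_cast; ring
  have hsl : ∀ R > 0, ContinuousOn (fun t => (u R t ^ m) ^ 2) (Ioo 0 T) := fun R hR =>
    ((vcont h m).pow 2).comp (f := fun t => (R, t)) (by fun_prop) fun t ht => ⟨hR, ht⟩
  have hpos : ∀ R > 0, 0 < e R := fun R hR => by
    refine intervalIntegral.intervalIntegral_pos_of_pos_on ((hsl R hR).mono hsub).intervalIntegrable (fun t ht => ?_) h12
    have := h.fl.upos R hR t ⟨ht1.trans ht.1, ht.2.trans ht2⟩
    positivity
  obtain ⟨K, hK, hb⟩ := u_bd h.hN h.hm h.fl (ε := t1) ⟨ht1, h12.trans ht2⟩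
  have hlim : Tendsto e atTop (𝓝 0) := by
    have h1 : Tendsto (fun R => K ^ 2 * Sg N R * |t2 - t1|) atTop (𝓝 (K ^ 2 * 0 * |t2 - t1|)) := ((Sg_tendsto h.hN).const_mul _).mul_const _
    rw [mul_zero, zero_mul] at h1
    refine squeeze_zero_norm' ?_ h1
    filter_upwards [eventually_gt_atTop 0] with R hR
    refine intervalIntegral.norm_integral_le_of_norm_le_const fun t ht => ?_
    rw [uIoc_of_le h12.le] at ht
    have h2 := (hb t ⟨ht.1.le, ht.2.trans_lt ht2⟩ R hR).2
    have h0 := h.fl.upos R hR t ⟨ht1.trans ht.1, ht.2.trans_lt ht2⟩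
    have h3 := pow_le_pow_left₀ (rpow_nonneg h0.le m) h2 2
    rw [mul_pow, sq_sqrt (Sg_nonneg hR)] at h3
    rwa [norm_of_nonneg (by positivity)]
  intro hcon
  obtain ⟨R0, hR0⟩ := eventually_atTop.1 (hcon.and (eventually_gt_atTop 0))
  have hmono : MonotoneOn e (Ici R0) := by
    refine monotoneOn_of_deriv_nonneg (convex_Ici R0) (fun x hx => (hd x (hR0 x hx).2).continuousAt.continuousWithinAt)
      (fun x hx => ?_) fun x hx => ?_
    · rw [interior_Ici] at hx
      exact (hd x (hR0 x (le_of_lt hx)).2).differentiableAt.differentiableWithinAt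
    · rw [interior_Ici] at hx
      have h1 := hR0 x (le_of_lt hx)
      rw [(hd x h1.2).deriv]
      have e1 : ∀ t, u x t ^ m * (Pw N x * g x t) = Pw N x / 2 * (2 * (u x t ^ m * g x t)) := fun t => by ring
      have h2 := not_le.1 h1.1
      simp only [e1] at h2
      rw [intervalIntegral.integral_const_mul] at h2
      have hP := Pp N h1.2
      exact (pos_of_mul_pos_right h2 (by positivity)).le
  have : e R0 ≤ 0 := ge_of_tendsto hlim (by
    filter_upwards [eventually_ge_atTop R0] with x hx
    exact hmono (self_mem_Ici) hx hx)
  exact absurd (hpos R0 (hR0 R0 le_rfl).2) (not_lt.2 this)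
lemma trunc_mono {f : ℝ → ℝ} (hc : ContinuousOn f IP) (h0 : ∀ x > 0, 0 ≤ f x) {ρ R ρ' R' : ℝ} (h1 : 0 < ρ') (h2 : ρ' ≤ ρ)
    (h3 : ρ ≤ R) (h4 : R ≤ R') : ∫ x in ρ..R, f x ≤ ∫ x in ρ'..R', f x := by
  refine intervalIntegral.integral_mono_interval h2 h3 h4 ?_ (ii_of_cont hc h1 (by linarith))
  filter_upwards [ae_restrict_mem measurableSet_Ioc] with x hx using h0 x (h1.trans hx.1)
lemma Pg_cont (h : FDC N m T u g ut) (ht : t ∈ Ioo 0 T) : ContinuousOn (fun x => Pw N x * g x t ^ 2) IP :=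
  (Pw_cont N).continuousOn.mul ((gslice h.fl ht).pow 2)
lemma Dtr_cont (h : FDC N m T u g ut) {ρ R : ℝ} (hρ : 0 < ρ) (hR : 0 < R) :
    ContinuousOn (fun t => ∫ x in ρ..R, Pw N x * g x t ^ 2) (Ioo 0 T) :=
  paramC isOpen_Ioo (φ := fun x t => Pw N x * g x t ^ 2)
    ((((Pw_cont N).comp continuous_fst).continuousOn).mul (h.fl.gcont.pow 2)) (uIcc_sub_Ioi hρ hR)
lemma f_drop (h : FDC N m T u g ut) {t1 t2 : ℝ} (ht1 : 0 < t1) (h12 : t1 ≤ t2) (ht2 : t2 < T) {ρ R : ℝ} (hρ : 0 < ρ) (hR : ρ ≤ R) :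
    fF N m u t2 + (m + 1) * ∫ t in t1..t2, ∫ x in ρ..R, Pw N x * g x t ^ 2 ≤ fF N m u t1 := by
  rcases h12.eq_or_lt with rfl | h12'
  · simp
  have hsub : Icc t1 t2 ⊆ Ioo 0 T := fun x hx => ⟨ht1.trans_le hx.1, hx.2.trans_lt ht2⟩
  have hm := h.hm
  have hc : ∀ t ∈ Ioo 0 T, ContinuousOn (fun x => Pw N x * (u x t * u x t ^ m)) IP := fun t ht =>
    (Pw_cont N).continuousOn.mul ((uslice h.fl ht).mul (vslice h.fl ht m))
  have h0 : ∀ t ∈ Ioo 0 T, ∀ x > 0, 0 ≤ Pw N x * (u x t * u x t ^ m) := fun t ht x hx => by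
    have := h.fl.upos x hx t ht
    have := Pp N hx
    positivity
  have i1 := hsub ⟨le_rfl, h12⟩
  have i2 := hsub ⟨h12, le_rfl⟩
  have hn : ∀ n : ℕ, (∫ x in (rl n)..(rr n), Pw N x * (u x t2 * u x t2 ^ m)) + (m + 1) * ∫ t in t1..t2, ∫ x in ρ..R, Pw N x * g x t ^ 2 ≤ fF N m u t1 := by
    intro n
    have hz := ((E_zero h ht1 h12 ht2).const_mul (m + 1)).const_sub (fF N m u t1)
    rw [mul_zero, sub_zero] at hz
    refine ge_of_tendsto hz ?_
    filter_upwards [Ioo_mem_nhdsGT (lt_min (rl_pos n) hρ)] with ρ' hρ'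
    obtain ⟨R', hR', hE⟩ := ((eventually_ge_atTop (max (rr n) R)).and_frequently (E_freq h ht1 h12' ht2)).exists
    have a1 := hρ'.2.le.trans (min_le_left _ _)
    have a2 := hρ'.2.le.trans (min_le_right _ _)
    have b1 := (le_max_left _ _).trans hR'
    have b2 := (le_max_right _ _).trans hR'
    have hR0 : 0 < R' := (rr_pos n).trans_le b1
    have key := f_trunc h ht1 h12 ht2 hρ'.1 hR0
    have k1 := trunc_mono (hc t2 i2) (h0 t2 i2) hρ'.1 a1 (rl_le n) b1
    have k2 := trunc_le (fF_int h i1) (h0 t1 i1) hρ'.1.le (a1.trans ((rl_le n).trans b1))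
    have k3 : ∫ t in t1..t2, ∫ x in ρ..R, Pw N x * g x t ^ 2 ≤ ∫ t in t1..t2, ∫ x in ρ'..R', Pw N x * g x t ^ 2 := by
      refine intervalIntegral.integral_mono_on h12 ?_ ?_ fun t ht => ?_
      · exact ((Dtr_cont h hρ (hρ.trans_le hR)).mono (by rwa [uIcc_of_le h12])).intervalIntegrable
      · exact ((Dtr_cont h hρ'.1 hR0).mono (by rwa [uIcc_of_le h12])).intervalIntegrable
      · exact trunc_mono (Pg_cont h (hsub ht)) (fun x hx => mul_nonneg (Pw_nonneg (le_of_lt hx)) (sq_nonneg _)) hρ'.1 a2 hR b2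
    unfold fF
    nlinarith
  have hl := (tendsto_trunc (fF_int h i2)).add_const ((m + 1) * ∫ t in t1..t2, ∫ x in ρ..R, Pw N x * g x t ^ 2)
  exact le_of_tendsto hl (Eventually.of_forall hn)
noncomputable def xX (N : ℕ) (u : ℝ → ℝ → ℝ) (δ t : ℝ) : ℝ :=
  ∫ r in IP, (Mm N (fun x => u x (t + δ)) r - Mm N (fun x => u x t) r) ^ 2 * (Pw N r)⁻¹
lemma X_anti (h : FDC N m T u g ut) {δ s t : ℝ} (hδ : 0 < δ) (hs : 0 < s) (hst : s ≤ t) (ht : t + δ < T) : xX N u δ t ≤ xX N u δ s := by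
  have hε : s / 2 ∈ Ioo 0 T := ⟨by linarith, by linarith⟩
  obtain ⟨K, hK, hb⟩ := u_bd h.hN h.hm h.fl hε
  set I := Ioo (s / 2) (T - δ)
  have j1 : ∀ τ ∈ I, τ ∈ Ioo 0 T := fun τ hτ => ⟨hε.1.trans hτ.1, by linarith [hτ.2]⟩
  have j2 : ∀ τ ∈ I, τ + δ ∈ Ioo 0 T := fun τ hτ => ⟨by linarith [hτ.1], by linarith [hτ.2]⟩
  have k1 : ∀ τ ∈ I, τ ∈ Ico (s / 2) T := fun τ hτ => ⟨hτ.1.le, (j1 τ hτ).2⟩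
  have k2 : ∀ τ ∈ I, τ + δ ∈ Ico (s / 2) T := fun τ hτ => ⟨by linarith [hτ.1], (j2 τ hτ).2⟩
  have h4 : ∀ τ ∈ Ico (s / 2) T, ∀ r > 0, |u r τ| ≤ K * Sg N r ^ (1 / m / 2) := fun τ hτ r hr => by
    rw [abs_of_pos (h.fl.upos r hr τ ⟨hε.1.trans_le hτ.1, hτ.2⟩)]; exact (hb τ hτ r hr).1
  have h5 : ∀ τ ∈ Ico (s / 2) T, ∀ r > 0, |u r τ ^ m| ≤ K * √(Sg N r) := fun τ hτ r hr => by
    rw [abs_of_pos (rpow_pos_of_pos (h.fl.upos r hr τ ⟨hε.1.trans_le hτ.1, hτ.2⟩) _)]; exact (hb τ hτ r hr).2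
  have key := fun τ hτ => energy_gen (m := m) h.hN h.hk (I := I) isOpen_Ioo (a := fun r t => u r (t + δ) - u r t) (b := fun r t => u r (t + δ) ^ m - u r t ^ m)
    (b' := fun r t => g r (t + δ) - g r t)
    (M := fun r t => Mm N (fun x => u x (t + δ)) r - Mm N (fun x => u x t) r) (K := K + K) (by positivity)
    (fun r hr s hs => ((Mu_dr h.hN h.hm h.hk h.fl (j2 s hs) hr).sub (Mu_dr h.hN h.hm h.hk h.fl (j1 s hs) hr)).congr_deriv (by ring))
    (fun r hr s hs => (((Mu_dt h.hN h.hm h.hk h.fl (j2 s hs) hr).comp_add_const s δ).sub (Mu_dt h.hN h.hm h.hk h.fl (j1 s hs) hr)).congr_deriv (by ring))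
    (fun r hr s hs => (h.fl.vr r hr _ (j2 s hs)).sub (h.fl.vr r hr s (j1 s hs)))
    (fun s hs => (uslice h.fl (j2 s hs)).sub (uslice h.fl (j1 s hs)))
    ((h.fl.gcont.comp (f := fun q : ℝ × ℝ => (q.1, q.2 + δ)) (by fun_prop) fun q hq => ⟨hq.1, j2 _ hq.2⟩).sub (h.fl.gcont.mono (prod_mono le_rfl j1)))
    (fun r hr s hs => by rw [add_mul]; exact (abs_sub _ _).trans (add_le_add (h4 _ (k2 s hs) r hr) (h4 _ (k1 s hs) r hr)))
    (fun r hr s hs => by rw [add_mul]; exact (abs_sub _ _).trans (add_le_add (h5 _ (k2 s hs) r hr) (h5 _ (k1 s hs) r hr)))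
    (fun r hr s hs => by
      rw [add_mul]; exact (abs_sub _ _).trans (add_le_add (Mm_dom h.hN h.hk (fun x hx => h4 _ (k2 s hs) x hx) hr) (Mm_dom h.hN h.hk (fun x hx => h4 _ (k1 s hs) x hx) hr)))
    (t := τ) hτ
  have hanti : AntitoneOn (fun τ => 1 / 2 * xX N u δ τ) I := by
    refine antitoneOn_of_deriv_nonpos (convex_Ioo _ _) (fun x hx => (key x hx).continuousAt.continuousWithinAt)
      (fun x hx => ?_) fun x hx => ?_
    · rw [interior_Ioo] at hx
      exact (key x hx).differentiableAt.differentiableWithinAt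
    · rw [interior_Ioo] at hx
      refine le_of_eq_of_le (key x hx).deriv (neg_nonpos.2 (setIntegral_nonneg mI fun r hr => mul_nonneg (Pw_nonneg (le_of_lt hr)) ?_))
      have p1 := h.fl.upos r hr _ (j1 x hx)
      have p2 := h.fl.upos r hr _ (j2 x hx)
      rcases le_total (u r x) (u r (x + δ)) with hle | hle
      · exact mul_nonneg (sub_nonneg.2 hle) (sub_nonneg.2 (rpow_le_rpow p1.le hle h.hm.le))
      · exact mul_nonneg_of_nonpos_of_nonpos (sub_nonpos.2 hle) (sub_nonpos.2 (rpow_le_rpow p2.le hle h.hm.le))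
  have := hanti (a := s) (b := t) ⟨by linarith, by linarith⟩ ⟨by linarith, by linarith⟩ hst
  simp only at this
  linarith
lemma X_int (h : FDC N m T u g ut) {s t : ℝ} (hs : s ∈ Ioo 0 T) (ht : t ∈ Ioo 0 T) :
    ContinuousOn (fun r => (Mm N (fun x => u x t) r - Mm N (fun x => u x s) r) ^ 2 * (Pw N r)⁻¹) IP ∧
    IntegrableOn (fun r => (Mm N (fun x => u x t) r - Mm N (fun x => u x s) r) ^ 2 * (Pw N r)⁻¹) IP := by
  have hMc : ∀ t ∈ Ioo 0 T, ContinuousOn (Mm N (fun x => u x t)) IP := fun t ht r hr => (Mu_dr h.hN h.hm h.hk h.fl ht hr).continuousAt.continuousWithinAt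
  have hc : ContinuousOn (fun r => (Mm N (fun x => u x t) r - Mm N (fun x => u x s) r) ^ 2 * (Pw N r)⁻¹) IP :=
    (((hMc t ht).sub (hMc s hs)).pow 2).mul PwInv_cont
  refine ⟨hc, Integrable.mono' (((hH_int h ht).add (hH_int h hs)).const_mul 2) (hc.aestronglyMeasurable mI) ?_⟩
  filter_upwards [ae_restrict_mem mI] with x hx
  have hP := Pp N hx
  rw [norm_of_nonneg (by positivity), Pi.add_apply, ← add_mul, ← mul_assoc]
  gcongr
  nlinarith [sq_nonneg (Mm N (fun x => u x t) x + Mm N (fun x => u x s) x)]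
lemma jensen {φ : ℝ → ℝ} {a b : ℝ} (hab : a ≤ b) (hc : ContinuousOn φ (Icc a b)) : (∫ x in a..b, φ x) ^ 2 ≤ (b - a) * ∫ x in a..b, φ x ^ 2 := by
  rcases hab.eq_or_lt with rfl | hlt
  · simp
  rw [← uIcc_of_le hab] at hc
  set A := ∫ x in a..b, φ x
  have h0 : 0 ≤ ∫ x in a..b, (φ x - A / (b - a)) ^ 2 := intervalIntegral.integral_nonneg hab fun x _ => sq_nonneg _
  have e : ∀ x, (φ x - A / (b - a)) ^ 2 = φ x ^ 2 - 2 * (A / (b - a)) * φ x + (A / (b - a)) ^ 2 := fun x => by ring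
  simp only [e] at h0
  have i1 : IntervalIntegrable (fun x => φ x ^ 2) volume a b := (hc.pow 2).intervalIntegrable
  have i2 : IntervalIntegrable (fun x => 2 * (A / (b - a)) * φ x) volume a b := (continuousOn_const.mul hc).intervalIntegrable
  rw [intervalIntegral.integral_add (i1.sub i2) (by simp), intervalIntegral.integral_sub i1 i2,
    intervalIntegral.integral_const_mul, intervalIntegral.integral_const, smul_eq_mul] at h0
  have hd : 0 < b - a := sub_pos.2 hlt
  have e2 : (b - a) * ((∫ x in a..b, φ x ^ 2) - 2 * (A / (b - a)) * A + (b - a) * (A / (b - a)) ^ 2) = (b - a) * (∫ x in a..b, φ x ^ 2) - A ^ 2 := by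
    field_simp; ring
  have := mul_nonneg hd.le h0
  linarith
lemma X_le (h : FDC N m T u g ut) {t δ : ℝ} (ht : 0 < t) (hδ : 0 < δ) (htδ : t + δ < T) :
    xX N u δ t ≤ δ * ((fF N m u t - fF N m u (t + δ)) / (m + 1)) := by
  have hm := h.hm
  have hsub : uIcc t (t + δ) ⊆ Ioo 0 T := by
    rw [uIcc_of_le (by linarith)]; exact fun x hx => ⟨ht.trans_le hx.1, hx.2.trans_lt htδ⟩
  have i1 := hsub left_mem_uIcc
  have i2 := hsub right_mem_uIcc
  refine le_of_tendsto (tendsto_trunc (X_int h i1 i2).2) (Eventually.of_forall fun n => ?_)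
  have hsr := uIcc_sub_Ioi (rl_pos n) (rr_pos n)
  have h1 : ∀ r > 0, (Mm N (fun x => u x (t + δ)) r - Mm N (fun x => u x t) r) ^ 2 * (Pw N r)⁻¹ ≤ δ * ∫ τ in t..(t + δ), Pw N r * g r τ ^ 2 := fun r hr => by
    have hgc : ContinuousOn (fun τ => Pw N r * g r τ) (Ioo 0 T) := continuousOn_const.mul (h.fl.gcont.comp (f := fun t => (r, t)) (by fun_prop) fun t ht => ⟨hr, ht⟩)
    rw [← intervalIntegral.integral_eq_sub_of_hasDerivAt (fun τ hτ => Mu_dt h.hN h.hm h.hk h.fl (hsub hτ) hr) (hgc.mono hsub).intervalIntegrable]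
    have hj := jensen (a := t) (b := t + δ) (by linarith) (hgc.mono (by rwa [← uIcc_of_le (by linarith)]))
    have hP := Pp N hr
    have e : ∀ τ, (Pw N r * g r τ) ^ 2 = Pw N r * (Pw N r * g r τ ^ 2) := fun τ => by ring
    have e3 : ∫ τ in t..(t + δ), (Pw N r * g r τ) ^ 2 = Pw N r * ∫ τ in t..(t + δ), Pw N r * g r τ ^ 2 := by
      simp only [e]; rw [intervalIntegral.integral_const_mul]
    rw [e3, add_sub_cancel_left] at hj
    rw [← div_eq_mul_inv, div_le_iff₀ hP]
    linarith
  have hPg : ContinuousOn (fun q : ℝ × ℝ => Pw N q.1 * g q.1 q.2 ^ 2) (IP ×ˢ Ioo 0 T) :=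
    (((Pw_cont N).comp continuous_fst).continuousOn).mul (h.fl.gcont.pow 2)
  have hsw : ∫ r in (rl n)..(rr n), ∫ τ in t..(t + δ), Pw N r * g r τ ^ 2 = ∫ τ in t..(t + δ), ∫ r in (rl n)..(rr n), Pw N r * g r τ ^ 2 := by
    refine intervalIntegral_intervalIntegral_swap ?_
    refine IntegrableOn.mono_set ?_ (prod_mono uIoc_subset_uIcc uIoc_subset_uIcc)
    exact ContinuousOn.integrableOn_compact (isCompact_uIcc.prod isCompact_uIcc) (hPg.mono (prod_mono hsr hsub))
  have hcs : ContinuousOn (fun r => ∫ τ in t..(t + δ), Pw N r * g r τ ^ 2) IP :=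
    paramC isOpen_Ioi (J := Ioo 0 T) (φ := fun τ r => Pw N r * g r τ ^ 2)
      (hPg.comp (f := fun q : ℝ × ℝ => (q.2, q.1)) (by fun_prop) fun q hq => ⟨hq.2, hq.1⟩) hsub
  have h2 : ∫ r in (rl n)..(rr n), (Mm N (fun x => u x (t + δ)) r - Mm N (fun x => u x t) r) ^ 2 * (Pw N r)⁻¹ ≤
      ∫ r in (rl n)..(rr n), δ * ∫ τ in t..(t + δ), Pw N r * g r τ ^ 2 :=
    intervalIntegral.integral_mono_on (rl_le n) (ii_of_cont (X_int h i1 i2).1 (rl_pos n) (rr_pos n))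
      ((ii_of_cont hcs (rl_pos n) (rr_pos n)).const_mul δ) fun r hr => h1 r ((rl_pos n).trans_le hr.1)
  refine h2.trans ?_
  rw [intervalIntegral.integral_const_mul, hsw]
  refine mul_le_mul_of_nonneg_left ?_ hδ.le
  rw [le_div_iff₀ (by positivity)]
  have := f_drop h ht (by linarith : t ≤ t + δ) htδ (rl_pos n) (rl_le n)
  linarith
lemma D_le (h : FDC N m T u g ut) {t h0 : ℝ} (hh : 0 < h0) (hht : h0 < t) (ht : t < T) : dD N g t * (h0 * (m + 1)) ≤ fF N m u (t - h0) := by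
  have hm := h.hm
  have ht0 : t ∈ Ioo 0 T := ⟨by linarith, ht⟩
  set B := fF N m u (t - h0) / (h0 * (m + 1)) with hB
  have key : ∀ n : ℕ, xX N u (h0 / (n + 1)) (t - h0 / (n + 1)) ≤ (h0 / (n + 1)) ^ 2 * B := by
    intro n
    set δ := h0 / (n + 1) with hδ
    have hn : (0:ℝ) < n + 1 := by positivity
    have hδ0 : 0 < δ := by positivity
    have hδn : (n + 1) * δ = h0 := by rw [hδ]; field_simp
    set τ : ℕ → ℝ := fun k => t - h0 + k * δ with hτ
    have hk : ∀ k ∈ Finset.range (n + 1), xX N u δ (t - δ) ≤ δ / (m + 1) * (fF N m u (τ k) - fF N m u (τ (k + 1))) := by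
      intro k hk
      have hk' : (k:ℝ) ≤ n := by exact_mod_cast Nat.lt_succ_iff.1 (Finset.mem_range.1 hk)
      have hkn : k * δ ≤ n * δ := by gcongr
      have hk0 : 0 ≤ k * δ := by positivity
      have e : τ (k + 1) = τ k + δ := by simp only [hτ]; push_cast; ring
      have h1 : xX N u δ (t - δ) ≤ xX N u δ (τ k) := X_anti h hδ0 (by simp only [hτ]; linarith) (by simp only [hτ]; linarith) (by linarith)
      have h2 := X_le h (t := τ k) (by simp only [hτ]; linarith) hδ0 (by simp only [hτ]; linarith)
      rw [e]
      refine (h1.trans h2).trans (le_of_eq ?_)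
      ring
    have hs := Finset.sum_le_sum hk
    rw [Finset.sum_const, ← Finset.mul_sum, Finset.sum_range_sub', Finset.card_range, nsmul_eq_mul] at hs
    have e0 : τ 0 = t - h0 := by simp [hτ]
    have e1 : τ (n + 1) = t := by simp only [hτ]; push_cast; linarith
    rw [e0, e1] at hs
    push_cast at hs
    have hf := fF_pos h ht0
    have h3 : (n + 1) * xX N u δ (t - δ) ≤ δ / (m + 1) * fF N m u (t - h0) := hs.trans (by
      gcongr; linarith)
    rw [← mul_le_mul_iff_right₀ hn]
    refine h3.trans (le_of_eq ?_)
    rw [hB, ← hδn]; field_simp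
  rw [← le_div_iff₀ (by positivity)]
  refine le_of_tendsto (tendsto_trunc (h.fl.gint t ht0)) (Eventually.of_forall fun j => ?_)
  have hδt : Tendsto (fun n : ℕ => h0 / ((n:ℝ) + 1)) atTop (𝓝 0) := by
    have := (tendsto_one_div_add_atTop_nhds_zero_nat (𝕜 := ℝ)).const_mul h0
    simpa [div_eq_mul_inv] using this
  have hδp : ∀ n : ℕ, 0 < h0 / ((n:ℝ) + 1) := fun n => by positivity
  have hδle : ∀ n : ℕ, h0 / ((n:ℝ) + 1) ≤ h0 := fun n => div_le_self hh.le (by linarith [(n.cast_nonneg : (0:ℝ) ≤ n)])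
  have hin : ∀ n : ℕ, t - h0 / ((n:ℝ) + 1) ∈ Ioo 0 T := fun n => ⟨by linarith [hδle n], by linarith [hδp n]⟩
  have hsr := uIcc_sub_Ioi (rl_pos j) (rr_pos j)
  obtain ⟨C, hC⟩ := h.fl.bd (t - h0) t (rr j) (by linarith) ht
  have lim : Tendsto (fun n : ℕ => ∫ r in (rl j)..(rr j), ((Mm N (fun x => u x t) r - Mm N (fun x => u x (t - h0 / ((n:ℝ) + 1))) r) / (h0 / ((n:ℝ) + 1))) ^ 2 * (Pw N r)⁻¹) atTop
      (𝓝 (∫ r in (rl j)..(rr j), (Pw N r * g r t) ^ 2 * (Pw N r)⁻¹)) := by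
    refine intervalIntegral.tendsto_integral_filter_of_dominated_convergence (fun r => (Pw N r * C) ^ 2 * (Pw N r)⁻¹) ?_ ?_ ?_ ?_
    · refine Eventually.of_forall fun n => ?_
      have := (continuousOn_const (c := ((h0 / ((n:ℝ) + 1)) ^ 2)⁻¹)).mul (X_int h (hin n) ht0).1
      refine (ii_of_cont (this.congr fun r hr => ?_) (rl_pos j) (rr_pos j)).aestronglyMeasurable_restrict_uIoc
      rw [Pi.mul_apply, div_pow _ (h0 / ((n:ℝ) + 1)), div_eq_inv_mul]
      ring
    · refine Eventually.of_forall fun n => Eventually.of_forall fun r hr => ?_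
      have hr0 : 0 < r := hsr (uIoc_subset_uIcc hr)
      rw [uIoc_of_le (rl_le j)] at hr
      have hP := Pp N hr0
      rw [norm_of_nonneg (by positivity)]
      refine mul_le_mul_of_nonneg_right ?_ (by positivity)
      rw [sq_le_sq]
      refine le_trans ?_ (le_abs_self _)
      rw [abs_div, abs_of_pos (hδp n), div_le_iff₀ (hδp n)]
      have := (convex_Icc (t - h0 / ((n:ℝ) + 1)) t).norm_image_sub_le_of_norm_hasDerivWithin_le (C := Pw N r * C)
        (f := fun τ => Mm N (fun x => u x τ) r) (f' := fun τ => Pw N r * g r τ)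
        (fun τ hτ => (Mu_dt h.hN h.hm h.hk h.fl ⟨(hin n).1.trans_le hτ.1, hτ.2.trans_lt ht⟩ hr0).hasDerivWithinAt) (fun τ hτ => by
          rw [norm_eq_abs, abs_mul, abs_of_pos hP]
          exact mul_le_mul_of_nonneg_left (hC r ⟨hr0, hr.2⟩ τ ⟨by linarith [hτ.1, hδle n], hτ.2⟩).2.1 hP.le)
        (left_mem_Icc.2 (by linarith [hδp n])) (right_mem_Icc.2 (by linarith [hδp n]))
      rwa [norm_eq_abs, norm_eq_abs, sub_sub_cancel, abs_of_pos (hδp n)] at this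
    · exact ii_of_cont ((((Pw_cont N).continuousOn.mul continuousOn_const).pow 2).mul PwInv_cont) (rl_pos j) (rr_pos j)
    · refine Eventually.of_forall fun r hr => ?_
      have hr0 : 0 < r := hsr (uIoc_subset_uIcc hr)
      have hd := hasDerivAt_iff_tendsto_slope.1 (Mu_dt h.hN h.hm h.hk h.fl ht0 hr0)
      have hs : Tendsto (fun n : ℕ => t - h0 / ((n:ℝ) + 1)) atTop (𝓝[≠] t) := by
        refine tendsto_nhdsWithin_iff.2 ⟨by simpa using hδt.const_sub t, Eventually.of_forall fun n => ?_⟩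
        have := hδp n
        simp only [mem_compl_iff, mem_singleton_iff]; linarith
      refine (((hd.comp hs).pow 2).mul_const _).congr fun n => ?_
      simp only [Function.comp, slope_def_field]
      congr 2
      rw [← neg_div_neg_eq]
      congr 1 <;> ring
  have e : ∀ r ∈ uIcc (rl j) (rr j), (Pw N r * g r t) ^ 2 * (Pw N r)⁻¹ = Pw N r * g r t ^ 2 := fun r hr => by
    have hP := Pp N (hsr hr)
    field_simp
  rw [intervalIntegral.integral_congr e] at lim
  refine le_of_tendsto lim (Eventually.of_forall fun n => ?_)
  have hX := X_int h (hin n) ht0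
  have h1 := trunc_le hX.2 (fun x hx => mul_nonneg (sq_nonneg _) (inv_nonneg.2 (Pw_pos hx).le)) (rl_pos j).le (rl_le j)
  have h2 := key n
  unfold xX at h2
  rw [sub_add_cancel] at h2
  have e2 : ∀ r, ((Mm N (fun x => u x t) r - Mm N (fun x => u x (t - h0 / ((n:ℝ) + 1))) r) / (h0 / ((n:ℝ) + 1))) ^ 2 * (Pw N r)⁻¹ =
     ((h0 / ((n:ℝ) + 1)) ^ 2)⁻¹ * ((Mm N (fun x => u x t) r - Mm N (fun x => u x (t - h0 / ((n:ℝ) + 1))) r) ^ 2 * (Pw N r)⁻¹) := fun r => by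
    rw [div_pow]; ring
  simp only [e2]
  rw [intervalIntegral.integral_const_mul, inv_mul_le_iff₀ (pow_pos (hδp n) 2)]
  exact h1.trans h2
end
end

section
open Real
variable {N : ℕ} {r : ℝ} {t : ℝ}
structure TS (m T : ℝ) (f H D : ℝ → ℝ) : Prop where
  hm : 0 < m
  hm1 : m < 1
  hT : 0 < T
  fpos : ∀ t ∈ Ioo 0 T, 0 < f t
  Hpos : ∀ t ∈ Ioo 0 T, 0 < H t
  fcont : ContinuousOn f (Ioo 0 T)
  Hd : ∀ t ∈ Ioo 0 T, HasDerivAt H (- f t) t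
  Ht : Tendsto H (𝓝[<] T) (𝓝 0)
  cs : ∀ t ∈ Ioo 0 T, f t ^ 2 / (2 * H t) ≤ D t
  dini : ∀ t ∈ Ioo 0 T, ∀ κ < D t, ∀ᶠ z in 𝓝[>] t, f z - f t ≤ - ((m + 1) * κ) * (z - t)
  Hle : ∃ C > 0, ∀ t ∈ Ioo 0 T, H t ^ ((m + 1) / 2) ≤ C * f t
  Dle : ∀ t h0, 0 < h0 → h0 < t → t < T → D t * (h0 * (m + 1)) ≤ f (t - h0)
section
variable {m T : ℝ} {f H D : ℝ → ℝ}
lemma FDC.ts {u g ut : ℝ → ℝ → ℝ} (h : FDC N m T u g ut) : TS m T (fF N m u) (hH N u) (dD N g) where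
  hm := h.hm
  hm1 := h.hm1
  hT := h.hT
  fpos _ ht := fF_pos h ht
  Hpos _ ht := hH_pos h ht
  fcont := fF_cont h
  Hd _ ht := hH_deriv h ht
  Ht := hH_tend h
  cs _ ht := f_sq_le h ht
  Hle := hH_le h
  Dle _ _ h1 h2 h3 := D_le h h1 h2 h3
  dini t ht κ hκ := by
    have hm := h.hm
    obtain ⟨n, hn⟩ := ((tendsto_trunc (h.fl.gint t ht)).eventually_const_lt hκ).exists
    have hc := (Dtr_cont h (rl_pos n) (rr_pos n)).continuousAt (isOpen_Ioo.mem_nhds ht)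
    obtain ⟨δ, hδ, hδ2⟩ := Metric.eventually_nhds_iff.1 ((hc.eventually_const_lt hn).and (isOpen_Ioo.mem_nhds ht))
    filter_upwards [Ioo_mem_nhdsGT (show t < t + δ by linarith)] with z hz
    have hin : ∀ x ∈ Icc t z, dist x t < δ := fun x hx => by
      rw [dist_eq, abs_of_nonneg (by linarith [hx.1])]; linarith [hx.2, hz.2]
    have hzT := (hδ2 (hin z (right_mem_Icc.2 hz.1.le))).2
    have h1 := f_drop h ht.1 hz.1.le hzT.2 (rl_pos n) (rl_le n)
    have h2 : ∫ x in t..z, κ ≤ ∫ τ in t..z, ∫ x in (rl n)..(rr n), Pw N x * g x τ ^ 2 := by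
      refine intervalIntegral.integral_mono_on hz.1.le (by simp) ?_ fun x hx => (hδ2 (hin x hx)).1.le
      refine ((Dtr_cont h (rl_pos n) (rr_pos n)).mono ?_).intervalIntegrable
      rw [uIcc_of_le hz.1.le]
      exact fun x hx => (hδ2 (hin x hx)).2
    rw [intervalIntegral.integral_const, smul_eq_mul] at h2
    nlinarith
lemma Rpow_deriv (h : TS m T f H D) (e : ℝ) (ht : t ∈ Ioo 0 T) :
    HasDerivAt (fun t => H t ^ e) (-(e * f t * H t ^ (e - 1))) t := by
  convert (h.Hd t ht).rpow_const (p := e) (Or.inl (h.Hpos t ht).ne') using 1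
  ring
lemma R_slope (h : TS m T f H D) (ht : t ∈ Ioo 0 T)
    (hr : -((m + 1) * H t ^ (-((m + 1) / 2)) * (D t - f t ^ 2 / (2 * H t))) < r) :
    ∀ᶠ z in 𝓝[>] t, slope (fun t => f t * H t ^ (-((m + 1) / 2))) t z < r := by
  have hm := h.hm
  set e := (m + 1) / 2 with he
  have hH := h.Hpos t ht
  have hd := Rpow_deriv h (-e) ht
  have hE : 0 < H t ^ (-e) := rpow_pos_of_pos hH _
  have e1 : H t ^ (-e - 1) = H t ^ (-e) / H t := by rw [rpow_sub_one hH.ne']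
  have hcl : Tendsto (fun κ => -((m + 1) * κ) * H t ^ (-e) + f t * (-(-e * f t * H t ^ (-e - 1)))) (𝓝[<] (D t))
      (𝓝 (-((m + 1) * D t) * H t ^ (-e) + f t * (-(-e * f t * H t ^ (-e - 1))))) := by
    refine Tendsto.mono_left ?_ nhdsWithin_le_nhds
    exact Continuous.tendsto (by fun_prop) _
  have hlt : -((m + 1) * D t) * H t ^ (-e) + f t * (-(-e * f t * H t ^ (-e - 1))) < r := by
    refine lt_of_eq_of_lt ?_ hr
    rw [e1, he]; field_simp; ring
  obtain ⟨κ, hκ1, hκ2⟩ := ((hcl.eventually_lt_const hlt).and self_mem_nhdsWithin).exists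
  have hs := (hasDerivAt_iff_tendsto_slope.1 hd).mono_left (nhdsGT_le_nhdsNE t)
  have hHc : Tendsto (fun z => H z ^ (-e)) (𝓝[>] t) (𝓝 (H t ^ (-e))) := hd.continuousAt.tendsto.mono_left nhdsWithin_le_nhds
  have hl : Tendsto (fun z => -((m + 1) * κ) * H z ^ (-e) + f t * slope (fun t => H t ^ (-e)) t z) (𝓝[>] t)
    (𝓝 (-((m + 1) * κ) * H t ^ (-e) + f t * (-(-e * f t * H t ^ (-e - 1))))) := (hHc.const_mul _).add (hs.const_mul _)
  filter_upwards [hl.eventually_lt_const hκ1, h.dini t ht κ hκ2, self_mem_nhdsWithin, Ioo_mem_nhdsGT ht.2] with z h1 h2 h3 h4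
  refine lt_of_le_of_lt ?_ h1
  have hz : 0 < z - t := sub_pos.2 h3
  have hHz : 0 < H z ^ (-e) := rpow_pos_of_pos (h.Hpos z ⟨ht.1.trans h4.1, h4.2⟩) _
  rw [slope_def_field, slope_def_field]
  have e2 : (f z * H z ^ (-e) - f t * H t ^ (-e)) / (z - t) = (f z - f t) / (z - t) * H z ^ (-e) + f t * ((H z ^ (-e) - H t ^ (-e)) / (z - t)) := by
    field_simp; ring
  rw [e2]
  gcongr
  rwa [div_le_iff₀ hz]
lemma R_cont (h : TS m T f H D) : ContinuousOn (fun t => f t * H t ^ (-((m + 1) / 2))) (Ioo 0 T) :=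
  h.fcont.mul fun _ ht => (Rpow_deriv h _ ht).continuousAt.continuousWithinAt
lemma R_drop (h : TS m T f H D) {t1 t2 η L : ℝ} (ht1 : 0 < t1) (h12 : t1 ≤ t2) (ht2 : t2 < T) (hη : 0 ≤ η)
    (hd : ∀ t ∈ Ico t1 t2, η * f t / (T - t) ≤ D t - f t ^ 2 / (2 * H t))
    (hL : ∀ t ∈ Ico t1 t2, L ≤ f t * H t ^ (-((m + 1) / 2))) :
    f t2 * H t2 ^ (-((m + 1) / 2)) ≤ f t1 * H t1 ^ (-((m + 1) / 2)) + (m + 1) * η * L * (log (T - t2) - log (T - t1)) := by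
  have hm := h.hm
  have hs : Icc t1 t2 ⊆ Ioo 0 T := fun x hx => ⟨ht1.trans_le hx.1, hx.2.trans_lt ht2⟩
  have hBd : ∀ x ∈ Icc t1 t2, HasDerivAt (fun t => f t1 * H t1 ^ (-((m + 1) / 2)) + (m + 1) * η * L * (log (T - t) - log (T - t1)))
      ((m + 1) * η * L * ((-1) / (T - x))) x := fun x hx => by
    have := (((hasDerivAt_id x).const_sub T).log (by have := (hs hx).2; simp only [id]; linarith))
    exact ((this.sub_const _).const_mul _).const_add _
  refine image_le_of_liminf_slope_right_le_deriv_boundary (f := fun t => f t * H t ^ (-((m + 1) / 2)))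
    (B := fun t => f t1 * H t1 ^ (-((m + 1) / 2)) + (m + 1) * η * L * (log (T - t) - log (T - t1)))
    (B' := fun x => (m + 1) * η * L * ((-1) / (T - x)))
    ((R_cont h).mono hs) (by simp) (fun x hx => (hBd x hx).continuousAt.continuousWithinAt)
    (fun x hx => (hBd x ⟨hx.1, hx.2.le⟩).hasDerivWithinAt) (fun x hx r hr => ?_) (right_mem_Icc.2 h12)
  have hxT := hs ⟨hx.1, hx.2.le⟩
  refine (R_slope h hxT (lt_of_le_of_lt ?_ hr)).frequently
  have hE : 0 < H x ^ (-((m + 1) / 2)) := rpow_pos_of_pos (h.Hpos x hxT) _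
  have hTx : 0 < T - x := sub_pos.2 hxT.2
  have h1 := mul_le_mul_of_nonneg_left (hd x hx) hE.le
  have h2 := mul_le_mul_of_nonneg_left (hL x hx) (show 0 ≤ η / (T - x) by positivity)
  have e : H x ^ (-((m + 1) / 2)) * (η * f x / (T - x)) = η / (T - x) * (f x * H x ^ (-((m + 1) / 2))) := by ring
  have h3 : η / (T - x) * L ≤ H x ^ (-((m + 1) / 2)) * (D x - f x ^ 2 / (2 * H x)) := by linarith
  have h4 := mul_le_mul_of_nonneg_left h3 (show 0 ≤ m + 1 by positivity)
  calc _ ≤ -((m + 1) * (η / (T - x) * L)) := by linarith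
    _ = _ := by ring
lemma R_anti (h : TS m T f H D) {t1 t2 : ℝ} (ht1 : 0 < t1) (h12 : t1 ≤ t2) (ht2 : t2 < T) :
    f t2 * H t2 ^ (-((m + 1) / 2)) ≤ f t1 * H t1 ^ (-((m + 1) / 2)) := by
  have := R_drop h (η := 0) (L := 0) ht1 h12 ht2 le_rfl (fun t ht => by
    have := h.cs t ⟨ht1.trans_le ht.1, ht.2.trans ht2⟩
    simp; linarith) (fun t ht => by
    have ht' : t ∈ Ioo 0 T := ⟨ht1.trans_le ht.1, ht.2.trans ht2⟩
    have := h.fpos t ht'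
    have := h.Hpos t ht'
    positivity)
  simpa using this
lemma R_lim (h : TS m T f H D) : ∃ L > 0, Tendsto (fun t => f t * H t ^ (-((m + 1) / 2))) (𝓝[<] T) (𝓝 L) ∧
    ∀ t ∈ Ioo 0 T, L ≤ f t * H t ^ (-((m + 1) / 2)) := by
  obtain ⟨C, hC, hCb⟩ := h.Hle
  set R := fun t => f t * H t ^ (-((m + 1) / 2)) with hR
  have hlow : ∀ t ∈ Ioo 0 T, 1 / C ≤ R t := fun t ht => by
    have h1 := hCb t ht
    have hH := h.Hpos t ht
    simp only [hR]
    rw [rpow_neg hH.le, ← div_eq_mul_inv, le_div_iff₀ (by positivity), one_div_mul_eq_div, div_le_iff₀ hC]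
    linarith
  set L := sInf (R '' Ioo 0 T) with hL
  have hbb : BddBelow (R '' Ioo 0 T) := ⟨1 / C, by rintro _ ⟨t, ht, rfl⟩; exact hlow t ht⟩
  have hne : (R '' Ioo 0 T).Nonempty := ⟨_, T / 2, ⟨by linarith [h.hT], by linarith [h.hT]⟩, rfl⟩
  refine ⟨L, lt_of_lt_of_le (by positivity : 0 < 1 / C) (le_csInf hne (by rintro _ ⟨t, ht, rfl⟩; exact hlow t ht)), ?_, fun t ht => csInf_le hbb ⟨t, ht, rfl⟩⟩
  refine tendsto_order.2 ⟨fun a ha => ?_, fun a ha => ?_⟩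
  · filter_upwards [Ioo_mem_nhdsLT h.hT] with t ht
    exact ha.trans_le (csInf_le hbb ⟨t, ht, rfl⟩)
  · obtain ⟨_, ⟨t, ht, rfl⟩, h2⟩ := exists_lt_of_csInf_lt hne ha
    filter_upwards [Ioo_mem_nhdsLT ht.2] with z hz
    exact (R_anti h ht.1 hz.1.le hz.2).trans_lt h2
lemma Ha_lim (h : TS m T f H D) {L : ℝ} (hL : Tendsto (fun t => f t * H t ^ (-((m + 1) / 2))) (𝓝[<] T) (𝓝 L)) :
    Tendsto (fun t => H t ^ ((1 - m) / 2) / (T - t)) (𝓝[<] T) (𝓝 ((1 - m) / 2 * L)) := by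
  have hm1 := h.hm1
  refine HasDerivAt.lhopital_zero_left_on_Ioo (f := fun t => H t ^ ((1 - m) / 2)) (g := fun t => T - t)
    (f' := fun t => -((1 - m) / 2 * f t * H t ^ ((1 - m) / 2 - 1))) (g' := fun _ => -1) h.hT
    (fun x hx => Rpow_deriv h _ hx) (fun x hx => by simpa using (hasDerivAt_id x).const_sub T) (by simp) ?_ ?_ ?_
  · have := h.Ht.rpow_const (p := (1 - m) / 2) (Or.inr (by linarith))
    rwa [zero_rpow (by linarith)] at this
  · have : Tendsto (fun t => T - t) (𝓝 T) (𝓝 (T - T)) := Continuous.tendsto (by fun_prop) _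
    rw [sub_self] at this
    exact this.mono_left nhdsWithin_le_nhds
  · refine (hL.const_mul ((1 - m) / 2)).congr fun t => ?_
    rw [show (1 - m) / 2 - 1 = -((m + 1) / 2) by ring]
    ring
noncomputable def lam (m T t : ℝ) : ℝ := ((T - t) / T) ^ (-(1 / (1 - m)))
lemma lam_pos (hT : 0 < T) (ht : t < T) : 0 < lam m T t :=
  rpow_pos_of_pos (div_pos (sub_pos.2 ht) hT) _
lemma lam_pow (_ : m < 1) (hT : 0 < T) (ht : t < T) (q : ℝ) : lam m T t ^ q = (T ^ (q / (1 - m))) * (T - t) ^ (-(q / (1 - m))) := by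
  have := sub_pos.2 ht
  rw [lam, ← rpow_mul (div_pos (sub_pos.2 ht) hT).le, div_rpow this.le hT.le, show -(1 / (1 - m)) * q = - (q / (1 - m)) by ring,
    rpow_neg hT.le, div_inv_eq_mul, mul_comm]
lemma lam_one (hm1 : m < 1) (hT : 0 < T) (ht : t < T) : lam m T t ^ (1 - m) = T / (T - t) := by
  rw [lam_pow hm1 hT ht, div_self (by linarith), rpow_one, rpow_neg_one, div_eq_mul_inv]
lemma ts_lim (h : TS m T f H D) : ∃ L > 0, ∃ F > 0, ∃ K > 0,
    Tendsto (fun t => f t * H t ^ (-((m + 1) / 2))) (𝓝[<] T) (𝓝 L) ∧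
    (∀ t ∈ Ioo 0 T, L ≤ f t * H t ^ (-((m + 1) / 2))) ∧
    Tendsto (fun t => lam m T t ^ (m + 1) * f t) (𝓝[<] T) (𝓝 F) ∧
    Tendsto (fun t => lam m T t ^ (2:ℝ) * H t) (𝓝[<] T) (𝓝 K) ∧
    Tendsto (fun t => (1 - m) * (T - t) * (f t / (2 * H t))) (𝓝[<] T) (𝓝 1) := by
  obtain ⟨L, hL, hLt, hLb⟩ := R_lim h
  have hm1 := h.hm1
  have hm := h.hm
  have hT := h.hT
  have hA := Ha_lim h hLt
  have hA0 : 0 < (1 - m) / 2 * L := mul_pos (by linarith) hL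
  refine ⟨L, hL, T ^ ((m + 1) / (1 - m)) * (L * ((1 - m) / 2 * L) ^ ((m + 1) / (1 - m))), by positivity,
    T ^ (2 / (1 - m)) * ((1 - m) / 2 * L) ^ (2 / (1 - m)), by positivity, hLt, hLb, ?_, ?_, ?_⟩
  · refine ((hLt.mul (hA.rpow_const (p := (m + 1) / (1 - m)) (Or.inl hA0.ne'))).const_mul (T ^ ((m + 1) / (1 - m)))).congr' ?_
    filter_upwards [Ioo_mem_nhdsLT h.hT] with t ht
    have hH := h.Hpos t ht
    have hS := sub_pos.2 ht.2
    rw [lam_pow hm1 hT ht.2, div_rpow (by positivity) hS.le, ← rpow_mul hH.le,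
      show (1 - m) / 2 * ((m + 1) / (1 - m)) = (m + 1) / 2 by field_simp [show (1 - m) ≠ 0 by linarith], rpow_neg hH.le, rpow_neg hS.le]
    have : 0 < H t ^ ((m + 1) / 2) := by positivity
    field_simp
  · refine ((hA.rpow_const (p := 2 / (1 - m)) (Or.inl hA0.ne')).const_mul (T ^ (2 / (1 - m)))).congr' ?_
    filter_upwards [Ioo_mem_nhdsLT h.hT] with t ht
    have hH := h.Hpos t ht
    have hS := sub_pos.2 ht.2
    rw [lam_pow hm1 hT ht.2, div_rpow (by positivity) hS.le, ← rpow_mul hH.le,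
      show (1 - m) / 2 * (2 / (1 - m)) = 1 by field_simp [show (1 - m) ≠ 0 by linarith], rpow_one, rpow_neg hS.le]
    field_simp
  · have := (hLt.div hA hA0.ne').const_mul ((1 - m) / 2)
    have e : (1 - m) / 2 * (L / ((1 - m) / 2 * L)) = 1 := by field_simp [show (1 - m) ≠ 0 by linarith]
    rw [e] at this
    refine this.congr' ?_
    filter_upwards [Ioo_mem_nhdsLT h.hT] with t ht
    have hH := h.Hpos t ht
    have hS := sub_pos.2 ht.2
    have e2 : H t ^ (-((m + 1) / 2)) = H t ^ ((1 - m) / 2) / H t := by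
      rw [← rpow_sub_one hH.ne']; congr 1; ring
    have : 0 < H t ^ ((1 - m) / 2) := by positivity
    simp only [Pi.div_apply]
    rw [e2]; field_simp
lemma ts_D (h : TS m T f H D) : ∃ C > 0, ∀ᶠ t in 𝓝[<] T, lam m T t ^ (2 * m) * D t ≤ C := by
  obtain ⟨L, hL, F, hF, K, hK, -, -, h3, -, -⟩ := ts_lim h
  have hm1 := h.hm1
  have hm := h.hm
  have hT := h.hT
  have hmv : Tendsto (fun t => t - (T - t)) (𝓝[<] T) (𝓝[<] T) := by
    refine tendsto_nhdsWithin_iff.2 ⟨?_, ?_⟩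
    · have : Tendsto (fun t => t - (T - t)) (𝓝 T) (𝓝 (T - (T - T))) := Continuous.tendsto (by fun_prop) _
      rw [sub_self, sub_zero] at this
      exact this.mono_left nhdsWithin_le_nhds
    · filter_upwards [self_mem_nhdsWithin] with t ht
      have : t < T := ht
      simp only [mem_Iio]; linarith
  refine ⟨(F + 1) * 2 ^ ((m + 1) / (1 - m)) / (T * (m + 1)), by positivity, ?_⟩
  filter_upwards [(h3.comp hmv).eventually_le_const (show F < F + 1 by linarith), Ioo_mem_nhdsLT (show T / 2 < T by linarith)] with t h1 ht
  have hS := sub_pos.2 ht.2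
  have hd := h.Dle t (T - t) hS (by linarith [ht.1]) ht.2
  simp only [Function.comp] at h1
  have hl : lam m T t ^ (m + 1) = 2 ^ ((m + 1) / (1 - m)) * lam m T (t - (T - t)) ^ (m + 1) := by
    rw [lam_pow hm1 hT ht.2, lam_pow hm1 hT (by linarith), show T - (t - (T - t)) = 2 * (T - t) by ring, mul_rpow (by norm_num) hS.le,
      rpow_neg (by norm_num : (0:ℝ) ≤ 2)]
    field_simp
  have hp := lam_pos (m := m) hT ht.2
  have e : lam m T t ^ (2 * m) = lam m T t ^ (m + 1) * ((T - t) / T) := by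
    have : lam m T t ^ (2 * m) * lam m T t ^ (1 - m) = lam m T t ^ (m + 1) := by
      rw [← rpow_add hp]; congr 1; ring
    rw [lam_one hm1 hT ht.2] at this
    rw [← this]; field_simp
  rw [le_div_iff₀ (by positivity)]
  have h5 : lam m T t ^ (m + 1) * f (t - (T - t)) ≤ (F + 1) * 2 ^ ((m + 1) / (1 - m)) := by
    rw [hl, mul_assoc, mul_comm]; gcongr
  refine le_trans ?_ h5
  have h6 := mul_le_mul_of_nonneg_left hd (rpow_nonneg hp.le (m + 1))
  refine le_trans (le_of_eq ?_) h6
  rw [e]; field_simp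
lemma ts_good (h : TS m T f H D) {ε θ : ℝ} (hε : 0 < ε) (hθ : 0 < θ) (hθ1 : θ < 1) : ∀ᶠ t in 𝓝[<] T, ∃ σ, σ ∈ Ioo 0 T ∧ σ ≤ t ∧ θ * (T - σ) ≤ T - t ∧
    lam m T σ ^ (2 * m) * (D σ - 2 * (1 / ((1 - m) * (T - σ))) * f σ + 2 * (1 / ((1 - m) * (T - σ))) ^ 2 * H σ) < ε := by
  obtain ⟨L, hL, F, hF, K, hK, h1, h2, h3, h4, h5⟩ := ts_lim h
  have hm1 := h.hm1
  have hm := h.hm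
  have hT := h.hT
  have hm10 : 0 < 1 - m := by linarith
  set η := ε * T / (4 * F) with hη
  have hη0 : 0 < η := by positivity
  have hlog : 0 < -log θ := by linarith [log_neg hθ hθ1]
  have hlim5 : Tendsto (fun t => 2 * (lam m T t ^ (2:ℝ) * H t) / ((1 - m) * T) ^ 2 * (1 - (1 - m) * (T - t) * (f t / (2 * H t))) ^ 2) (𝓝[<] T) (𝓝 0) := by
    have := ((h4.const_mul 2).div_const (((1 - m) * T) ^ 2)).mul ((h5.const_sub 1).pow 2)
    simpa using this
  have ev : ∀ᶠ t in 𝓝[<] T, f t * H t ^ (-((m + 1) / 2)) < L + (m + 1) * η * L * (-log θ) ∧ lam m T t ^ (m + 1) * f t < 2 * F ∧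
      2 * (lam m T t ^ (2:ℝ) * H t) / ((1 - m) * T) ^ 2 * (1 - (1 - m) * (T - t) * (f t / (2 * H t))) ^ 2 < ε / 2 :=
    (h1.eventually_lt_const (by have : 0 < (m + 1) * η * L * (-log θ) := by positivity
                                linarith)).and ((h3.eventually_lt_const (by linarith)).and (hlim5.eventually_lt_const (by positivity)))
  obtain ⟨a, ha, ha2⟩ := (mem_nhdsLT_iff_exists_Ioo_subset' hT).1 ev
  set a' := max a 0 with ha'
  have ha'T : a' < T := max_lt ha hT
  have hb : T - θ * (T - a') < T := by nlinarith
  filter_upwards [Ioo_mem_nhdsLT hb] with t ht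
  set t1 := T - (T - t) / θ with ht1
  have ht1a : a' < t1 := by
    have : (T - t) / θ < T - a' := by rw [div_lt_iff₀ hθ]; linarith [ht.1]
    linarith
  have hS := sub_pos.2 ht.2
  have ht1t : t1 < t := by
    have : T - t < (T - t) / θ := by rw [lt_div_iff₀ hθ]; nlinarith
    linarith
  have hin : ∀ σ ∈ Icc t1 t, a < σ ∧ 0 < σ ∧ σ < T := fun σ hσ =>
    ⟨(le_max_left a 0).trans_lt (ht1a.trans_le hσ.1), (le_max_right a 0).trans_lt (ht1a.trans_le hσ.1), hσ.2.trans_lt ht.2⟩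
  have hex : ∃ σ ∈ Ico t1 t, D σ - f σ ^ 2 / (2 * H σ) < η * f σ / (T - σ) := by
    by_contra hcon
    push Not at hcon
    have hd := R_drop h (hin t1 ⟨le_rfl, ht1t.le⟩).2.1 ht1t.le ht.2 hη0.le hcon (L := L) (fun σ hσ => h2 σ (hin σ ⟨hσ.1, hσ.2.le⟩).2)
    have hlt := (ha2 (show t1 ∈ Ioo a T from ⟨(hin t1 ⟨le_rfl, ht1t.le⟩).1, (hin t1 ⟨le_rfl, ht1t.le⟩).2.2⟩)).1
    have hle := h2 t (hin t ⟨ht1t.le, le_rfl⟩).2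
    have e : log (T - t) - log (T - t1) = log θ := by
      rw [show T - t1 = (T - t) / θ by rw [ht1]; ring, log_div hS.ne' hθ.ne']; ring
    rw [e] at hd
    nlinarith
  obtain ⟨σ, hσ, hσ2⟩ := hex
  have hσ' := hin σ ⟨hσ.1, hσ.2.le⟩
  obtain ⟨-, c2, c3⟩ := ha2 (show σ ∈ Ioo a T from ⟨hσ'.1, hσ'.2.2⟩)
  have hSσ := sub_pos.2 hσ'.2.2
  refine ⟨σ, hσ'.2, hσ.2.le, ?_, ?_⟩
  · have : T - σ ≤ (T - t) / θ := by linarith [hσ.1]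
    rw [le_div_iff₀ hθ] at this; linarith
  · have hH := h.Hpos σ hσ'.2
    have hp := lam_pos (m := m) hT hσ'.2.2
    have hl1 := lam_one hm1 hT hσ'.2.2
    have hA : 0 < lam m T σ ^ (2 * m) := by positivity
    have e1 : lam m T σ ^ (m + 1) = lam m T σ ^ (2 * m) * (T / (T - σ)) := by
      rw [← hl1, ← rpow_add hp]; congr 1; ring
    have e2 : lam m T σ ^ (2:ℝ) = lam m T σ ^ (2 * m) * (T / (T - σ)) ^ 2 := by
      rw [← hl1, ← rpow_natCast, ← rpow_mul hp.le, ← rpow_add hp]; congr 1; push_cast; ring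
    rw [e1] at c2
    rw [e2] at c3
    have e3 : lam m T σ ^ (2 * m) * (D σ - 2 * (1 / ((1 - m) * (T - σ))) * f σ + 2 * (1 / ((1 - m) * (T - σ))) ^ 2 * H σ) =
      lam m T σ ^ (2 * m) * (D σ - f σ ^ 2 / (2 * H σ)) + 2 * (lam m T σ ^ (2 * m) * (T / (T - σ)) ^ 2 * H σ) / ((1 - m) * T) ^ 2 * (1 - (1 - m) * (T - σ) * (f σ / (2 * H σ))) ^ 2 := by
      field_simp; ring
    rw [e3]
    have h7 : lam m T σ ^ (2 * m) * (D σ - f σ ^ 2 / (2 * H σ)) < ε / 2 := by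
      refine (mul_lt_mul_of_pos_left hσ2 hA).trans ?_
      have e4 : lam m T σ ^ (2 * m) * (η * f σ / (T - σ)) = (lam m T σ ^ (2 * m) * (T / (T - σ)) * f σ) * (η / T) := by field_simp
      rw [e4]
      refine (mul_lt_mul_of_pos_right c2 (by positivity)).trans_le (le_of_eq ?_)
      rw [hη]; field_simp; ring
    linarith
end
end

section
open Real
variable {r : ℝ} {t : ℝ}
lemma le_of_deriv0 {φ φ' : ℝ → ℝ} {r l : ℝ} (hr : 0 < r) (hc : ContinuousOn φ (Ioc 0 r)) (hd : ∀ x ∈ Ioo 0 r, HasDerivAt φ (φ' x) x)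
    (h0 : ∀ x ∈ Ioo 0 r, 0 ≤ φ' x) (hl : Tendsto φ (𝓝[>] 0) (𝓝 l)) : l ≤ φ r := by
  have hm : MonotoneOn φ (Ioc 0 r) := monotoneOn_of_deriv_nonneg (convex_Ioc 0 r) hc
    (by rw [interior_Ioc]; exact fun x hx => (hd x hx).differentiableAt.differentiableWithinAt)
    (by rw [interior_Ioc]; exact fun x hx => by rw [(hd x hx).deriv]; exact h0 x hx)
  refine le_of_tendsto hl ?_
  filter_upwards [Ioo_mem_nhdsGT hr] with x hx
  exact hm ⟨hx.1, hx.2.le⟩ ⟨hr, le_rfl⟩ hx.2.le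
lemma lt_of_deriv0 {φ φ' : ℝ → ℝ} {r l : ℝ} (hr : 0 < r) (hc : ContinuousOn φ (Ioc 0 r)) (hd : ∀ x ∈ Ioo 0 r, HasDerivAt φ (φ' x) x)
    (h0 : ∀ x ∈ Ioo 0 r, 0 < φ' x) (hl : Tendsto φ (𝓝[>] 0) (𝓝 l)) : l < φ r := by
  have hm : StrictMonoOn φ (Ioc 0 r) := strictMonoOn_of_deriv_pos (convex_Ioc 0 r) hc
    (by rw [interior_Ioc]; exact fun x hx => by rw [(hd x hx).deriv]; exact h0 x hx)
  have h1 : l ≤ φ (r / 2) := le_of_deriv0 (φ' := φ') (by positivity) (hc.mono (Ioc_subset_Ioc_right (by linarith)))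
    (fun x hx => hd x ⟨hx.1, by linarith [hx.2]⟩) (fun x hx => (h0 x ⟨hx.1, by linarith [hx.2]⟩).le) hl
  exact h1.trans_lt (hm ⟨by positivity, by linarith⟩ ⟨hr, le_rfl⟩ (by linarith))
lemma lt_of_derivT {φ φ' : ℝ → ℝ} {r l : ℝ} (hd : ∀ x ≥ r, HasDerivAt φ (φ' x) x)
    (h0 : ∀ x > r, φ' x < 0) (hl : Tendsto φ atTop (𝓝 l)) : l < φ r := by
  have hm : StrictAntiOn φ (Ici r) := strictAntiOn_of_deriv_neg (convex_Ici r) (fun x hx => (hd x hx).continuousAt.continuousWithinAt)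
    (by rw [interior_Ici]; exact fun x hx => by rw [(hd x (le_of_lt hx)).deriv]; exact h0 x hx)
  have h1 : l ≤ φ (r + 1) := by
    refine le_of_tendsto hl ?_
    filter_upwards [eventually_ge_atTop (r + 1)] with x hx
    exact hm.antitoneOn (by simp) (by simp only [mem_Ici]; linarith) hx
  exact h1.trans_lt (hm (by simp) (by simp) (by linarith))
section
variable {N : ℕ} {p c : ℝ} {y : ℝ → ℝ}
lemma coth_deriv (hr : 0 < r) : HasDerivAt (fun r => cosh r / sinh r) (1 - (cosh r / sinh r) ^ 2) r := by
  have h0 := sinh_pos_iff.2 hr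
  refine ((hasDerivAt_cosh r).div (hasDerivAt_sinh r) h0.ne').congr_deriv ?_
  field_simp
lemma coth_gt (hr : 0 < r) : 1 < cosh r / sinh r := by
  rw [one_lt_div (sinh_pos_iff.2 hr)]; exact sinh_lt_cosh r
lemma coth_le (hr : 1 ≤ r) : cosh r / sinh r ≤ 2 := by
  have h1 := le_sinh (zero_le_one.trans hr)
  have h0 : 0 < sinh r := by linarith
  rw [div_le_iff₀ h0]
  nlinarith [cosh_sq r, cosh_pos r]
lemma Pw_infty (hN : 2 ≤ N) : Tendsto (Pw N) atTop atTop := by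
  refine tendsto_atTop_mono' _ ?_ tendsto_id
  filter_upwards [eventually_ge_atTop 1] with r hr
  have h1 := le_sinh (zero_le_one.trans hr)
  unfold Pw
  simp only [id]
  exact h1.trans (le_self_pow₀ (by linarith) (by omega))
lemma Sg_lt_B (hN : 2 ≤ N) (hr : 0 < r) :
    Sg N r < cosh r / sinh r / ((1 + ((N:ℝ) - 2) * (cosh r / sinh r) ^ 2) * Pw N r) := by
  have hN2 : (0:ℝ) ≤ (N:ℝ) - 2 := by have : (2:ℝ) ≤ N := by exact_mod_cast hN
                                     linarith
  set κ := fun r => cosh r / sinh r with hκ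
  set φ := fun r => κ r / ((1 + ((N:ℝ) - 2) * κ r ^ 2) * Pw N r) - Sg N r with hφ
  suffices h : 0 < φ r by simp only [hφ, hκ] at h; linarith
  have hd : ∀ x > 0, HasDerivAt φ (2 * (1 - κ x ^ 2) / (Pw N x * (1 + ((N:ℝ) - 2) * κ x ^ 2) ^ 2)) x := fun x hx => by
    have hP := Pp N hx
    have h1 := coth_deriv hx
    have hG : 0 < 1 + ((N:ℝ) - 2) * κ x ^ 2 := by positivity
    have := (h1.div ((((h1.pow 2).const_mul ((N:ℝ) - 2)).const_add 1).mul (Pw_hasDeriv hN hx)) (mul_pos hG hP).ne').sub (Sg_hasDeriv hN hx)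
    refine this.congr_deriv ?_
    simp only [hκ, Pi.mul_apply, Pi.pow_apply, Nat.add_one_sub_one, pow_one] at hG ⊢
    generalize cosh x / sinh x = k at *
    have hG' := hG.ne'
    field_simp
    push_cast
    ring
  refine lt_of_derivT (fun x hx => hd x (hr.trans_le hx)) (fun x hx => ?_) ?_
  · have hx0 : 0 < x := hr.trans hx
    have hP := Pp N hx0
    have h1 : 1 < κ x := coth_gt hx0
    refine div_neg_of_neg_of_pos (by nlinarith) (by positivity)
  · have h1 : Tendsto (fun r => κ r / ((1 + ((N:ℝ) - 2) * κ r ^ 2) * Pw N r)) atTop (𝓝 0) := by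
      refine squeeze_zero' (g := fun r => 2 / Pw N r) ?_ ?_ (tendsto_const_nhds.div_atTop (Pw_infty hN))
      · filter_upwards [eventually_ge_atTop 1] with x hx
        have hx0 : 0 < x := by linarith
        have hP := Pp N hx0
        have h1 : 1 < κ x := coth_gt hx0
        positivity
      · filter_upwards [eventually_ge_atTop 1] with x hx
        have hx0 : 0 < x := by linarith
        have hP := Pp N hx0
        have h1 : κ x ≤ 2 := coth_le hx
        gcongr
        have : 0 ≤ ((N:ℝ) - 2) * κ x ^ 2 := by positivity
        nlinarith
    simpa using h1.sub (Sg_tendsto hN)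
lemma kPs_anti (hN : 2 ≤ N) : StrictAntiOn (fun r => cosh r / sinh r * Pw N r * Sg N r) IP := by
  have hN2 : (0:ℝ) ≤ (N:ℝ) - 2 := by have : (2:ℝ) ≤ N := by exact_mod_cast hN
                                     linarith
  have hd : ∀ x > 0, HasDerivAt (fun r => cosh r / sinh r * Pw N r * Sg N r)
      (Pw N x * (1 + ((N:ℝ) - 2) * (cosh x / sinh x) ^ 2) * Sg N x - cosh x / sinh x) x := fun x hx => by
    have hP := Pp N hx
    refine (((coth_deriv hx).mul (Pw_hasDeriv hN hx)).mul (Sg_hasDeriv hN hx)).congr_deriv ?_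
    simp only [Pi.mul_apply]
    generalize cosh x / sinh x = k
    field_simp
    ring
  refine strictAntiOn_of_deriv_neg (convex_Ioi 0) (fun x hx => (hd x hx).continuousAt.continuousWithinAt) ?_
  rw [interior_Ioi]
  intro x hx
  rw [(hd x hx).deriv]
  have h1 := Sg_lt_B hN hx
  have hP := Pp N hx
  rw [lt_div_iff₀ (by positivity)] at h1
  linarith
structure Prof (N : ℕ) (p c : ℝ) (y : ℝ → ℝ) : Prop where
  hN : 2 ≤ N
  hp : 1 < p
  hc : 0 < c
  hsub : ((N:ℝ) - 2) * p < N + 2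
  ypos : ∀ r > 0, 0 < y r
  ybd : ∃ C > 0, ∀ r > 0, y r ≤ C
  ysq : ∃ K > 0, ∀ r > 0, y r ≤ K * √(Sg N r)
  yd : ∀ r > 0, HasDerivAt y (-(c * Mm N (fun x => y x ^ p) r / Pw N r)) r
lemma Prof.yc (h : Prof N p c y) : ContinuousOn y IP := fun r hr => (h.yd r hr).continuousAt.continuousWithinAt
lemma Prof.pc (h : Prof N p c y) : ContinuousOn (fun x => y x ^ p) IP := h.yc.rpow_const fun x hx => Or.inl (h.ypos x hx).ne'
lemma Prof.p0 (h : Prof N p c y) : ∀ x > 0, 0 ≤ y x ^ p := fun x hx => rpow_nonneg (h.ypos x hx).le _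
lemma Prof.int (h : Prof N p c y) : IntegrableOn (fun x => Pw N x * y x ^ p * √(Sg N x)) IP := by
  obtain ⟨K, hK, hb⟩ := h.ysq
  have hp := h.hp
  refine Integrable.mono' ((Sp_int h.hN h.hp h.hsub).const_mul (K ^ p))
    ((((Pw_cont N).continuousOn.mul h.pc).mul (sqS_cont h.hN)).aestronglyMeasurable mI) ?_
  filter_upwards [ae_restrict_mem mI] with x hx
  have hP := Pp N hx
  have hs := Sg_pos h.hN hx
  have hy := h.ypos x hx
  have h1 : y x ^ p ≤ K ^ p * Sg N x ^ (p / 2) := by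
    refine (rpow_le_rpow hy.le (hb x hx) (by linarith)).trans (le_of_eq ?_)
    rw [mul_rpow hK.le (by positivity), sqrt_eq_rpow, ← rpow_mul hs.le]
    congr 2; ring
  rw [norm_of_nonneg (by positivity)]
  calc _ ≤ Pw N x * (K ^ p * Sg N x ^ (p / 2)) * √(Sg N x) := by gcongr
    _ = _ := by ring
lemma Prof.Md (h : Prof N p c y) (hr : 0 < r) : HasDerivAt (Mm N (fun x => y x ^ p)) (Pw N r * y r ^ p) r :=
  M_deriv h.pc hr (Mint h.hN h.pc h.p0 h.int hr.le)
lemma Prof.M0 (h : Prof N p c y) (hr : 0 < r) : 0 ≤ Mm N (fun x => y x ^ p) r := M_nonneg h.p0 hr.le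
lemma Prof.Mle (h : Prof N p c y) {C : ℝ} (hC : ∀ r > 0, y r ≤ C) (hr : 0 < r) : Mm N (fun x => y x ^ p) r ≤ C ^ p * (r * Pw N r) := by
  have hp := h.hp
  have : Mm N (fun x => y x ^ p) r ≤ ∫ x in 0..r, Pw N r * C ^ p := by
    refine intervalIntegral.integral_mono_on_of_le_Ioo hr.le (Mint h.hN h.pc h.p0 h.int hr.le) (by simp) fun x hx => ?_
    have hy := h.ypos x hx.1
    have hP := Pw_nonneg (N := N) hx.1.le
    have := hC x hx.1
    gcongr
    · exact Pw_nonneg hr.le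
    · exact Pw_mono hx.1.le hx.2.le
    · exact rpow_le_rpow hy.le this (by linarith)
  rw [intervalIntegral.integral_const, smul_eq_mul, sub_zero] at this
  linarith
lemma Prof.Mt (h : Prof N p c y) : Tendsto (Mm N (fun x => y x ^ p)) (𝓝[>] 0) (𝓝 0) := by
  obtain ⟨C, hC, hb⟩ := h.ybd
  refine squeeze_zero' (g := fun r => C ^ p * (r * Pw N r)) ?_ ?_ ?_
  · filter_upwards [self_mem_nhdsWithin] with r hr using h.M0 hr
  · filter_upwards [self_mem_nhdsWithin] with r hr using h.Mle hb hr
  · have : Tendsto (fun r => C ^ p * (r * Pw N r)) (𝓝 0) (𝓝 (C ^ p * (0 * Pw N 0))) :=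
      Continuous.tendsto (by have := Pw_cont N; fun_prop) _
    rw [zero_mul, mul_zero] at this
    exact this.mono_left nhdsWithin_le_nhds
lemma Prof.yinf (h : Prof N p c y) : Tendsto y atTop (𝓝 0) := by
  obtain ⟨K, hK, hb⟩ := h.ysq
  refine squeeze_zero' (g := fun r => K * √(Sg N r)) ?_ ?_ ?_
  · filter_upwards [eventually_gt_atTop 0] with r hr using (h.ypos r hr).le
  · filter_upwards [eventually_gt_atTop 0] with r hr using hb r hr
  · simpa using (sqS_tendsto h.hN).const_mul K
lemma Prof.Ms (h : Prof N p c y) (hr : 0 < r) : c * Mm N (fun x => y x ^ p) r * Sg N r < y r := by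
  set M := Mm N (fun x => y x ^ p) with hM
  have hc := h.hc
  have hlim : Tendsto (fun r => y r - c * (M r * √(Sg N r) * √(Sg N r))) atTop (𝓝 (0 - c * (0 * 0))) :=
    h.yinf.sub (((M_infty h.hN h.pc h.p0 h.int).mul (sqS_tendsto h.hN)).const_mul c)
  have key := lt_of_derivT (φ := fun r => y r - c * (M r * Sg N r)) (φ' := fun r => -(c * (Pw N r * y r ^ p * Sg N r))) (r := r) (l := 0)
    (fun x hx => by
      have hx0 : 0 < x := hr.trans_le hx
      have hP := Pp N hx0
      refine ((h.yd x hx0).sub (((h.Md hx0).mul (Sg_hasDeriv h.hN hx0)).const_mul c)).congr_deriv ?_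
      simp only [← hM]
      field_simp; ring) (fun x hx => by
      have hx0 : 0 < x := hr.trans hx
      have hP := Pp N hx0
      have := Sg_pos h.hN hx0
      have := h.ypos x hx0
      simp only [Left.neg_neg_iff]
      positivity) (by
      simp only [mul_zero, sub_zero] at hlim
      refine hlim.congr' ?_
      filter_upwards [eventually_gt_atTop 0] with x hx
      rw [mul_assoc, mul_self_sqrt (Sg_pos h.hN hx).le])
  linarith [key]
noncomputable def jJ (N : ℕ) (p c : ℝ) (y : ℝ → ℝ) (r : ℝ) : ℝ :=
  1 / 2 * Sg N r * (c * Mm N (fun x => y x ^ p) r) ^ 2 - 1 / 2 * y r * (c * Mm N (fun x => y x ^ p) r) +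
    c * Pw N r ^ 2 * Sg N r * y r ^ (p + 1) / (p + 1)
lemma jJ_deriv (h : Prof N p c y) (hr : 0 < r) : HasDerivAt (jJ N p c y)
    (-(c * Pw N r * y r ^ (p + 1) / (p + 1) * ((p + 3) / 2 - 2 * ((N:ℝ) - 1) * (cosh r / sinh r * Pw N r * Sg N r)))) r := by
  have hP := Pp N hr
  have hy := h.ypos r hr
  have hp := h.hp
  have hs := Sg_hasDeriv h.hN hr
  have hM := (h.Md hr).const_mul c
  have hyp := (h.yd r hr).rpow_const (p := p + 1) (Or.inl hy.ne')
  refine HasDerivAt.congr_deriv ((((hs.const_mul (1 / 2)).mul (hM.pow 2)).sub (((h.yd r hr).const_mul (1 / 2)).mul hM)).add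
    ((((((Pw_hasDeriv h.hN hr).pow 2).const_mul c).mul hs).mul hyp).div_const (p + 1))) ?_
  simp only [Pi.mul_apply, Pi.pow_apply]
  rw [show p + 1 - 1 = p by ring, rpow_add_one hy.ne']
  generalize cosh r / sinh r = k
  generalize y r ^ p = z
  have : p + 1 ≠ 0 := by linarith
  field_simp
  push_cast
  ring
lemma jJ_lim (h : Prof N p c y) {l : Filter ℝ} (hl : ∀ᶠ r in l, 0 < r) (h1 : Tendsto (fun r => Mm N (fun x => y x ^ p) r * √(Sg N r)) l (𝓝 0))
    (h2 : Tendsto (fun r => Pw N r * y r ^ (p + 1)) l (𝓝 0)) : Tendsto (jJ N p c y) l (𝓝 0) := by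
  obtain ⟨K, hK, hb⟩ := h.ysq
  have hc := h.hc
  have hp := h.hp
  have hlim : Tendsto (fun r => 1 / 2 * c ^ 2 * (Mm N (fun x => y x ^ p) r * √(Sg N r)) ^ 2 + 1 / 2 * K * c * (Mm N (fun x => y x ^ p) r * √(Sg N r))
      + c / (p + 1) * (Pw N r * y r ^ (p + 1))) l (𝓝 0) := by
    simpa using (((h1.pow 2).const_mul (1 / 2 * c ^ 2)).add (h1.const_mul (1 / 2 * K * c))).add (h2.const_mul (c / (p + 1)))
  refine squeeze_zero_norm' ?_ hlim
  filter_upwards [hl] with r hr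
  have hs := Sg_pos h.hN hr
  have hP := Pp N hr
  have hM := h.M0 hr
  have hy := h.ypos r hr
  have hPs := Pw_Sg_le h.hN hr
  have hyK := hb r hr
  rw [norm_eq_abs, jJ]
  set M := Mm N (fun x => y x ^ p) r
  have e1 : 1 / 2 * Sg N r * (c * M) ^ 2 = 1 / 2 * c ^ 2 * (M * √(Sg N r)) ^ 2 := by rw [mul_pow M, sq_sqrt hs.le]; ring
  have e2 : 1 / 2 * y r * (c * M) ≤ 1 / 2 * K * c * (M * √(Sg N r)) := by
    calc _ ≤ 1 / 2 * (K * √(Sg N r)) * (c * M) := by gcongr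
      _ = _ := by ring
  have e3 : c * Pw N r ^ 2 * Sg N r * y r ^ (p + 1) / (p + 1) ≤ c / (p + 1) * (Pw N r * y r ^ (p + 1)) := by
    calc _ = c / (p + 1) * (Pw N r * y r ^ (p + 1)) * (Pw N r * Sg N r) := by ring
      _ ≤ c / (p + 1) * (Pw N r * y r ^ (p + 1)) * 1 := by gcongr
      _ = _ := by ring
  have p1 : 0 ≤ 1 / 2 * Sg N r * (c * M) ^ 2 := by positivity
  have p2 : 0 ≤ 1 / 2 * y r * (c * M) := by positivity
  have p3 : 0 ≤ c * Pw N r ^ 2 * Sg N r * y r ^ (p + 1) / (p + 1) := by positivity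
  rw [abs_le]
  constructor <;> linarith
lemma jJ_zero (h : Prof N p c y) : Tendsto (jJ N p c y) (𝓝[>] 0) (𝓝 0) := by
  obtain ⟨C, hC, hb⟩ := h.ybd
  have hp := h.hp
  refine jJ_lim h self_mem_nhdsWithin (M_zero h.hN h.pc h.p0 h.int) (squeeze_zero' (g := fun r => Pw N r * C ^ (p + 1)) ?_ ?_ ?_)
  · filter_upwards [self_mem_nhdsWithin] with r hr
    have := Pp N hr
    have := h.ypos r hr
    positivity
  · filter_upwards [self_mem_nhdsWithin] with r hr
    have := Pp N hr
    have := h.ypos r hr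
    have := hb r hr
    gcongr
  · have := (((Pw_cont N).tendsto 0).mono_left (nhdsWithin_le_nhds (s := IP))).mul_const (C ^ (p + 1))
    rwa [Pw_zero h.hN, zero_mul] at this
lemma jJ_inf (h : Prof N p c y) : Tendsto (jJ N p c y) atTop (𝓝 0) := by
  obtain ⟨K, hK, hb⟩ := h.ysq
  have hp := h.hp
  refine jJ_lim h (eventually_gt_atTop 0) (M_infty h.hN h.pc h.p0 h.int) (squeeze_zero' (g := fun r => K ^ (p + 1) * (Sg N r) ^ ((p - 1) / 2)) ?_ ?_ ?_)
  · filter_upwards [eventually_gt_atTop 0] with r hr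
    have := Pp N hr
    have := h.ypos r hr
    positivity
  · filter_upwards [eventually_gt_atTop 0] with r hr
    have hP := Pp N hr
    have hy := h.ypos r hr
    have hs := Sg_pos h.hN hr
    have h1 : y r ^ (p + 1) ≤ K ^ (p + 1) * (Sg N r ^ ((p - 1) / 2) * Sg N r) := by
      refine (rpow_le_rpow hy.le (hb r hr) (by linarith)).trans (le_of_eq ?_)
      rw [mul_rpow hK.le (by positivity), sqrt_eq_rpow, ← rpow_mul hs.le, ← rpow_add_one hs.ne']
      congr 2; ring
    calc _ ≤ Pw N r * (K ^ (p + 1) * (Sg N r ^ ((p - 1) / 2) * Sg N r)) := by gcongr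
      _ = K ^ (p + 1) * (Sg N r ^ ((p - 1) / 2)) * (Pw N r * Sg N r) := by ring
      _ ≤ K ^ (p + 1) * (Sg N r ^ ((p - 1) / 2)) * 1 := by gcongr; exact Pw_Sg_le h.hN hr
      _ = _ := by ring
  · have := ((Sg_tendsto h.hN).rpow_const (p := (p - 1) / 2) (Or.inr (by linarith))).const_mul (K ^ (p + 1))
    rwa [zero_rpow (by linarith), mul_zero] at this
lemma jJ_pos (h : Prof N p c y) (hr : 0 < r) : 0 < jJ N p c y r := by
  have hp := h.hp
  have hc := h.hc
  have hN1 : (0:ℝ) < (N:ℝ) - 1 := by have : (2:ℝ) ≤ N := by exact_mod_cast h.hN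
                                     linarith
  have hb : ∀ x z : ℝ, 0 < x → x < z → (p + 3) / 2 - 2 * ((N:ℝ) - 1) * (cosh x / sinh x * Pw N x * Sg N x) <
      (p + 3) / 2 - 2 * ((N:ℝ) - 1) * (cosh z / sinh z * Pw N z * Sg N z) := fun x z hx hxz => by
    have := mul_lt_mul_of_pos_left (kPs_anti h.hN (mem_Ioi.2 hx) (mem_Ioi.2 (hx.trans hxz)) hxz) (show 0 < 2 * ((N:ℝ) - 1) by positivity)
    simp only at this; linarith
  have hpos : ∀ x > 0, 0 < c * Pw N x * y x ^ (p + 1) / (p + 1) := fun x hx => by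
    have := Pp N hx
    have := h.ypos x hx
    positivity
  rcases le_or_gt ((p + 3) / 2 - 2 * ((N:ℝ) - 1) * (cosh r / sinh r * Pw N r * Sg N r)) 0 with h0 | h0
  · refine lt_of_deriv0 hr (fun x hx => (jJ_deriv h hx.1).continuousAt.continuousWithinAt) (fun x hx => jJ_deriv h hx.1) (fun x hx => ?_) (jJ_zero h)
    have := mul_neg_of_pos_of_neg (hpos x hx.1) ((hb x r hx.1 hx.2).trans_le h0)
    linarith
  · refine lt_of_derivT (fun x hx => jJ_deriv h (hr.trans_le hx)) (fun x hx => ?_) (jJ_inf h)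
    have := mul_pos (hpos x (hr.trans hx)) (h0.trans (hb r x hr hx))
    linarith
end
end

section
open Real
variable {r : ℝ} {t : ℝ}
section
variable {N : ℕ} {p c : ℝ} {y y1 y2 : ℝ → ℝ}
lemma Prof.lim0 (h : Prof N p c y) : ∃ α > 0, Tendsto y (𝓝[>] 0) (𝓝 α) ∧ ∀ r > 0, y r ≤ α := by
  obtain ⟨C, hC, hb⟩ := h.ybd
  have hanti : AntitoneOn y IP := antitoneOn_of_deriv_nonpos (convex_Ioi 0) h.yc
    (by rw [interior_Ioi]; exact fun x hx => (h.yd x hx).differentiableAt.differentiableWithinAt)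
    (by rw [interior_Ioi]; intro x hx; rw [(h.yd x hx).deriv]
        have := h.M0 hx
        have := Pp N hx
        have := h.hc
        simp only [Left.neg_nonpos_iff]; positivity)
  have hbb : BddAbove (y '' IP) := ⟨C, by rintro _ ⟨t, ht, rfl⟩; exact hb t ht⟩
  have hne : (y '' IP).Nonempty := ⟨_, 1, mem_Ioi.2 one_pos, rfl⟩
  have hle : ∀ r > 0, y r ≤ sSup (y '' IP) := fun t ht => le_csSup hbb ⟨t, ht, rfl⟩
  refine ⟨sSup (y '' IP), (h.ypos 1 one_pos).trans_le (hle 1 one_pos), ?_, hle⟩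
  refine tendsto_order.2 ⟨fun a ha => ?_, fun a ha => ?_⟩
  · obtain ⟨_, ⟨t, ht, rfl⟩, h2⟩ := exists_lt_of_lt_csSup hne ha
    filter_upwards [Ioo_mem_nhdsGT ht] with z hz
    exact h2.trans_le (hanti hz.1 ht hz.2.le)
  · filter_upwards [self_mem_nhdsWithin] with t ht
    exact (hle t ht).trans_lt ha
lemma uniq_lt (h1 : Prof N p c y1) (h2 : Prof N p c y2) {α1 α2 : ℝ} (hα1 : 0 < α1) (hlt : α1 < α2)
    (l1 : Tendsto y1 (𝓝[>] 0) (𝓝 α1)) (l2 : Tendsto y2 (𝓝[>] 0) (𝓝 α2)) : False := by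
  have hp := h1.hp
  have hc := h1.hc
  set M1 := Mm N (fun x => y1 x ^ p) with hM1
  set M2 := Mm N (fun x => y2 x ^ p) with hM2
  set q := fun r => y2 r / y1 r with hq
  set W := fun r => c * (y2 r * M1 r - y1 r * M2 r) with hW
  have hWd : ∀ r > 0, HasDerivAt W (c * Pw N r * (y1 r * y2 r) * (y1 r ^ (p - 1) - y2 r ^ (p - 1))) r := fun r hr => by
    have a1 := h1.ypos r hr
    have a2 := h2.ypos r hr
    have hP := Pp N hr
    refine HasDerivAt.congr_deriv ((((h2.yd r hr).mul (h1.Md hr)).sub ((h1.yd r hr).mul (h2.Md hr))).const_mul c) ?_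
    simp only [← hM1, ← hM2]
    have e1 : y1 r ^ p = y1 r ^ (p - 1) * y1 r := by rw [← rpow_add_one a1.ne']; congr 1; ring
    have e2 : y2 r ^ p = y2 r ^ (p - 1) * y2 r := by rw [← rpow_add_one a2.ne']; congr 1; ring
    rw [e1, e2]
    field_simp; ring
  have hWc : ContinuousOn W IP := fun r hr => (hWd r hr).continuousAt.continuousWithinAt
  have hqd : ∀ r > 0, HasDerivAt q (W r / (Pw N r * y1 r ^ 2)) r := fun r hr => by
    have a1 := h1.ypos r hr
    have hP := Pp N hr
    refine ((h2.yd r hr).div (h1.yd r hr) a1.ne').congr_deriv ?_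
    simp only [← hM1, ← hM2, hW]
    field_simp; ring
  have hqpos : ∀ r > 0, 0 < q r := fun r hr => div_pos (h2.ypos r hr) (h1.ypos r hr)
  have hql : Tendsto q (𝓝[>] 0) (𝓝 (α2 / α1)) := l2.div l1 hα1.ne'
  have hWl : Tendsto W (𝓝[>] 0) (𝓝 0) := by
    simpa using ((l2.mul h1.Mt).sub (l1.mul h2.Mt)).const_mul c
  have hWneg : ∀ r > 0, 1 < q r → c * Pw N r * (y1 r * y2 r) * (y1 r ^ (p - 1) - y2 r ^ (p - 1)) < 0 := fun r hr hq1 => by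
    have a1 := h1.ypos r hr
    have a2 := h2.ypos r hr
    have hP := Pp N hr
    have : y1 r < y2 r := (one_lt_div a1).1 hq1
    have := rpow_lt_rpow a1.le this (show 0 < p - 1 by linarith)
    exact mul_neg_of_pos_of_neg (by positivity) (by linarith)
  obtain ⟨ρ, hρ, hρ1⟩ := (mem_nhdsGT_iff_exists_Ioo_subset' (a := (0:ℝ)) one_pos).1 (hql.eventually_const_lt ((one_lt_div hα1).2 hlt))
  have hρ0 : (0:ℝ) < ρ := hρ
  have hW0 : ∀ r, 0 < r → r < ρ → W r < 0 := fun r hr hrρ => by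
    have := lt_of_deriv0 (φ := fun r => - W r) hr (fun x hx => (hWc.neg x hx.1).mono fun z hz => hz.1) (fun x hx => (hWd x hx.1).neg)
      (fun x hx => by
        have := hWneg x hx.1 (hρ1 ⟨hx.1, hx.2.trans hrρ⟩)
        linarith) (by simpa using hWl.neg)
    linarith [this]
  set Y := fun r => jJ N p c y2 r - q r ^ (p + 1) * jJ N p c y1 r with hY
  have hYd : ∀ r > 0, HasDerivAt Y (-((p + 1) * q r ^ p * (W r / (Pw N r * y1 r ^ 2)) * jJ N p c y1 r)) r := fun r hr => by
    have a1 := h1.ypos r hr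
    have a2 := h2.ypos r hr
    refine HasDerivAt.congr_deriv ((jJ_deriv h2 hr).sub (((hqd r hr).rpow_const (p := p + 1) (Or.inl (hqpos r hr).ne')).mul (jJ_deriv h1 hr))) ?_
    have e : y2 r ^ (p + 1) = q r ^ (p + 1) * y1 r ^ (p + 1) := by
      rw [← mul_rpow (hqpos r hr).le a1.le]; congr 1; simp only [hq]; field_simp
    rw [e, show p + 1 - 1 = p by ring]
    ring
  have hYc : ContinuousOn Y IP := fun r hr => (hYd r hr).continuousAt.continuousWithinAt
  have hYl : Tendsto Y (𝓝[>] 0) (𝓝 0) := by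
    have := (jJ_zero h2).sub ((hql.rpow_const (p := p + 1) (Or.inl (div_pos (hα1.trans hlt) hα1).ne')).mul (jJ_zero h1))
    simpa using this
  have hYpos' : ∀ x > 0, W x < 0 → 0 < -((p + 1) * q x ^ p * (W x / (Pw N x * y1 x ^ 2)) * jJ N p c y1 x) := fun x hx hWx => by
    have hP := Pp N hx
    have a1 := h1.ypos x hx
    have hqx := hqpos x hx
    have hJ := jJ_pos h1 hx
    have hd : W x / (Pw N x * y1 x ^ 2) < 0 := div_neg_of_neg_of_pos hWx (by positivity)
    have h3 : (p + 1) * q x ^ p * (W x / (Pw N x * y1 x ^ 2)) < 0 := mul_neg_of_pos_of_neg (by positivity) hd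
    have := mul_neg_of_neg_of_pos h3 hJ
    linarith
  have hYp : ∀ r > 0, (∀ x ∈ Ioo 0 r, W x < 0) → 0 < Y r := fun r hr hWx =>
    lt_of_deriv0 hr (hYc.mono fun z hz => hz.1) (fun x hx => hYd x hx.1) (fun x hx => hYpos' x hx.1 (hWx x hx)) hYl
  by_cases hall : ∀ r > 0, W r < 0
  · have hqanti : ∀ r > 0, q r ≤ α2 / α1 := fun r hr => by
      have := le_of_deriv0 (φ := fun r => - q r) hr (fun x hx => (hqd x hx.1).neg.continuousAt.continuousWithinAt) (fun x hx => (hqd x hx.1).neg) (fun x hx => by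
        have hP := Pp N hx.1
        have a1 := h1.ypos x hx.1
        have hd : W x / (Pw N x * y1 x ^ 2) < 0 := div_neg_of_neg_of_pos (hall x hx.1) (by positivity)
        linarith) hql.neg
      linarith [this]
    have hYinf : Tendsto Y atTop (𝓝 0) := by
      have hlim : Tendsto (fun r => jJ N p c y2 r + (α2 / α1) ^ (p + 1) * jJ N p c y1 r) atTop (𝓝 0) := by
        simpa using (jJ_inf h2).add ((jJ_inf h1).const_mul ((α2 / α1) ^ (p + 1)))
      refine squeeze_zero_norm' ?_ hlim
      filter_upwards [eventually_gt_atTop 0] with r hr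
      have b1 := jJ_pos h1 hr
      have b2 := jJ_pos h2 hr
      have hqx := hqpos r hr
      have : q r ^ (p + 1) * jJ N p c y1 r ≤ (α2 / α1) ^ (p + 1) * jJ N p c y1 r := by
        gcongr; exact hqanti r hr
      have h0 : 0 ≤ q r ^ (p + 1) * jJ N p c y1 r := by positivity
      rw [norm_eq_abs, abs_le]
      simp only [hY]
      constructor <;> linarith
    have := lt_of_derivT (φ := fun r => - Y r) (r := 1) (fun x hx => (hYd x (by linarith : (0:ℝ) < x)).neg)
      (fun x hx => by
        have hx0 : 0 < x := one_pos.trans hx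
        have := hYpos' x hx0 (hall x hx0)
        linarith) hYinf.neg
    have := hYp 1 one_pos fun x hx => hall x hx.1
    simp only at *
    linarith
  · push Not at hall
    obtain ⟨R, hR, hWR⟩ := hall
    have hRρ : ρ ≤ R := by
      by_contra hcon
      push Not at hcon
      linarith [hW0 R hR hcon]
    set S := {r ∈ Icc (ρ / 2) R | 0 ≤ W r} with hS
    have hScl : IsClosed S := by
      have := (hWc.mono (fun x hx => lt_of_lt_of_le (by positivity) hx.1 : Icc (ρ / 2) R ⊆ IP)).preimage_isClosed_of_isClosed isClosed_Icc isClosed_Ici (t := Ici 0)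
      exact this
    have hSne : S.Nonempty := ⟨R, ⟨by linarith, le_rfl⟩, hWR⟩
    have hSbb : BddBelow S := ⟨ρ / 2, fun x hx => hx.1.1⟩
    set r1 := sInf S with hr1
    have hr1S : r1 ∈ S := hScl.csInf_mem hSne hSbb
    have hr1p : 0 < r1 := lt_of_lt_of_le (by positivity) hr1S.1.1
    have hneg : ∀ x ∈ Ioo 0 r1, W x < 0 := fun x hx => by
      by_contra hcon
      push Not at hcon
      have hxρ : ρ ≤ x := by
        by_contra h'
        push Not at h'
        linarith [hW0 x hx.1 h']
      have : r1 ≤ x := csInf_le hSbb ⟨⟨by linarith, hx.2.le.trans hr1S.1.2⟩, hcon⟩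
      linarith [hx.2]
    have hWr1 : W r1 = 0 := by
      refine le_antisymm ?_ hr1S.2
      have : Tendsto W (𝓝[<] r1) (𝓝 (W r1)) := ((hWd r1 hr1p).continuousAt.tendsto).mono_left nhdsWithin_le_nhds
      refine le_of_tendsto this ?_
      filter_upwards [Ioo_mem_nhdsLT hr1p] with x hx using (hneg x hx).le
    have hqr1 : q r1 < 1 := by
      by_contra hcon
      push Not at hcon
      have hqa : StrictAntiOn q (Ioc 0 r1) := strictAntiOn_of_deriv_neg (convex_Ioc 0 r1) (fun x hx => (hqd x hx.1).continuousAt.continuousWithinAt)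
        (by rw [interior_Ioc]; exact fun x hx => by
              rw [(hqd x hx.1).deriv]
              have hP := Pp N hx.1
              have a1 := h1.ypos x hx.1
              exact div_neg_of_neg_of_pos (hneg x hx) (by positivity))
      have := lt_of_deriv0 (φ := fun r => - W r) hr1p (fun x hx => (hWc.neg x hx.1).mono fun z hz => hz.1) (fun x hx => (hWd x hx.1).neg)
        (fun x hx => by
          have := hWneg x hx.1 (hcon.trans_lt (hqa ⟨hx.1, hx.2.le⟩ ⟨hr1p, le_rfl⟩ hx.2))
          linarith) (by simpa using hWl.neg)
      simp only [hWr1] at this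
      linarith
    have hYr1 := hYp r1 hr1p hneg
    have a1 := h1.ypos r1 hr1p
    have a2 := h2.ypos r1 hr1p
    have hqx := hqpos r1 hr1p
    have e2 : y2 r1 = q r1 * y1 r1 := by simp only [hq]; field_simp
    have eM : M2 r1 = q r1 * M1 r1 := by
      have : y2 r1 * M1 r1 - y1 r1 * M2 r1 = 0 := by
        rcases mul_eq_zero.1 hWr1 with h | h
        · exact absurd h hc.ne'
        · exact h
      rw [e2] at this
      have h' : y1 r1 * (q r1 * M1 r1 - M2 r1) = 0 := by linarith
      rcases mul_eq_zero.1 h' with h | h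
      · exact absurd h a1.ne'
      · linarith
    have e : Y r1 = (q r1 ^ 2 - q r1 ^ (p + 1)) * (1 / 2 * (c * M1 r1) * (c * M1 r1 * Sg N r1 - y1 r1)) := by
      simp only [hY, jJ, ← hM1, ← hM2]
      rw [eM, e2, mul_rpow hqx.le a1.le]
      ring
    have h5 : q r1 ^ (p + 1) ≤ q r1 ^ 2 := by
      rw [← rpow_natCast]
      exact rpow_le_rpow_of_exponent_ge hqx hqr1.le (by push_cast; linarith)
    have h6 := h1.Ms hr1p
    have h7 : 0 ≤ 1 / 2 * (c * M1 r1) := by have := h1.M0 hr1p; positivity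
    have : Y r1 ≤ 0 := by
      rw [e]
      exact mul_nonpos_of_nonneg_of_nonpos (by linarith) (mul_nonpos_of_nonneg_of_nonpos h7 (by linarith))
    linarith
lemma rpow_lip {p α a b : ℝ} (hp : 1 < p) (ha : 0 < a) (hb : 0 < b) (ha1 : a ≤ α) (hb1 : b ≤ α) : |a ^ p - b ^ p| ≤ p * α ^ (p - 1) * |a - b| := by
  have := (convex_Ioc 0 α).norm_image_sub_le_of_norm_hasDerivWithin_le (C := p * α ^ (p - 1)) (f := fun x => x ^ p) (f' := fun x => p * x ^ (p - 1))
    (fun x hx => (hasDerivAt_rpow_const (Or.inl hx.1.ne')).hasDerivWithinAt) (fun x hx => by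
      have := hx.1
      rw [norm_of_nonneg (by positivity)]
      gcongr
      exact hx.2) ⟨hb, hb1⟩ ⟨ha, ha1⟩
  simpa [norm_eq_abs] using this
lemma uniq_eq (h1 : Prof N p c y1) (h2 : Prof N p c y2) {α : ℝ} (hα : 0 < α)
    (l1 : Tendsto y1 (𝓝[>] 0) (𝓝 α)) (l2 : Tendsto y2 (𝓝[>] 0) (𝓝 α)) (b1 : ∀ r > 0, y1 r ≤ α) (b2 : ∀ r > 0, y2 r ≤ α) (hr : 0 < r) : y1 r = y2 r := by
  have hp := h1.hp
  have hc := h1.hc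
  set L := p * α ^ (p - 1) with hL
  have hL0 : 0 < L := by positivity
  set A := c * L / 2 with hA
  have key : ∀ n : ℕ, ∀ x > 0, |y1 x - y2 x| ≤ α * (A * x ^ 2) ^ n / n.factorial := by
    intro n
    induction n with
    | zero =>
      intro x hx
      simp only [pow_zero, Nat.factorial_zero, Nat.cast_one, mul_one, div_one]
      have := b1 x hx; have := b2 x hx; have := h1.ypos x hx; have := h2.ypos x hx
      rw [abs_le]; constructor <;> linarith
    | succ n ih =>
      intro x hx
      have hM : ∀ z > 0, |Mm N (fun x => y1 x ^ p) z - Mm N (fun x => y2 x ^ p) z| ≤ z * (Pw N z * (L * (α * (A * z ^ 2) ^ n / n.factorial))) := by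
        intro z hz
        have i1 := Mint h1.hN h1.pc h1.p0 h1.int hz.le
        have i2 := Mint h2.hN h2.pc h2.p0 h2.int hz.le
        unfold Mm
        rw [← intervalIntegral.integral_sub i1 i2, ← norm_eq_abs]
        refine (intervalIntegral.norm_integral_le_of_norm_le_const (C := Pw N z * (L * (α * (A * z ^ 2) ^ n / n.factorial))) fun w hw => ?_).trans (le_of_eq (by rw [sub_zero, abs_of_pos hz]; ring))
        rw [uIoc_of_le hz.le] at hw
        have hP := Pp N hw.1
        rw [← mul_sub, norm_eq_abs, abs_mul, abs_of_pos hP]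
        have hr1 := rpow_lip hp (h1.ypos w hw.1) (h2.ypos w hw.1) (b1 w hw.1) (b2 w hw.1)
        have hi := ih w hw.1
        have hw0 := hw.1
        have hA0 : 0 ≤ A := by positivity
        refine mul_le_mul (Pw_mono hw.1.le hw.2) (hr1.trans ?_) (abs_nonneg _) (Pw_nonneg hz.le)
        refine mul_le_mul_of_nonneg_left (hi.trans ?_) hL0.le
        gcongr
        exact hw.2
      have hb : ∀ z > 0, HasDerivAt (fun z => α * (A * z ^ 2) ^ (n + 1) / (n + 1).factorial) (c * L * (α * (A * z ^ 2) ^ n / n.factorial) * z) z := fun z hz => by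
        refine ((((((hasDerivAt_id z).pow 2).const_mul A).pow (n + 1)).const_mul α).div_const _).congr_deriv ?_
        have hfac : ((n + 1).factorial : ℝ) = (n + 1) * n.factorial := by rw [Nat.factorial_succ]; push_cast; ring
        have hf0 : (n.factorial : ℝ) ≠ 0 := by positivity
        rw [hfac]
        simp only [id, Nat.add_one_sub_one, pow_one, mul_one, Pi.mul_apply, Pi.pow_apply]
        push_cast
        field_simp
        rw [hA]; ring
      have hbl : Tendsto (fun z => α * (A * z ^ 2) ^ (n + 1) / (n + 1).factorial) (𝓝[>] 0) (𝓝 0) := by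
        have : Tendsto (fun z => α * (A * z ^ 2) ^ (n + 1) / (n + 1).factorial) (𝓝 0) (𝓝 (α * (A * 0 ^ 2) ^ (n + 1) / (n + 1).factorial)) := Continuous.tendsto (by fun_prop) _
        simp only [ne_eq, OfNat.ofNat_ne_zero, not_false_eq_true, zero_pow, mul_zero, Nat.add_eq_zero_iff, one_ne_zero, and_false, zero_div] at this
        exact this.mono_left nhdsWithin_le_nhds
      have hdd : ∀ z > 0, |-(c * Mm N (fun x => y1 x ^ p) z / Pw N z) - -(c * Mm N (fun x => y2 x ^ p) z / Pw N z)| ≤ c * L * (α * (A * z ^ 2) ^ n / n.factorial) * z := fun z hz => by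
        have hP := Pp N hz
        have := hM z hz
        have e : -(c * Mm N (fun x => y1 x ^ p) z / Pw N z) - -(c * Mm N (fun x => y2 x ^ p) z / Pw N z) = -(c * (Mm N (fun x => y1 x ^ p) z - Mm N (fun x => y2 x ^ p) z) / Pw N z) := by ring
        rw [e, abs_neg, abs_div, abs_mul, abs_of_pos hc, abs_of_pos hP, div_le_iff₀ hP]
        calc _ ≤ c * (z * (Pw N z * (L * (α * (A * z ^ 2) ^ n / n.factorial)))) := by gcongr
          _ = _ := by ring
      have d1 := fun z (hz : 0 < z) => (hb z hz).sub ((h1.yd z hz).sub (h2.yd z hz))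
      have d2 := fun z (hz : 0 < z) => (hb z hz).add ((h1.yd z hz).sub (h2.yd z hz))
      have k1 := le_of_deriv0 hx (fun z hz => (d1 z hz.1).continuousAt.continuousWithinAt) (fun z hz => d1 z hz.1)
        (fun z hz => by have := abs_le.1 (hdd z hz.1); linarith) (hbl.sub (l1.sub l2))
      have k2 := le_of_deriv0 hx (fun z hz => (d2 z hz.1).continuousAt.continuousWithinAt) (fun z hz => d2 z hz.1)
        (fun z hz => by have := abs_le.1 (hdd z hz.1); linarith) (hbl.add (l1.sub l2))
      simp only [Pi.add_apply, Pi.sub_apply] at k1 k2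
      rw [abs_le]
      constructor <;> linarith
  have ht : Tendsto (fun n : ℕ => α * ((A * r ^ 2) ^ n / n.factorial)) atTop (𝓝 0) := by
    simpa using (FloorSemiring.tendsto_pow_div_factorial_atTop (A * r ^ 2)).const_mul α
  have := ge_of_tendsto ht (Eventually.of_forall fun n => by have := key n r hr; rwa [mul_div_assoc] at this)
  have := abs_nonpos_iff.1 this
  linarith
lemma uniq (h1 : Prof N p c y1) (h2 : Prof N p c y2) (hr : 0 < r) : y1 r = y2 r := by
  obtain ⟨α1, hα1, l1, b1⟩ := h1.lim0
  obtain ⟨α2, hα2, l2, b2⟩ := h2.lim0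
  rcases lt_trichotomy α1 α2 with h | h | h
  · exact (uniq_lt h1 h2 hα1 h l1 l2).elim
  · subst h; exact uniq_eq h1 h2 hα1 l1 l2 b1 b2 hr
  · exact (uniq_lt h2 h1 hα2 h l2 l1).elim
end
end

section
open Real
variable {r : ℝ} {t : ℝ}
variable {N : ℕ}
lemma ev_neg {F : ℝ → ℝ} {d x : ℝ} (h : HasDerivAt F d x) (h0 : F x = 0) (hd : d < 0) : ∀ᶠ y in 𝓝[>] x, F y < 0 := by
  have h1 := (hasDerivAt_iff_tendsto_slope.1 h).mono_left (nhdsWithin_mono x (fun y (hy : x < y) => hy.ne'))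
  filter_upwards [h1.eventually_lt_const hd, self_mem_nhdsWithin] with y hy hxy
  rw [slope_def_field, h0, sub_zero] at hy
  have : 0 < y - x := sub_pos.2 hxy
  by_contra hF
  exact absurd hy (not_lt.2 (div_nonneg (not_lt.1 hF) this.le))
lemma loc_min_div {h h' : ℝ → ℝ} {x q : ℝ} (hx : 0 < x) (hd : ∀ᶠ y in 𝓝 x, HasDerivAt h (h' y) y) (hm : IsLocalMin h x)
    (hP : HasDerivAt (fun y => Pw N y * h' y) (Pw N x * q) x) : 0 ≤ q := by
  by_contra hq
  have hq := not_le.1 hq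
  have h0 : h' x = 0 := hm.hasDerivAt_eq_zero hd.self_of_nhds
  have h1 := ev_neg hP (by simp [h0]) (mul_neg_of_pos_of_neg (Pw_pos hx) hq)
  have h2 := (h1.and ((hd.filter_mono nhdsWithin_le_nhds).and ((hm.filter_mono nhdsWithin_le_nhds))))
  obtain ⟨b, hb, hb2⟩ := (mem_nhdsGT_iff_exists_Ioo_subset).1 h2
  have hb : x < b := hb
  have hy : (x + b) / 2 ∈ Ioo x b := ⟨by linarith, by linarith⟩
  obtain ⟨ξ, hξ, he⟩ := exists_hasDerivAt_eq_slope h h' hy.1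
    (fun z hz => by
      rcases eq_or_lt_of_le hz.1 with e | e
      · rw [← e]; exact hd.self_of_nhds.continuousAt.continuousWithinAt
      · exact (hb2 ⟨e, hz.2.trans_lt hy.2⟩).2.1.continuousAt.continuousWithinAt)
    (fun z hz => (hb2 ⟨hz.1, hz.2.trans hy.2⟩).2.1)
  have h3 := (hb2 ⟨hξ.1, hξ.2.trans hy.2⟩).1
  have h4 : h' ξ < 0 := by
    by_contra hc
    exact absurd h3 (not_lt.2 (mul_nonneg (Pw_pos (hx.trans hξ.1)).le (not_lt.1 hc)))
  have h5 := (hb2 hy).2.2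
  rw [he] at h4
  exact absurd h4 (not_lt.2 (div_nonneg (sub_nonneg.2 h5) (by linarith [hy.1])))
lemma maxP (hN : 2 ≤ N) {g gr gt q : ℝ → ℝ → ℝ} {ρ τ1 τ2 : ℝ}
    (gc : ContinuousOn (fun x : ℝ × ℝ => g x.1 x.2) (Ioc 0 ρ ×ˢ Icc τ1 τ2))
    (hr : ∀ r ∈ Ioo 0 ρ, ∀ τ ∈ Ioc τ1 τ2, HasDerivAt (fun x => g x τ) (gr r τ) r)
    (ht : ∀ r ∈ Ioo 0 ρ, ∀ τ ∈ Ioc τ1 τ2, HasDerivAt (fun x => g r x) (gt r τ) τ)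
    (hP : ∀ r ∈ Ioo 0 ρ, ∀ τ ∈ Ioc τ1 τ2, HasDerivAt (fun x => Pw N x * gr x τ) (Pw N r * q r τ) r)
    (bd : ∃ C, ∀ r ∈ Ioc 0 ρ, ∀ τ ∈ Icc τ1 τ2, -C ≤ g r τ)
    (h0 : ∀ r ∈ Ioc 0 ρ, 0 ≤ g r τ1) (h1 : ∀ τ ∈ Icc τ1 τ2, 0 ≤ g ρ τ)
    (hn : ∀ r ∈ Ioo 0 ρ, ∀ τ ∈ Ioc τ1 τ2, g r τ < 0 → gt r τ ≤ 0 → 0 ≤ q r τ → False) :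
    ∀ r ∈ Ioc 0 ρ, ∀ τ ∈ Icc τ1 τ2, 0 ≤ g r τ := by
  intro r hr' τ hτ
  by_contra hneg
  have hneg := not_le.1 hneg
  obtain ⟨C, hC⟩ := bd
  have hsr : 0 < 1 + Sg N r := by have := Sg_pos hN hr'.1; linarith
  set ε := -g r τ / (2 * (1 + Sg N r)) with hε
  have hε0 : 0 < ε := div_pos (by linarith) (by linarith)
  set G : ℝ × ℝ → ℝ := fun x => g x.1 x.2 + ε * (1 + Sg N x.1) with hG
  have hG1 : G (r, τ) < 0 := by
    have : ε * (1 + Sg N r) = - g r τ / 2 := by rw [hε]; field_simp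
    simp only [hG, this]; linarith
  obtain ⟨δ, hδ1, hδ2⟩ := (((Sg_atZero hN).eventually_gt_atTop (C / ε)).and (Ioc_mem_nhdsGT hr'.1)).exists
  have hsub : Icc δ ρ ×ˢ Icc τ1 τ2 ⊆ Ioc 0 ρ ×ˢ Icc τ1 τ2 := prod_mono (fun x hx => ⟨hδ2.1.trans_le hx.1, hx.2⟩) le_rfl
  have hGc : ContinuousOn G (Icc δ ρ ×ˢ Icc τ1 τ2) := by
    refine (gc.mono hsub).add (continuousOn_const.mul (continuousOn_const.add ?_))
    exact (Sg_cont hN).comp continuousOn_fst (fun x hx => hδ2.1.trans_le hx.1.1)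
  obtain ⟨⟨x, y⟩, ⟨hx, hy⟩, hmin⟩ := (isCompact_Icc.prod isCompact_Icc).exists_isMinOn ⟨(r, τ), ⟨⟨hδ2.2, hr'.2⟩, hτ⟩⟩ hGc
  have hGxy : G (x, y) < 0 := (hmin (show (r, τ) ∈ Icc δ ρ ×ˢ Icc τ1 τ2 from ⟨⟨hδ2.2, hr'.2⟩, hτ⟩)).trans_lt hG1
  have hx0 : 0 < x := hδ2.1.trans_le hx.1
  have hsx : 0 < 1 + Sg N x := by have := Sg_pos hN hx0; linarith
  have hp := mul_pos hε0 hsx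
  have hgxy : g x y < 0 := by simp only [hG] at hGxy; linarith
  have hxρ : x < ρ := lt_of_le_of_ne hx.2 (fun e => by rw [e] at hgxy; linarith [h1 y hy])
  have hyτ : τ1 < y := lt_of_le_of_ne hy.1 (fun e => by rw [← e] at hgxy; linarith [h0 x ⟨hx0, hx.2⟩])
  have hδx : δ < x := lt_of_le_of_ne hx.1 (fun e => by
    have h2 := hC x ⟨hx0, hx.2⟩ y hy
    rw [e, div_lt_iff₀ hε0] at hδ1
    simp only [hG] at hGxy
    nlinarith)
  have hxI : x ∈ Ioo 0 ρ := ⟨hx0, hxρ⟩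
  have hyI : y ∈ Ioc τ1 τ2 := ⟨hyτ, hy.2⟩
  refine hn x hxI y hyI hgxy ?_ ?_
  · by_contra hc
    have hc := not_le.1 hc
    have hd := ht x hxI y hyI
    have e1 : HasDerivAt (fun s => g x y - g x (y - s)) (gt x y) 0 := by
      have h2 : HasDerivAt (fun s => g x s) (gt x y) (y - 0) := by simpa using hd
      have h3 := (h2.comp_const_sub y 0).const_sub (g x y)
      simpa using h3
    have e2 := ev_neg e1.neg (by simp) (by linarith)
    obtain ⟨s, hs1, hs2⟩ := (e2.and (Ioc_mem_nhdsGT (sub_pos.2 hyτ))).exists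
    have h3 := hmin (show (x, y - s) ∈ Icc δ ρ ×ˢ Icc τ1 τ2 from ⟨hx, ⟨by linarith [hs2.2], by linarith [hs2.1, hy.2]⟩⟩)
    simp only [hG, mem_setOf_eq] at h3
    simp only [Pi.neg_apply] at hs1
    linarith
  · have hnb : ∀ᶠ z in 𝓝 x, z ∈ Ioo δ ρ := Ioo_mem_nhds hδx hxρ
    refine loc_min_div (N := N) (h := fun z => g z y + ε * (1 + Sg N z)) (h' := fun z => gr z y + ε * (- (Pw N z)⁻¹)) hx0 ?_ ?_ ?_
    · filter_upwards [hnb] with z hz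
      have hz0 := hδ2.1.trans hz.1
      exact (hr z ⟨hz0, hz.2⟩ y hyI).add (((Sg_hasDeriv hN hz0).const_add 1).const_mul ε)
    · filter_upwards [hnb] with z hz
      exact hmin (show (z, y) ∈ Icc δ ρ ×ˢ Icc τ1 τ2 from ⟨⟨hz.1.le, hz.2.le⟩, hy⟩)
    · refine ((hP x hxI y hyI).sub_const ε).congr_of_eventuallyEq ?_
      filter_upwards [hnb] with z hz
      have := (Pp N (hδ2.1.trans hz.1)).ne'
      field_simp
      ring
end

section
open Real
variable {r : ℝ} {t : ℝ}
structure ZF (N : ℕ) (p c : ℝ) (z zr zt : ℝ → ℝ → ℝ) : Prop where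
  hN : 2 ≤ N
  hp : 1 < p
  hc : 0 < c
  hsub : ((N:ℝ) - 2) * p < N + 2
  zpos : ∀ r > 0, ∀ τ > 0, 0 < z r τ
  zcont : ContinuousOn (fun x : ℝ × ℝ => z x.1 x.2) (IP ×ˢ IP)
  zd : ∀ r > 0, ∀ τ > 0, HasDerivAt (fun x => z x τ) (zr r τ) r
  ztd : ∀ r > 0, ∀ τ > 0, HasDerivAt (fun x => z r x) (zt r τ) τ
  zP : ∀ r > 0, ∀ τ > 0, HasDerivAt (fun x => Pw N x * zr x τ) (Pw N r * (p * z r τ ^ (p - 1) * zt r τ - c * z r τ ^ p)) r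
  bd : ∀ τ1 > 0, ∀ τ2, ∃ C, ∀ r ∈ Ioc 0 1, ∀ τ ∈ Icc τ1 τ2, z r τ ≤ C
  lbd : ∀ τ > 0, ∃ η > 0, ∀ r ∈ Ioc 0 1, η ≤ z r τ
variable {N : ℕ} {p c : ℝ} {z zr zt : ℝ → ℝ → ℝ}
lemma ZF.cmp (h : ZF N p c z zr zt) (σ : ℝ) {φ φ' L χ χ' : ℝ → ℝ} {ρ τ1 τ2 : ℝ} (hτ1 : 0 < τ1)
    (hφc : ContinuousOn φ (Ioc 0 ρ)) (hχc : ContinuousOn χ (Icc τ1 τ2))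
    (hφ : ∀ r ∈ Ioo 0 ρ, HasDerivAt φ (φ' r) r) (hL : ∀ r ∈ Ioo 0 ρ, HasDerivAt (fun x => Pw N x * φ' x) (Pw N r * L r) r)
    (hχ : ∀ τ ∈ Ioc τ1 τ2, HasDerivAt χ (χ' τ) τ)
    (bd : ∃ C, ∀ r ∈ Ioc 0 ρ, ∀ τ ∈ Icc τ1 τ2, -C ≤ σ * (φ r + χ τ - z r τ))
    (h0 : ∀ r ∈ Ioc 0 ρ, 0 ≤ σ * (φ r + χ τ1 - z r τ1)) (h1 : ∀ τ ∈ Icc τ1 τ2, 0 ≤ σ * (φ ρ + χ τ - z ρ τ))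
    (hn : ∀ r ∈ Ioo 0 ρ, ∀ τ ∈ Ioc τ1 τ2, σ * (φ r + χ τ - z r τ) < 0 → σ * (χ' τ - zt r τ) ≤ 0 →
      0 ≤ σ * (L r - (p * z r τ ^ (p - 1) * zt r τ - c * z r τ ^ p)) → False) :
    ∀ r ∈ Ioc 0 ρ, ∀ τ ∈ Icc τ1 τ2, 0 ≤ σ * (φ r + χ τ - z r τ) := by
  refine maxP h.hN (gr := fun r τ => σ * (φ' r - zr r τ)) (gt := fun r τ => σ * (χ' τ - zt r τ))
    (q := fun r τ => σ * (L r - (p * z r τ ^ (p - 1) * zt r τ - c * z r τ ^ p))) ?_ ?_ ?_ ?_ bd h0 h1 hn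
  · refine continuousOn_const.mul (((hφc.comp continuousOn_fst fun x hx => hx.1).add (hχc.comp continuousOn_snd fun x hx => hx.2)).sub
      (h.zcont.mono (prod_mono (fun x hx => hx.1) (fun x hx => hτ1.trans_le hx.1))))
  · intro r hr τ hτ
    exact (((hφ r hr).add_const (χ τ)).sub (h.zd r hr.1 τ (hτ1.trans hτ.1))).const_mul σ
  · intro r hr τ hτ
    exact (((hχ τ hτ).const_add (φ r)).sub (h.ztd r hr.1 τ (hτ1.trans hτ.1))).const_mul σ
  · intro r hr τ hτ
    refine ((((hL r hr).sub (h.zP r hr.1 τ (hτ1.trans hτ.1))).const_mul σ).congr_deriv (by ring)).congr_of_eventuallyEq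
      (Eventually.of_forall fun x => ?_)
    simp only [Pi.sub_apply]
    ring
lemma coth_ge (hr : 0 < r) : 1 ≤ r * (cosh r / sinh r) := by
  have hs := sinh_pos_iff.2 hr
  rw [← mul_div_assoc, le_div_iff₀ hs, one_mul]
  have h := le_of_deriv0 (φ := fun x => x * cosh x - sinh x) (φ' := fun x => x * sinh x) (l := 0) hr
    (by fun_prop) (fun x hx => (((hasDerivAt_id x).mul (hasDerivAt_cosh x)).sub (hasDerivAt_sinh x)).congr_deriv (by simp))
    (fun x hx => mul_nonneg hx.1.le (sinh_nonneg_iff.2 hx.1.le))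
    (by
      have : Continuous (fun x : ℝ => x * cosh x - sinh x) := by fun_prop
      simpa using (this.tendsto 0).mono_left (nhdsWithin_le_nhds (s := IP)))
  linarith
lemma pow_bar (hN : 2 ≤ N) {a r : ℝ} (hr : 0 < r) : ∃ L, L ≥ (a + N - 2) * r ^ (a - 2) ∧
    HasDerivAt (fun x => Pw N x * x ^ (a - 1)) (Pw N r * L) r := by
  refine ⟨((N:ℝ) - 1) * (cosh r / sinh r) * r ^ (a - 1) + (a - 1) * r ^ (a - 1 - 1), ?_,
    ((Pw_hasDeriv hN hr).mul (hasDerivAt_rpow_const (p := a - 1) (Or.inl hr.ne'))).congr_deriv (by ring)⟩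
  have e : r ^ (a - 1) = r * r ^ (a - 2) := by
    rw [mul_comm, ← rpow_add_one hr.ne']; congr 1; ring
  have e2 : a - 1 - 1 = a - 2 := by ring
  rw [e2, e]
  have h1 := coth_ge hr
  have h2 : 0 < r ^ (a - 2) := by positivity
  have h3 : (1:ℝ) ≤ N - 1 := by have : (2:ℝ) ≤ N := by exact_mod_cast hN
                                linarith
  have h4 : 0 ≤ ((N:ℝ) - 1) * r ^ (a - 2) * (r * (cosh r / sinh r) - 1) := by
    apply mul_nonneg (by positivity) (by linarith)
  have h5 : ((N:ℝ) - 1) * (cosh r / sinh r) * (r * r ^ (a - 2)) + (a - 1) * r ^ (a - 2) - (a + N - 2) * r ^ (a - 2) =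
    ((N:ℝ) - 1) * r ^ (a - 2) * (r * (cosh r / sinh r) - 1) := by ring
  linarith
/-- one bootstrap step -/
lemma ZF.step (h : ZF N p c z zr zt) {τ1 C b a : ℝ} (hτ1 : 0 < τ1) (hC : 0 < C)
    (hb : ∀ r ∈ Ioc 0 1, ∀ τ ≥ τ1, z r τ ≤ C * r ^ (-b)) (ha : a ≤ 2 - b * p) (ha0 : a ≠ 0) (ha1 : 0 < a + N - 2) :
    ∃ Λ > 0, ∃ K > 0, ∀ r ∈ Ioc 0 1, ∀ τ ≥ τ1, z r τ ≤ Λ + K * ((1 - r ^ a) / a) := by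
  obtain ⟨C1, hC1⟩ := h.bd τ1 hτ1 τ1
  have hc := h.hc
  have hp := h.hp
  set Λ := max C C1 with hΛ
  have hΛ0 : 0 < Λ := hC.trans_le (le_max_left _ _)
  set K := (c * C ^ p + 1) / (a + N - 2) with hK
  have hK0 : 0 < K := by positivity
  refine ⟨Λ, hΛ0, K, hK0, ?_⟩
  have hpos : ∀ r ∈ Ioc (0:ℝ) 1, 0 ≤ (1 - r ^ a) / a := fun r hr => by
    rcases lt_or_gt_of_ne ha0 with h1 | h1
    · exact div_nonneg_of_nonpos (by linarith [one_le_rpow_of_pos_of_le_one_of_nonpos hr.1 hr.2 h1.le]) h1.le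
    · exact div_nonneg (by linarith [rpow_le_one hr.1.le hr.2 h1.le]) h1.le
  choose! L hL1 hL2 using fun r (hr : 0 < r) => pow_bar (a := a) h.hN hr
  intro r hr τ hτ
  have := h.cmp 1 (φ := fun r => Λ + K * ((1 - r ^ a) / a)) (φ' := fun r => -K * r ^ (a - 1)) (L := fun r => -K * L r)
    (χ := fun _ => 0) (χ' := fun _ => 0) (ρ := 1) (τ2 := τ) hτ1 ?_ continuousOn_const ?_ ?_ (fun _ _ => hasDerivAt_const _ _) ?_ ?_ ?_ ?_ r hr τ ⟨hτ, le_rfl⟩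
  · linarith
  · exact continuousOn_const.add (continuousOn_const.mul ((continuousOn_const.sub (continuousOn_id.rpow_const
      fun x hx => Or.inl hx.1.ne')).div_const a))
  · intro r hr
    refine (((((hasDerivAt_rpow_const (p := a) (Or.inl hr.1.ne')).const_sub 1).div_const a).const_mul K).const_add Λ).congr_deriv ?_
    field_simp
  · intro r hr
    refine (((hL2 r hr.1).const_mul (-K)).congr_deriv (by ring)).congr_of_eventuallyEq (Eventually.of_forall fun x => ?_)
    ring
  · obtain ⟨C2, hC2⟩ := h.bd τ1 hτ1 τ
    refine ⟨C2, fun r hr τ hτ => ?_⟩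
    have h1 := hC2 r hr τ hτ
    have h2 := mul_nonneg hK0.le (hpos r hr)
    linarith
  · intro r hr
    have h1 := hC1 r hr τ1 ⟨le_rfl, le_rfl⟩
    have h2 := mul_nonneg hK0.le (hpos r hr)
    have h3 := le_max_right C C1
    linarith
  · intro τ hτ
    have h1 := hb 1 ⟨one_pos, le_rfl⟩ τ hτ.1
    have h3 := le_max_left C C1
    simp only [one_rpow] at h1 ⊢
    simp only [sub_self, zero_div]; linarith
  · intro r hr τ hτ h1 h2 h3
    have hr1 : r ∈ Ioc (0:ℝ) 1 := ⟨hr.1, hr.2.le⟩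
    have hz := h.zpos r hr.1 τ (hτ1.trans hτ.1)
    have hzt : 0 ≤ p * z r τ ^ (p - 1) * zt r τ := mul_nonneg (by positivity) (by linarith)
    have h4 : z r τ ^ p ≤ C ^ p * r ^ (a - 2) := by
      calc z r τ ^ p ≤ (C * r ^ (-b)) ^ p := rpow_le_rpow hz.le (hb r hr1 τ hτ.1.le) (by linarith)
        _ = C ^ p * r ^ (-b * p) := by rw [mul_rpow hC.le (by have := hr.1; positivity), ← rpow_mul hr.1.le]
        _ ≤ _ := by
          gcongr ?_ * ?_
          exact rpow_le_rpow_of_exponent_ge hr.1 hr.2.le (by linarith)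
    have h5 := mul_le_mul_of_nonneg_left (hL1 r hr.1) hK0.le
    have h6 : K * ((a + N - 2) * r ^ (a - 2)) = c * (C ^ p * r ^ (a - 2)) + r ^ (a - 2) := by rw [hK]; field_simp
    have h7 : 0 < r ^ (a - 2) := by have := hr.1; positivity
    have h8 := mul_le_mul_of_nonneg_left h4 hc.le
    linarith
lemma ZF.boot (h : ZF N p c z zr zt) {τ1 γ : ℝ} (hτ1 : 0 < τ1) (hγ : 0 < γ) (k : ℕ) : ∀ b, 0 < b → γ ≤ 2 - (p - 1) * b → b * p < N → b < k * γ →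
    (∃ C > 0, ∀ r ∈ Ioc 0 1, ∀ τ ≥ τ1, z r τ ≤ C * r ^ (-b)) → ∃ Λ > 0, ∀ r ∈ Ioc 0 1, ∀ τ ≥ τ1, z r τ ≤ Λ := by
  have hp := h.hp
  induction k with
  | zero => intro b hb _ _ h1; simp at h1; linarith
  | succ k ih =>
    rintro b hb hbγ hbN hbk ⟨C, hC, hz⟩
    push_cast at hbk
    rcases lt_or_ge (b * p) 2 with h2 | h2
    · have hN2 : (2:ℝ) ≤ N := by exact_mod_cast h.hN
      obtain ⟨Λ, hΛ, K, hK, hk⟩ := h.step hτ1 hC hz (a := 2 - b * p) le_rfl (by linarith) (by linarith)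
      have ha : 0 < 2 - b * p := by linarith
      refine ⟨Λ + K * (1 / (2 - b * p)), by positivity, fun r hr τ hτ => (hk r hr τ hτ).trans ?_⟩
      have := hr.1
      gcongr
      have : 0 < r ^ (2 - b * p) := by positivity
      linarith
    · have hN3 : (3:ℝ) ≤ N := by
        have : (2:ℝ) < N := by linarith
        have : 2 < N := by exact_mod_cast this
        exact_mod_cast this
      have hbg : γ ≤ b := by nlinarith
      have hk1 : 0 < (k:ℝ) := by
        by_contra hk
        have : (k:ℝ) * γ ≤ 0 := mul_nonpos_of_nonpos_of_nonneg (not_lt.1 hk) hγ.le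
        linarith
      have hk1 : (1:ℝ) ≤ k := by
        have : 0 < k := by exact_mod_cast hk1
        exact_mod_cast this
      have hkγ : γ ≤ k * γ := by nlinarith
      set b' := max (b * p - 2) (γ / 2) with hb'
      have hg2 : γ < 2 := by nlinarith
      have hb0 : 0 < b' := lt_max_of_lt_right (by linarith)
      have hbb : b' ≤ b := max_le (by nlinarith) (by linarith)
      have hbN' : b' < N - 2 := max_lt (by linarith) (by linarith)
      obtain ⟨Λ, hΛ, K, hK, hk⟩ := h.step hτ1 hC hz (a := -b') (by linarith [le_max_left (b * p - 2) (γ / 2)]) (by linarith) (by linarith)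
      refine ih b' hb0 (by nlinarith) (by nlinarith) (max_lt (by nlinarith) (by linarith)) ⟨Λ + K / b', by positivity, fun r hr τ hτ => (hk r hr τ hτ).trans ?_⟩
      have h1 := one_le_rpow_of_pos_of_le_one_of_nonpos hr.1 hr.2 (show -b' ≤ 0 by linarith)
      have h3 : (1 - r ^ (-b')) / -b' = (r ^ (-b') - 1) / b' := by field_simp; ring
      rw [h3]
      have h4 : K * ((r ^ (-b') - 1) / b') = K / b' * r ^ (-b') - K / b' := by field_simp
      have h5 : 0 < K / b' := by positivity
      nlinarith
lemma ZF.Linf (h : ZF N p c z zr zt) {τ1 C : ℝ} (hτ1 : 0 < τ1) (hC : 0 < C)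
    (hb : ∀ r ∈ Ioc 0 1, ∀ τ ≥ τ1, z r τ ≤ C * √(Sg N r)) : ∃ Λ > 0, ∀ r ∈ Ioc 0 1, ∀ τ ≥ τ1, z r τ ≤ Λ := by
  have hp := h.hp
  obtain ⟨β, hβ, hβN, hβp, hβ4, hβ3, hβ2⟩ := beta_exists h.hN hp h.hsub
  obtain ⟨C1, hC1, hs⟩ := Sg_near (N := N) h.hN hβ hβN
  set γ := 2 - (p - 1) * (β / 2) with hγ
  have hγ0 : 0 < γ := by rw [hγ]; nlinarith
  obtain ⟨k, hk⟩ := exists_nat_gt (β / 2 / γ)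
  refine h.boot hτ1 hγ0 k (β / 2) (by positivity) le_rfl (by nlinarith) ((div_lt_iff₀ hγ0).1 hk) ⟨C * √C1, by positivity, fun r hr τ hτ => (hb r hr τ hτ).trans ?_⟩
  rw [mul_assoc]
  gcongr
  have h1 : r ^ (-(β / 2)) = √(r ^ (-β)) := by
    rw [sqrt_eq_rpow, ← rpow_mul hr.1.le]; congr 1; ring
  rw [h1, ← sqrt_mul hC1.le]
  exact sqrt_le_sqrt (hs r hr.1 hr.2)
end

section
open Real
variable {r : ℝ} {t : ℝ}
variable {N : ℕ} {p c : ℝ} {z zr zt : ℝ → ℝ → ℝ}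
lemma ZF.upper (h : ZF N p c z zr zt) {τ1 τ Λ A ρ : ℝ} (hτ1 : 0 < τ1) (hΛ : 0 < Λ) (hρ : ρ ≤ 1)
    (hb : ∀ r ∈ Ioc 0 1, ∀ τ ≥ τ1, z r τ ≤ Λ) (hA : 0 < A) (hAz : ∀ τ ≥ τ1, z ρ τ ≤ A) (hτ : τ1 ≤ τ) (hr : r ∈ Ioc 0 ρ) :
    z r τ ≤ A + (c + p) * Λ ^ p * (ρ ^ 2 - r ^ 2) + Λ * exp (-(τ - τ1)) := by
  have hc := h.hc
  have hp := h.hp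
  have hN2 : (2:ℝ) ≤ N := by exact_mod_cast h.hN
  set K := (c + p) * Λ ^ p with hK
  have hK0 : 0 < K := by positivity
  choose! L hL1 hL2 using fun r (hr : 0 < r) => pow_bar (a := 2) h.hN hr
  have hin : ∀ r ∈ Ioc 0 ρ, r ∈ Ioc (0:ℝ) 1 := fun r hr => ⟨hr.1, hr.2.trans hρ⟩
  have hφ0 : ∀ r ∈ Ioc 0 ρ, 0 ≤ K * (ρ ^ 2 - r ^ 2) := fun r hr => mul_nonneg hK0.le (by nlinarith [hr.1, hr.2])
  have := h.cmp 1 (φ := fun r => A + K * (ρ ^ 2 - r ^ 2)) (φ' := fun r => -(2 * K) * r ^ ((2:ℝ) - 1)) (L := fun r => -(2 * K) * L r)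
    (χ := fun τ => Λ * exp (-(τ - τ1))) (χ' := fun τ => -(Λ * exp (-(τ - τ1)))) (ρ := ρ) (τ2 := τ) hτ1 (by fun_prop) (by fun_prop)
    ?_ ?_ ?_ ?_ ?_ ?_ ?_ r hr τ ⟨hτ, le_rfl⟩
  · linarith
  · intro r hr
    refine ((((hasDerivAt_pow 2 r).const_sub (ρ ^ 2)).const_mul K).const_add A).congr_deriv ?_
    norm_num
    ring
  · intro r hr
    refine (((hL2 r hr.1).const_mul (-(2 * K))).congr_deriv (by ring)).congr_of_eventuallyEq (Eventually.of_forall fun x => ?_)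
    ring
  · intro τ _
    refine ((((hasDerivAt_id τ).sub_const τ1).neg.exp).const_mul Λ).congr_deriv ?_
    simp
  · refine ⟨Λ, fun r hr τ hτ => ?_⟩
    have h1 := hb r (hin r hr) τ hτ.1
    have h2 := hφ0 r hr
    have h3 : 0 < Λ * exp (-(τ - τ1)) := by positivity
    linarith
  · intro r hr
    have h1 := hb r (hin r hr) τ1 le_rfl
    have h2 := hφ0 r hr
    simp only [sub_self, neg_zero, exp_zero]
    linarith
  · intro τ hτ
    have h1 := hAz τ hτ.1
    have h3 : 0 < Λ * exp (-(τ - τ1)) := by positivity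
    simp only [sub_self]
    linarith
  · intro r hr τ hτ h1 h2 h3
    have hr1 := hin r ⟨hr.1, hr.2.le⟩
    have hz := h.zpos r hr.1 τ (hτ1.trans hτ.1)
    have hzΛ := hb r hr1 τ hτ.1.le
    have hzp : z r τ ^ p ≤ Λ ^ p := rpow_le_rpow hz.le hzΛ (by linarith)
    have hzp1 : z r τ ^ (p - 1) ≤ Λ ^ (p - 1) := rpow_le_rpow hz.le hzΛ (by linarith)
    have he : exp (-(τ - τ1)) ≤ 1 := exp_le_one_iff.2 (by linarith [hτ.1])
    have hzt : -Λ ≤ zt r τ := by nlinarith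
    have h4 : Λ ^ (p - 1) * Λ = Λ ^ p := by rw [← rpow_add_one hΛ.ne']; congr 1; ring
    have h5 : -(p * Λ ^ p) ≤ p * z r τ ^ (p - 1) * zt r τ := by
      have h6 : 0 < z r τ ^ (p - 1) := by positivity
      have h7 := mul_le_mul_of_nonneg_left hzt (show 0 ≤ p * z r τ ^ (p - 1) by positivity)
      have h8 : p * z r τ ^ (p - 1) * Λ ≤ p * Λ ^ (p - 1) * Λ := by gcongr
      have h9 : p * Λ ^ (p - 1) * Λ = p * Λ ^ p := by rw [mul_assoc, h4]
      linarith
    have h6 := hL1 r hr.1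
    norm_num at h6
    have h7 := mul_le_mul_of_nonneg_left (show 1 ≤ L r by linarith) hK0.le
    have h8 := mul_le_mul_of_nonneg_left hzp hc.le
    have h9 : K = c * Λ ^ p + p * Λ ^ p := by rw [hK]; ring
    linarith
lemma ZF.lower (h : ZF N p c z zr zt) {τ1 A ρ : ℝ} (hτ1 : 0 < τ1) (hρ0 : 0 < ρ) (hρ : ρ ≤ 1)
    (hA : 0 < A) (hAz : ∀ τ ≥ τ1, A ≤ z ρ τ) : ∃ κ > 0, ∀ τ ≥ τ1, ∀ r ∈ Ioc 0 ρ, A - A * exp (-κ * (τ - τ1)) ≤ z r τ := by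
  have hc := h.hc
  have hp := h.hp
  obtain ⟨η1, hη1, hη⟩ := h.lbd τ1 hτ1
  set η := min η1 A with hηd
  have hη0 : 0 < η := lt_min hη1 hA
  have hηA : η ≤ A := min_le_right _ _
  have hin : ∀ r ∈ Ioc 0 ρ, r ∈ Ioc (0:ℝ) 1 := fun r hr => ⟨hr.1, hr.2.trans hρ⟩
  have hsplit : ∀ x : ℝ, 0 < x → x ^ p = x ^ (p - 1) * x := fun x hx => by rw [← rpow_add_one hx.ne']; congr 1; ring
  have hL0 : ∀ r ∈ Ioo 0 ρ, HasDerivAt (fun x => Pw N x * (0:ℝ)) (Pw N r * 0) r := fun r hr => by simpa using hasDerivAt_const r (0:ℝ)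
  have hst : ∀ τ ≥ τ1, ∀ r ∈ Ioc 0 ρ, η ≤ z r τ := by
    intro τ hτ r hr
    have := h.cmp (-1) (φ := fun r => η) (φ' := fun _ => 0) (L := fun r => 0)
      (χ := fun _ => 0) (χ' := fun _ => 0) (ρ := ρ) (τ2 := τ) hτ1 (by fun_prop) (by fun_prop)
      (fun r _ => hasDerivAt_const _ _) hL0 (fun _ _ => hasDerivAt_const _ _) ⟨η, fun r hr τ hτ => ?_⟩ (fun r hr => ?_) (fun τ hτ => ?_) ?_ r hr τ ⟨hτ, le_rfl⟩
    · linarith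
    · linarith [h.zpos r hr.1 τ (hτ1.trans_le hτ.1)]
    · linarith [hη r (hin r hr), min_le_left η1 A]
    · linarith [hAz τ hτ.1]
    · intro r hr τ hτ h1 h2 h3
      have hz := h.zpos r hr.1 τ (hτ1.trans hτ.1)
      have h4 : p * z r τ ^ (p - 1) * zt r τ ≤ 0 := mul_nonpos_of_nonneg_of_nonpos (by positivity) (by linarith)
      have h5 : 0 < c * z r τ ^ p := by positivity
      linarith
  set κ := c * η / (2 * p * A) with hκ
  have hκ0 : 0 < κ := by positivity
  refine ⟨κ, hκ0, fun τ hτ r hr => ?_⟩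
  have := h.cmp (-1) (φ := fun r => A) (φ' := fun _ => 0) (L := fun r => 0)
      (χ := fun τ => -((A - η) * exp (-κ * (τ - τ1)))) (χ' := fun τ => κ * ((A - η) * exp (-κ * (τ - τ1)))) (ρ := ρ) (τ2 := τ) hτ1 (by fun_prop) (by fun_prop)
      (fun r _ => hasDerivAt_const _ _) hL0 (fun τ _ => ?_) ⟨A, fun r hr τ hτ => ?_⟩ (fun r hr => ?_) (fun τ hτ => ?_) ?_ r hr τ ⟨hτ, le_rfl⟩
  · have : 0 < exp (-κ * (τ - τ1)) := exp_pos _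
    nlinarith
  · refine ((((((hasDerivAt_id τ).sub_const τ1).const_mul (-κ)).exp).const_mul (A - η)).neg).congr_deriv ?_
    simp
    ring
  · have h1 := h.zpos r hr.1 τ (hτ1.trans_le hτ.1)
    have : 0 ≤ (A - η) * exp (-κ * (τ - τ1)) := mul_nonneg (by linarith) (exp_pos _).le
    linarith
  · simp only [sub_self, mul_zero, exp_zero]
    linarith [hst τ1 le_rfl r hr]
  · have : 0 ≤ (A - η) * exp (-κ * (τ - τ1)) := mul_nonneg (by linarith) (exp_pos _).le
    linarith [hAz τ hτ.1]
  · intro r hr τ hτ h1 h2 h3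
    have hz := h.zpos r hr.1 τ (hτ1.trans hτ.1)
    have hs := hst τ hτ.1.le r ⟨hr.1, hr.2.le⟩
    have he : exp (-κ * (τ - τ1)) ≤ 1 := exp_le_one_iff.2 (by nlinarith [hτ.1])
    have he0 := exp_pos (-κ * (τ - τ1))
    have h4 : zt r τ ≤ κ * A := by
      have : (A - η) * exp (-κ * (τ - τ1)) ≤ A * 1 := mul_le_mul (by linarith) he he0.le hA.le
      nlinarith
    rw [hsplit _ hz] at h3
    have h5 : 0 < z r τ ^ (p - 1) := by positivity
    have h6 : 0 ≤ z r τ ^ (p - 1) * (p * zt r τ - c * z r τ) := by linarith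
    have h7 := nonneg_of_mul_nonneg_right h6 h5
    have h8 : p * (κ * A) = c * η / 2 := by rw [hκ]; field_simp
    have h9 : 0 < c * η := by positivity
    nlinarith
lemma ZF.near (h : ZF N p c z zr zt) {τ1 Λ α : ℝ} {V : ℝ → ℝ} (hτ1 : 0 < τ1) (hΛ : 0 < Λ)
    (hb : ∀ r ∈ Ioc 0 1, ∀ τ ≥ τ1, z r τ ≤ Λ) (hV : Tendsto V (𝓝[>] 0) (𝓝 α)) (hα : 0 < α)
    (hcv : ∀ r > 0, Tendsto (fun τ => z r τ) atTop (𝓝 (V r))) {ε' : ℝ} (hε' : 0 < ε') :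
    ∃ ρ ∈ Ioc (0:ℝ) 1, ∃ τ0, ∀ τ ≥ τ0, ∀ r ∈ Ioc 0 ρ, |z r τ - α| ≤ ε' := by
  have hc := h.hc
  have hp := h.hp
  set ε := min ε' α with hε
  have hε0 : 0 < ε := lt_min hε' hα
  set K := (c + p) * Λ ^ p with hK
  have hK0 : 0 < K := by positivity
  have hev : ∀ᶠ ρ in 𝓝[>] (0:ℝ), K * ρ ^ 2 < ε / 4 := by
    have : Tendsto (fun ρ : ℝ => K * ρ ^ 2) (𝓝 0) (𝓝 0) := by
      have : Continuous (fun ρ : ℝ => K * ρ ^ 2) := by fun_prop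
      simpa using this.tendsto 0
    exact (this.eventually_lt_const (by positivity)).filter_mono nhdsWithin_le_nhds
  obtain ⟨ρ, ⟨h1, h2⟩, h3⟩ := ((hev.and (hV.eventually (Metric.ball_mem_nhds α (show 0 < ε / 4 by positivity)))).and (Ioc_mem_nhdsGT one_pos)).exists
  obtain ⟨τ2, h4⟩ := eventually_atTop.1 (((hcv ρ h3.1).eventually (Metric.ball_mem_nhds (V ρ) (show 0 < ε / 4 by positivity))).and (eventually_ge_atTop τ1))
  rw [dist_eq, abs_lt] at h2
  have h12 := (h4 τ2 le_rfl).2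
  have h5 : ∀ τ ≥ τ2, α - ε / 2 ≤ z ρ τ ∧ z ρ τ ≤ α + ε / 2 := fun τ hτ => by
    have := (h4 τ hτ).1
    rw [dist_eq, abs_lt] at this
    constructor <;> linarith
  have hεα : ε ≤ α := min_le_right _ _
  have hεε : ε ≤ ε' := min_le_left _ _
  obtain ⟨κ, hκ, hlow⟩ := h.lower (hτ1.trans_le h12) h3.1 h3.2 (show 0 < α - ε / 2 by linarith) fun τ hτ => (h5 τ hτ).1
  have hup := fun τ (hτ : τ2 ≤ τ) r (hr : r ∈ Ioc 0 ρ) => h.upper (hτ1.trans_le h12) hΛ h3.2 (fun r hr τ hτ => hb r hr τ (h12.trans hτ)) (show 0 < α + ε / 2 by linarith) (fun τ hτ => (h5 τ hτ).2) hτ hr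
  have hexp : ∀ κ > 0, ∀ B > 0, ∀ᶠ τ in atTop, B * exp (-κ * (τ - τ2)) < ε / 4 := by
    intro κ hκ B hB
    have h1 : Tendsto (fun τ => κ * (τ - τ2)) atTop atTop := (tendsto_atTop_add_const_right _ _ tendsto_id).const_mul_atTop hκ
    have h2 := ((tendsto_exp_neg_atTop_nhds_zero.comp h1).const_mul B)
    rw [mul_zero] at h2
    filter_upwards [h2.eventually_lt_const (show 0 < ε / 4 by positivity)] with τ hτ
    simpa using hτ
  obtain ⟨τ0, h0⟩ := eventually_atTop.1 (((hexp κ hκ (α - ε / 2) (by linarith)).and (hexp 1 one_pos Λ hΛ)).and (eventually_ge_atTop τ2))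
  refine ⟨ρ, h3, τ0, fun τ hτ r hr => ?_⟩
  obtain ⟨⟨h6, h7⟩, h8⟩ := h0 τ hτ
  have h9 := hlow τ h8 r hr
  have h10 := hup τ h8 r hr
  rw [neg_one_mul] at h7
  have h11 : 0 < K * r ^ 2 := by have := hr.1; positivity
  rw [abs_le]
  constructor <;> linarith
end

section
open Real
variable {r : ℝ} {t : ℝ}
variable {N : ℕ} {m T : ℝ} {u g ut : ℝ → ℝ → ℝ}
lemma prof_V (hN : 2 ≤ N) (hm : 0 < m) (hm1 : m < 1) (hT : 0 < T) (hsub : ((N:ℝ) - 2) * (1 / m) < N + 2) {V : ℝ → ℝ}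
    (hV : IsStationaryProfile N m T V) : Prof N (1 / m) (1 / ((1 - m) * T)) V := by
  have hp : 1 < 1 / m := (one_lt_div hm).2 hm1
  have hc : 0 < 1 / ((1 - m) * T) := by have : 0 < 1 - m := by linarith
                                        positivity
  have hVc : ContinuousOn V (Ici 0) := hV.smooth.continuousOn
  have hsm : ContDiffOn ℝ (⊤ : ℕ∞) V IP := hV.smooth.mono Ioi_subset_Ici_self
  have hd : ∀ r > 0, HasDerivAt V (deriv V r) r := fun r hr =>
    ((hsm.differentiableOn (by simp)).differentiableAt (Ioi_mem_nhds hr)).hasDerivAt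
  have hd1 : ContDiffOn ℝ 1 (deriv V) IP := ((contDiffOn_infty_iff_deriv_of_isOpen isOpen_Ioi).1 hsm).2.of_le (by exact_mod_cast le_top)
  have hd2 : ∀ r > 0, HasDerivAt (deriv V) (deriv (deriv V) r) r := fun r hr =>
    ((hd1.differentiableOn (by simp)).differentiableAt (Ioi_mem_nhds hr)).hasDerivAt
  have hg := hd1.continuousOn
  obtain ⟨-, hi2, hi⟩ := hV.mem
  have hi2' : IntegrableOn (fun x => Pw N x * V x ^ 2) IP := hi2.congr_fun (fun x _ => by simp [Pw, mul_comm]) mI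
  have hi' : IntegrableOn (fun x => Pw N x * deriv V x ^ 2) IP := hi.congr_fun (fun x _ => by simp [Pw, mul_comm]) mI
  have hinf := y_inf hd hg hi' hi2'
  set D := ∫ x in IP, Pw N x * deriv V x ^ 2 with hD
  have hD0 : 0 ≤ D := setIntegral_nonneg mI fun x hx => mul_nonneg (Pw_pos hx).le (sq_nonneg _)
  have hsq : ∀ r > 0, V r ≤ √(D + 1) * √(Sg N r) := fun r hr => by
    rw [← sqrt_mul (by linarith)]
    refine le_sqrt_of_sq_le ((y_sq_le hN hd hg hi' hinf hr).trans ?_)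
    have := Sg_nonneg (N := N) hr
    nlinarith
  have hbd : ∃ C > 0, ∀ r > 0, V r ≤ C := by
    obtain ⟨C, hC⟩ := isCompact_Icc.bddAbove_image (hVc.mono (Icc_subset_Ici_self : Icc (0:ℝ) 1 ⊆ Ici 0))
    refine ⟨max C (√(D + 1) * √(Sg N 1)), lt_max_of_lt_right ?_, fun r hr => ?_⟩
    · have := Sg_pos hN one_pos
      positivity
    · rcases le_or_gt r 1 with h1 | h1
      · exact le_max_of_le_left (hC ⟨r, ⟨hr.le, h1⟩, rfl⟩)
      · refine le_max_of_le_right ((hsq r hr).trans ?_)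
        gcongr
        exact (Sg_strictAnti hN).antitoneOn (mem_Ioi.2 one_pos) hr h1.le
  have hpc : ContinuousOn (fun x => V x ^ (1 / m)) (Ici 0) := hVc.rpow_const fun x hx => Or.inl (hV.pos x hx).ne'
  have hMi : ∀ r > 0, IntervalIntegrable (fun x => Pw N x * V x ^ (1 / m)) volume 0 r := fun r hr =>
    (((Pw_cont N).continuousOn.mul hpc).mono (by rw [uIcc_of_le hr.le]; exact Icc_subset_Ici_self)).intervalIntegrable
  have hMd : ∀ r > 0, HasDerivAt (Mm N (fun x => V x ^ (1 / m))) (Pw N r * V r ^ (1 / m)) r := fun r hr =>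
    M_deriv (hpc.mono Ioi_subset_Ici_self) hr (hMi r hr)
  have hM0 : Tendsto (Mm N (fun x => V x ^ (1 / m))) (𝓝[>] 0) (𝓝 0) := by
    have h1 := intervalIntegral.continuousOn_primitive_interval' (hMi 1 one_pos) left_mem_uIcc 0 left_mem_uIcc
    have h2 : Tendsto (Mm N (fun x => V x ^ (1 / m))) (𝓝[uIcc 0 1] 0) (𝓝 0) := by
      have h3 := h1.tendsto
      rwa [intervalIntegral.integral_same] at h3
    rw [uIcc_of_le zero_le_one] at h2
    rw [← nhdsWithin_Ioc_eq_nhdsGT one_pos]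
    exact h2.mono_left (nhdsWithin_mono _ Ioc_subset_Icc_self)
  have hPV0 : Tendsto (fun r => Pw N r * deriv V r) (𝓝[>] 0) (𝓝 0) := by
    have h1 : ContinuousOn (derivWithin V (Ici 0)) (Ici 0) := hV.smooth.continuousOn_derivWithin (uniqueDiffOn_Ici 0) (by simp)
    have h2 := (((Pw_cont N).continuousOn.mul h1) 0 self_mem_Ici).tendsto
    rw [Pi.mul_apply, Pw_zero hN, zero_mul] at h2
    refine (h2.mono_left (nhdsWithin_mono _ Ioi_subset_Ici_self)).congr' ?_
    filter_upwards [self_mem_nhdsWithin] with x hx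
    rw [Pi.mul_apply, derivWithin_of_mem_nhds (Ici_mem_nhds (mem_Ioi.1 hx))]
  set c := 1 / ((1 - m) * T) with hcd
  have hφd : ∀ r > 0, HasDerivAt (fun r => Pw N r * deriv V r + c * Mm N (fun x => V x ^ (1 / m)) r) 0 r := fun r hr => by
    refine (((Pw_hasDeriv hN hr).mul (hd2 r hr)).add ((hMd r hr).const_mul c)).congr_deriv ?_
    have := hV.ode r hr
    have e : V r ^ (1 / m) / ((1 - m) * T) = c * V r ^ (1 / m) := by rw [hcd]; ring
    rw [e] at this
    linear_combination Pw N r * this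
  have hφc : ContinuousOn (fun r => Pw N r * deriv V r + c * Mm N (fun x => V x ^ (1 / m)) r) IP :=
    fun r hr => (hφd r hr).continuousAt.continuousWithinAt
  have hφ0 : Tendsto (fun r => Pw N r * deriv V r + c * Mm N (fun x => V x ^ (1 / m)) r) (𝓝[>] 0) (𝓝 0) := by
    simpa using hPV0.add (hM0.const_mul c)
  refine ⟨hN, hp, hc, hsub, fun r hr => hV.pos r hr.le, hbd, ⟨√(D + 1), by positivity, hsq⟩, fun r hr => ?_⟩
  have h1 := le_of_deriv0 hr (hφc.mono Ioc_subset_Ioi_self) (fun x hx => hφd x hx.1) (fun _ _ => le_rfl) hφ0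
  have h2 := le_of_deriv0 (φ' := fun _ => 0) (l := 0) hr (hφc.neg.mono Ioc_subset_Ioi_self) (fun x hx => by simpa using (hφd x hx.1).neg) (fun _ _ => le_rfl) (by have := hφ0.neg; rw [neg_zero] at this; exact this)
  refine (hd r hr).congr_deriv ?_
  have hP := Pp N hr
  field_simp
  simp only [Pi.neg_apply] at h2
  linarith
noncomputable def tt (T τ : ℝ) : ℝ := T - T * exp (-τ / T)
noncomputable def Ee (m T τ : ℝ) : ℝ := exp (τ / ((1 - m) * T))
lemma tt_mem (hT : 0 < T) {τ : ℝ} (hτ : 0 < τ) : tt T τ ∈ Ioo 0 T := by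
  have h1 : exp (-τ / T) < 1 := exp_lt_one_iff.2 (div_neg_of_neg_of_pos (by linarith) hT)
  have h2 := exp_pos (-τ / T)
  unfold tt
  constructor <;> nlinarith
lemma tt_mono (hT : 0 < T) {a b : ℝ} (h : a ≤ b) : tt T a ≤ tt T b := by
  unfold tt
  gcongr
lemma tt_lim (hT : 0 < T) : Tendsto (tt T) atTop (𝓝[<] T) := by
  refine tendsto_nhdsWithin_iff.2 ⟨?_, ?_⟩
  · have h1 : Tendsto (fun τ : ℝ => τ / T) atTop atTop := tendsto_id.atTop_div_const hT
    have h2 := ((tendsto_exp_neg_atTop_nhds_zero.comp h1).const_mul T).const_sub T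
    rw [mul_zero, sub_zero] at h2
    refine h2.congr fun τ => ?_
    simp [tt, neg_div]
  · filter_upwards [eventually_gt_atTop 0] with τ hτ
    exact (tt_mem hT hτ).2
lemma lam_tt (hT : 0 < T) (hm1 : m < 1) (τ : ℝ) : lam m T (tt T τ) = Ee m T τ := by
  have h1 : (T - tt T τ) / T = exp (-τ / T) := by unfold tt; field_simp; ring
  have : 1 - m ≠ 0 := by linarith
  rw [lam, h1, ← exp_mul, Ee]
  congr 1
  field_simp
lemma rescaled_eq (r τ : ℝ) : rescaled m T u r τ = Ee m T τ * u r (tt T τ) := rfl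
lemma FDC.zf (h : FDC N m T u g ut) : ∃ zr zt, ZF N (1 / m) (1 / ((1 - m) * T)) (fun r τ => rescaled m T u r τ ^ m) zr zt := by
  have hT := h.hT
  have hm := h.hm
  have hm1 := h.hm1
  have hm10 : 0 < 1 - m := by linarith
  set c := 1 / ((1 - m) * T) with hc
  have hE : ∀ τ, 0 < Ee m T τ := fun τ => exp_pos _
  have hEe : ∀ τ, Ee m T τ * exp (-τ / T) = Ee m T τ ^ m := fun τ => by
    rw [Ee, ← exp_mul, ← exp_add]; congr 1; field_simp; ring
  have hEd : ∀ τ, HasDerivAt (Ee m T) (c * Ee m T τ) τ := fun τ => by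
    refine (((hasDerivAt_id τ).div_const ((1 - m) * T)).exp).congr_deriv ?_
    simp [Ee, hc]; ring
  have htd : ∀ τ, HasDerivAt (tt T) (exp (-τ / T)) τ := fun τ => by
    refine (((((hasDerivAt_id τ).neg.div_const T).exp).const_mul T).const_sub T).congr_deriv ?_
    simp; field_simp
  have hw : ∀ r > 0, ∀ τ > 0, 0 < rescaled m T u r τ := fun r hr τ hτ => mul_pos (hE τ) (h.fl.upos r hr _ (tt_mem hT hτ))
  have hsplit : ∀ r > 0, ∀ τ > 0, rescaled m T u r τ ^ m = Ee m T τ ^ m * u r (tt T τ) ^ m := fun r hr τ hτ => by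
    rw [rescaled_eq, mul_rpow (hE τ).le (h.fl.upos r hr _ (tt_mem hT hτ)).le]
  have hEc : Continuous (Ee m T) := continuous_iff_continuousAt.2 fun τ => (hEd τ).continuousAt
  have htc : Continuous (tt T) := continuous_iff_continuousAt.2 fun τ => (htd τ).continuousAt
  have hwd : ∀ r > 0, ∀ τ > 0, HasDerivAt (fun x => rescaled m T u r x)
    (c * rescaled m T u r τ + Ee m T τ ^ m * ut r (tt T τ)) τ := fun r hr τ hτ => by
    have h1 := (h.fl.uder r hr _ (tt_mem hT hτ)).comp τ (htd τ)
    refine ((hEd τ).mul h1).congr_deriv ?_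
    rw [← hEe, rescaled_eq]; simp only [Function.comp]; ring
  refine ⟨fun r τ => Ee m T τ ^ m * g r (tt T τ), fun r τ => (c * rescaled m T u r τ + Ee m T τ ^ m * ut r (tt T τ)) * m * rescaled m T u r τ ^ (m - 1),
    h.hN, h.hp, by positivity, h.hsub, fun r hr τ hτ => rpow_pos_of_pos (hw r hr τ hτ) _, ?_, ?_, ?_, ?_, ?_, ?_⟩
  · refine ContinuousOn.rpow_const ?_ fun x hx => Or.inl (hw x.1 hx.1 x.2 hx.2).ne'
    refine (hEc.comp continuous_snd).continuousOn.mul ?_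
    exact h.fl.ucont.comp (f := fun x : ℝ × ℝ => (x.1, tt T x.2)) (by fun_prop) fun x hx => ⟨hx.1, tt_mem hT hx.2⟩
  · intro r hr τ hτ
    refine ((h.fl.vr r hr _ (tt_mem hT hτ)).const_mul (Ee m T τ ^ m)).congr_of_eventuallyEq ?_
    filter_upwards [Ioi_mem_nhds hr] with x hx
    exact hsplit x hx τ hτ
  · intro r hr τ hτ
    exact (hwd r hr τ hτ).rpow_const (Or.inl (hw r hr τ hτ).ne')
  · intro r hr τ hτ
    have hW := hw r hr τ hτ
    refine (((h.fl.Pg r hr _ (tt_mem hT hτ)).const_mul (Ee m T τ ^ m)).congr_deriv ?_).congr_of_eventuallyEq (Eventually.of_forall fun x => by ring)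
    have e1 : (rescaled m T u r τ ^ m) ^ (1 / m) = rescaled m T u r τ := by rw [← rpow_mul hW.le, mul_one_div_cancel hm.ne', rpow_one]
    have e2 : (rescaled m T u r τ ^ m) ^ (1 / m - 1) * rescaled m T u r τ ^ (m - 1) = 1 := by
      rw [← rpow_mul hW.le, ← rpow_add hW, show m * (1 / m - 1) + (m - 1) = 0 by field_simp; ring, rpow_zero]
    rw [e1]
    have e3 : 1 / m * m = 1 := by field_simp
    linear_combination (-(Pw N r * (c * rescaled m T u r τ + Ee m T τ ^ m * ut r (tt T τ)) * (1 / m * m))) * e2 - (Pw N r * (c * rescaled m T u r τ + Ee m T τ ^ m * ut r (tt T τ))) * e3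
  · intro τ1 hτ1 τ2
    rcases le_or_gt τ1 τ2 with h12 | h12
    swap
    · exact ⟨0, fun r _ τ hτ => absurd (hτ.1.trans hτ.2) (not_le.2 h12)⟩
    obtain ⟨C, hC⟩ := h.fl.bd (tt T τ1) (tt T τ2) 1 (tt_mem hT hτ1).1 (tt_mem hT (hτ1.trans_le h12)).2
    refine ⟨(Ee m T τ2 * C) ^ m, fun r hr τ hτ => ?_⟩
    have hτ0 := hτ1.trans_le hτ.1
    refine rpow_le_rpow (hw r hr.1 τ hτ0).le ?_ hm.le
    have h1 := (hC r hr _ ⟨tt_mono hT hτ.1, tt_mono hT hτ.2⟩).1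
    have h2 := h.fl.upos r hr.1 _ (tt_mem hT hτ0)
    have h3 : Ee m T τ ≤ Ee m T τ2 := by unfold Ee; gcongr; exact hτ.2
    exact mul_le_mul h3 h1 h2.le (hE _).le
  · intro τ hτ
    obtain ⟨η, hη, h1⟩ := h.fl.lbd (tt T τ) 1 (tt_mem hT hτ)
    have h2 := hE τ
    refine ⟨(Ee m T τ * η) ^ m, by positivity, fun r hr => ?_⟩
    exact rpow_le_rpow (by positivity) (mul_le_mul_of_nonneg_left (h1 r hr) (hE τ).le) hm.le
end

section
open Real
variable {r : ℝ} {t : ℝ}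
variable {N : ℕ} {p C : ℝ} {y a : ℝ → ℝ} {Y : ℕ → ℝ → ℝ}
structure EqC (N : ℕ) (C : ℝ) (y : ℝ → ℝ) : Prop where
  nn : ∀ r > 0, 0 ≤ y r
  le : ∀ r > 0, y r ≤ C * √(Sg N r)
  eq : ∀ r q, 0 < r → r ≤ q → (y r - y q) ^ 2 ≤ C ^ 2 * (Sg N r - Sg N q)
lemma EqC.abs (h : EqC N C y) {r q : ℝ} (hr : 0 < r) (hq : 0 < q) : |y r - y q| ≤ √(C ^ 2 * |Sg N r - Sg N q|) := by
  refine abs_le_sqrt ?_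
  rcases le_total r q with h1 | h1
  · exact (h.eq r q hr h1).trans (mul_le_mul_of_nonneg_left (le_abs_self _) (sq_nonneg _))
  · rw [abs_sub_comm, ← neg_sub, neg_sq]
    exact (h.eq q r hq h1).trans (mul_le_mul_of_nonneg_left (le_abs_self _) (sq_nonneg _))
lemma eqc_mod (hN : 2 ≤ N) (C : ℝ) (hr : 0 < r) {ε : ℝ} (hε : 0 < ε) : ∀ᶠ q in 𝓝 r, 0 < q ∧ √(C ^ 2 * |Sg N r - Sg N q|) < ε := by
  refine (eventually_gt_nhds hr).and ?_
  have h1 := (Sg_cont hN).continuousAt (Ioi_mem_nhds hr)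
  have h2 : ContinuousAt (fun q => √(C ^ 2 * |Sg N r - Sg N q|)) r := (continuousAt_const.mul (continuousAt_const.sub h1).abs).sqrt
  exact h2.eventually_lt continuousAt_const (by simpa using hε)
lemma EqC.cont (hN : 2 ≤ N) (h : EqC N C y) : ContinuousOn y IP := by
  intro r hr
  refine ContinuousAt.continuousWithinAt (Metric.tendsto_nhds.2 fun ε hε => ?_)
  filter_upwards [eqc_mod hN C (mem_Ioi.1 hr) hε] with q hq
  rw [dist_comm, dist_eq]
  exact (h.abs hr hq.1).trans_lt hq.2
lemma EqC.lim (h : ∀ n, EqC N C (Y n)) (ha : ∀ r > 0, Tendsto (fun n => Y n r) atTop (𝓝 (a r))) : EqC N C a where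
  nn r hr := ge_of_tendsto' (ha r hr) fun n => (h n).nn r hr
  le r hr := le_of_tendsto' (ha r hr) fun n => (h n).le r hr
  eq r q hr hq := le_of_tendsto' (((ha r hr).sub (ha q (hr.trans_le hq))).pow 2) fun n => (h n).eq r q hr hq
lemma EqC.subseq (hN : 2 ≤ N) (h : ∀ n, EqC N C (Y n)) : ∃ φ : ℕ → ℕ, StrictMono φ ∧ ∃ a : ℝ → ℝ, ∀ r > 0, Tendsto (fun n => Y (φ n) r) atTop (𝓝 (a r)) := by
  have hK : IsCompact (Set.pi univ fun q : {q : ℚ // 0 < q} => Icc (0:ℝ) (C * √(Sg N ((q:ℚ):ℝ)))) := isCompact_univ_pi fun _ => isCompact_Icc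
  obtain ⟨b, -, φ, hφ, hb⟩ := hK.tendsto_subseq (x := fun n (q : {q : ℚ // 0 < q}) => Y n ((q:ℚ):ℝ)) fun n q _ =>
    ⟨(h n).nn _ (by exact_mod_cast q.2), (h n).le _ (by exact_mod_cast q.2)⟩
  rw [tendsto_pi_nhds] at hb
  refine ⟨φ, hφ, ?_⟩
  have : ∀ r : ℝ, ∃ l, 0 < r → Tendsto (fun n => Y (φ n) r) atTop (𝓝 l) := fun r => by
    by_cases hr : 0 < r
    · suffices hc : CauchySeq fun n => Y (φ n) r by
        obtain ⟨l, hl⟩ := cauchySeq_tendsto_of_complete hc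
        exact ⟨l, fun _ => hl⟩
      refine Metric.cauchySeq_iff'.2 fun ε hε => ?_
      obtain ⟨δ, hδ, hm⟩ := Metric.eventually_nhds_iff.1 (eqc_mod hN C hr (by positivity : 0 < ε / 3))
      obtain ⟨q, hq1, hq2⟩ := exists_rat_btwn (lt_add_of_pos_right r hδ)
      have hq := hm (y := (q:ℝ)) (by rw [dist_eq, abs_of_pos] <;> linarith)
      obtain ⟨M, hM⟩ := Metric.cauchySeq_iff'.1 (hb ⟨q, by exact_mod_cast hq.1⟩).cauchySeq (ε / 3) (by positivity)
      refine ⟨M, fun n hn => ?_⟩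
      have h1 := hM n hn
      have h2 := (h (φ n)).abs hr hq.1
      have h3 := (h (φ M)).abs hr hq.1
      simp only [dist_eq, Function.comp] at h1 ⊢
      rw [abs_lt] at h1 ⊢
      rw [abs_le] at h2 h3
      constructor <;> linarith [hq.2, h1.1, h1.2, h2.1, h2.2, h3.1, h3.2]
    · exact ⟨0, fun h => absurd h hr⟩
  choose a ha using this
  exact ⟨a, ha⟩
lemma EqC.pb (hC : 0 < C) (hp : 1 < p) (h : EqC N C y) {x : ℝ} (hx : 0 < x) : |y x ^ p| ≤ C ^ p * Sg N x ^ (p / 2) := by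
  have h1 := h.nn x hx
  rw [abs_of_nonneg (by positivity)]
  refine (rpow_le_rpow h1 (h.le x hx) (by linarith)).trans_eq ?_
  rw [mul_rpow hC.le (by positivity), sqrt_eq_rpow, ← rpow_mul (Sg_nonneg hx)]
  congr 2
  ring
lemma EqC.pc (hN : 2 ≤ N) (hp : 1 < p) (h : EqC N C y) : ContinuousOn (fun x => y x ^ p) IP :=
  (h.cont hN).rpow_const fun _ _ => Or.inr (by linarith)
lemma EqC.int (hN : 2 ≤ N) (hp : 1 < p) (hsub : ((N:ℝ) - 2) * p < N + 2) (hC : 0 < C) (h : EqC N C y) :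
    IntegrableOn (fun x => Pw N x * y x ^ p * √(Sg N x)) IP := by
  refine ((Sp_int hN hp hsub).const_mul (C ^ p)).mono' ((((Pw_cont N).continuousOn.mul (h.pc hN hp)).mul (sqS_cont hN)).aestronglyMeasurable mI) ?_
  filter_upwards [ae_restrict_mem mI] with x hx
  have hx' := mem_Ioi.1 hx
  have h1 := h.pb hC hp hx'
  have h2 := Pp N hx'
  rw [norm_eq_abs, abs_mul, abs_mul, abs_of_pos h2, abs_of_nonneg (sqrt_nonneg _)]
  calc _ ≤ Pw N x * (C ^ p * Sg N x ^ (p / 2)) * √(Sg N x) := by gcongr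
    _ = _ := by ring
lemma EqC.mint (hN : 2 ≤ N) (hp : 1 < p) (hsub : ((N:ℝ) - 2) * p < N + 2) (hC : 0 < C) (h : EqC N C y) (hr : 0 ≤ r) :
    IntervalIntegrable (fun x => Pw N x * y x ^ p) volume 0 r :=
  Mint hN (h.pc hN hp) (fun x hx => rpow_nonneg (h.nn x hx) _) (h.int hN hp hsub hC) hr
lemma EqC.md (hN : 2 ≤ N) (hp : 1 < p) (hsub : ((N:ℝ) - 2) * p < N + 2) (hC : 0 < C) (h : EqC N C y) (hr : 0 < r) :
    HasDerivAt (Mm N fun x => y x ^ p) (Pw N r * y r ^ p) r :=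
  M_deriv (h.pc hN hp) hr (h.mint hN hp hsub hC hr.le)
lemma EqC.mc (hN : 2 ≤ N) (hp : 1 < p) (hsub : ((N:ℝ) - 2) * p < N + 2) (hC : 0 < C) (h : EqC N C y) :
    ContinuousOn (fun r => Mm N (fun x => y x ^ p) r / Pw N r) IP := fun r hr =>
  ((h.md hN hp hsub hC (mem_Ioi.1 hr)).continuousAt.div (Pw_cont N).continuousAt (Pw_pos (mem_Ioi.1 hr)).ne').continuousWithinAt
lemma EqC.mlim (hN : 2 ≤ N) (hp : 1 < p) (hsub : ((N:ℝ) - 2) * p < N + 2) (hC : 0 < C) (h : ∀ n, EqC N C (Y n))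
    (ha : ∀ r > 0, Tendsto (fun n => Y n r) atTop (𝓝 (a r))) (hr : 0 < r) :
    Tendsto (fun n => Mm N (fun x => Y n x ^ p) r) atTop (𝓝 (Mm N (fun x => a x ^ p) r)) := by
  have hS0 : ∀ x > 0, 0 ≤ Sg N x ^ (p / 2) := fun x hx => rpow_nonneg (Sg_nonneg hx) _
  refine intervalIntegral.tendsto_integral_filter_of_dominated_convergence (fun x => C ^ p * (Pw N x * Sg N x ^ (p / 2))) (Eventually.of_forall fun n => ?_)
    (Eventually.of_forall fun n => ae_of_all _ fun x hx => ?_) ((Mint hN (Sp_cont hN _) hS0 (Sp_int hN hp hsub) hr.le).const_mul _) (ae_of_all _ fun x hx => ?_)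
  · exact ((h n).mint hN hp hsub hC hr.le).aestronglyMeasurable_restrict_uIoc
  · rw [uIoc_of_le hr.le] at hx
    rw [norm_eq_abs, abs_mul, abs_of_pos (Pw_pos hx.1)]
    have := mul_le_mul_of_nonneg_left ((h n).pb hC hp hx.1) (Pp N hx.1).le
    linarith
  · rw [uIoc_of_le hr.le] at hx
    exact ((ha x hx.1).rpow_const (Or.inr (by linarith))).const_mul _
lemma EqC.flim (hN : 2 ≤ N) (hp : 1 < p) (hsub : ((N:ℝ) - 2) * p < N + 2) (hC : 0 < C) (h : ∀ n, EqC N C (Y n))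
    (ha : ∀ r > 0, Tendsto (fun n => Y n r) atTop (𝓝 (a r))) :
    Tendsto (fun n => ∫ x in IP, Pw N x * (Y n x ^ p * Y n x)) atTop (𝓝 (∫ x in IP, Pw N x * (a x ^ p * a x))) := by
  refine tendsto_integral_filter_of_dominated_convergence (fun x => C ^ p * C * (Pw N x * Sg N x ^ (p / 2) * √(Sg N x))) (Eventually.of_forall fun n => ?_)
    (Eventually.of_forall fun n => ?_) ((Sp_int hN hp hsub).const_mul _) ?_
  · exact ((Pw_cont N).continuousOn.mul (((h n).pc hN hp).mul ((h n).cont hN))).aestronglyMeasurable mI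
  · filter_upwards [ae_restrict_mem mI] with x hx
    have hx' := mem_Ioi.1 hx
    have h2 := Pp N hx'
    rw [norm_eq_abs, abs_mul, abs_mul, abs_of_pos h2, abs_of_nonneg ((h n).nn x hx')]
    calc _ ≤ Pw N x * (C ^ p * Sg N x ^ (p / 2) * (C * √(Sg N x))) :=
          mul_le_mul_of_nonneg_left (mul_le_mul ((h n).pb hC hp hx') ((h n).le x hx') ((h n).nn x hx') ((abs_nonneg _).trans ((h n).pb hC hp hx'))) h2.le
      _ = _ := by ring
  · filter_upwards [ae_restrict_mem mI] with x hx
    have hx' := mem_Ioi.1 hx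
    exact (((ha x hx').rpow_const (Or.inr (by linarith))).mul (ha x hx')).const_mul _
lemma EqC.qlim (hN : 2 ≤ N) (hp : 1 < p) (hsub : ((N:ℝ) - 2) * p < N + 2) (hC : 0 < C) (h : ∀ n, EqC N C (Y n))
    (ha : ∀ r > 0, Tendsto (fun n => Y n r) atTop (𝓝 (a r))) {r q : ℝ} (hr : 0 < r) (hq : 0 < q) :
    Tendsto (fun n => ∫ s in r..q, Mm N (fun x => Y n x ^ p) s / Pw N s) atTop (𝓝 (∫ s in r..q, Mm N (fun x => a x ^ p) s / Pw N s)) := by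
  have hS0 : ∀ x > 0, 0 ≤ Sg N x ^ (p / 2) := fun x hx => rpow_nonneg (Sg_nonneg hx) _
  have hpm : 1 / (1 / p) = p := one_div_one_div p
  have hA : ContinuousOn (fun s => C ^ p * Aa N p s / Pw N s) IP := fun s hs =>
    ((continuousAt_const.mul (M_deriv (Sp_cont hN _) hs (Mint hN (Sp_cont hN _) hS0 (Sp_int hN hp hsub) (mem_Ioi.1 hs).le)).continuousAt).div
      (Pw_cont N).continuousAt (Pw_pos (mem_Ioi.1 hs)).ne').continuousWithinAt
  have hsb := uIcc_sub_Ioi hr hq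
  refine intervalIntegral.tendsto_integral_filter_of_dominated_convergence (fun s => C ^ p * Aa N p s / Pw N s) (Eventually.of_forall fun n => ?_)
    (Eventually.of_forall fun n => ae_of_all _ fun x hx => ?_) (hA.mono hsb).intervalIntegrable (ae_of_all _ fun x hx => ?_)
  · exact ((((h n).mc hN hp hsub hC).mono hsb).intervalIntegrable).aestronglyMeasurable_restrict_uIoc
  · have hx0 : 0 < x := hsb (uIoc_subset_uIcc hx)
    rw [norm_eq_abs, abs_div, abs_of_pos (Pw_pos hx0)]
    refine div_le_div_of_nonneg_right ?_ (Pw_pos hx0).le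
    have := Mm_dom (m := 1 / p) hN (by rw [hpm]; exact Sp_int hN hp hsub) (a := fun x => Y n x ^ p) (K := C ^ p) (by rw [hpm]; exact fun x hx => (h n).pb hC hp hx) hx0
    rwa [hpm] at this
  · have hx0 : 0 < x := hsb (uIoc_subset_uIcc hx)
    exact (mlim hN hp hsub hC h ha hx0).div_const _
end

section
open Real
variable {r : ℝ} {t : ℝ}
variable {N : ℕ} {m T C : ℝ} {u g ut : ℝ → ℝ → ℝ}
noncomputable def yy (m T : ℝ) (u : ℝ → ℝ → ℝ) (t r : ℝ) : ℝ := lam m T t ^ m * u r t ^ m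
lemma lam_sq (hT : 0 < T) (ht : t < T) : (lam m T t ^ m) ^ 2 = lam m T t ^ (2 * m) := by
  rw [← rpow_natCast, ← rpow_mul (lam_pos hT ht).le]
  congr 1
  push_cast
  ring
lemma yy_eqc (h : FDC N m T u g ut) (ht : t ∈ Ioo 0 T) (hC : 0 < C) (hD : lam m T t ^ (2 * m) * dD N g t ≤ C ^ 2) :
    EqC N C (yy m T u t) := by
  have hl := lam_pos (m := m) h.hT ht.2
  have hle : ∀ r > 0, yy m T u t r ^ 2 ≤ C ^ 2 * Sg N r := fun r hr => by
    have h1 := v_le h.hN h.fl ht hr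
    have h2 := Sg_nonneg (N := N) hr
    rw [yy, mul_pow, lam_sq h.hT ht.2]
    calc _ ≤ lam m T t ^ (2 * m) * (dD N g t * Sg N r) := mul_le_mul_of_nonneg_left h1 (by positivity)
      _ = lam m T t ^ (2 * m) * dD N g t * Sg N r := by ring
      _ ≤ _ := by gcongr
  refine ⟨fun r hr => ?_, fun r hr => ?_, fun r q hr hq => ?_⟩
  · have := h.fl.upos r hr t ht
    unfold yy
    positivity
  · have := le_sqrt_of_sq_le (hle r hr)
    rwa [sqrt_mul (sq_nonneg _), sqrt_sq hC.le] at this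
  · have h1 := CS_diff h.hN (fun x hx => h.fl.vr x hx t ht) (gslice h.fl ht) (h.fl.gint t ht) hr hq
    have h2 : 0 ≤ Sg N r - Sg N q := sub_nonneg.2 ((Sg_strictAnti h.hN).antitoneOn hr (hr.trans_le hq) hq)
    have h3 : yy m T u t r - yy m T u t q = lam m T t ^ m * (u r t ^ m - u q t ^ m) := by unfold yy; ring
    rw [h3, mul_pow, lam_sq h.hT ht.2]
    calc _ ≤ lam m T t ^ (2 * m) * (dD N g t * (Sg N r - Sg N q)) := mul_le_mul_of_nonneg_left h1 (by positivity)
      _ = lam m T t ^ (2 * m) * dD N g t * (Sg N r - Sg N q) := by ring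
      _ ≤ _ := by gcongr
lemma yy_pow (h : FDC N m T u g ut) (ht : t ∈ Ioo 0 T) (hr : 0 < r) : yy m T u t r ^ (1 / m) = lam m T t * u r t := by
  have hl := lam_pos (m := m) h.hT ht.2
  have hu := h.fl.upos r hr t ht
  have hm := h.hm
  rw [yy, mul_rpow (by positivity) (by positivity), ← rpow_mul hl.le, ← rpow_mul hu.le, mul_one_div_cancel hm.ne', rpow_one, rpow_one]
lemma yy_M (h : FDC N m T u g ut) (ht : t ∈ Ioo 0 T) (hr : 0 < r) :
    Mm N (fun x => yy m T u t x ^ (1 / m)) r = lam m T t * Mm N (fun x => u x t) r := by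
  rw [Mm, Mm, ← intervalIntegral.integral_const_mul]
  refine intervalIntegral.integral_congr_ae (ae_of_all _ fun x hx => ?_)
  rw [uIoc_of_le hr.le] at hx
  simp only [yy_pow h ht hx.1]
  ring
lemma yy_Q (h : FDC N m T u g ut) (ht : t ∈ Ioo 0 T) {r q : ℝ} (hr : 0 < r) (hq : 0 < q) :
    ∫ s in r..q, Mm N (fun x => yy m T u t x ^ (1 / m)) s / Pw N s = lam m T t * ∫ s in r..q, Mm N (fun x => u x t) s / Pw N s := by
  rw [← intervalIntegral.integral_const_mul]
  refine intervalIntegral.integral_congr fun x hx => ?_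
  simp only [yy_M h ht (mem_Ioi.1 (uIcc_sub_Ioi hr hq hx))]
  ring
lemma yy_F (h : FDC N m T u g ut) (ht : t ∈ Ioo 0 T) :
    ∫ x in IP, Pw N x * (yy m T u t x ^ (1 / m) * yy m T u t x) = lam m T t ^ (m + 1) * fF N m u t := by
  rw [fF, ← integral_const_mul]
  refine setIntegral_congr_fun mI fun x hx => ?_
  simp only [yy_pow h ht (mem_Ioi.1 hx)]
  rw [rpow_add (lam_pos h.hT ht.2), rpow_one, yy]
  ring
lemma MuP_cont (h : FDC N m T u g ut) (ht : t ∈ Ioo 0 T) : ContinuousOn (fun s => Mm N (fun x => u x t) s / Pw N s) IP := fun r hr =>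
  ((Mu_dr h.hN h.hm h.hk h.fl ht (mem_Ioi.1 hr)).continuousAt.div (Pw_cont N).continuousAt (Pw_pos (mem_Ioi.1 hr)).ne').continuousWithinAt
lemma prim_hd {f : ℝ → ℝ} (hf : ContinuousOn f IP) {q r : ℝ} (hq : 0 < q) (hr : 0 < r) : HasDerivAt (fun x => ∫ s in q..x, f s) (f r) r :=
  intervalIntegral.integral_hasDerivAt_right (hf.mono (uIcc_sub_Ioi hq hr)).intervalIntegrable
    (hf.stronglyMeasurableAtFilter isOpen_Ioi r hr) (hf.continuousAt (Ioi_mem_nhds hr))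
lemma yy_good (h : FDC N m T u g ut) (ht : t ∈ Ioo 0 T) {r q : ℝ} (hr : 0 < r) (hq : r ≤ q) :
    (yy m T u t r - yy m T u t q - 1 / ((1 - m) * T) * ∫ s in r..q, Mm N (fun x => yy m T u t x ^ (1 / m)) s / Pw N s) ^ 2 ≤
    lam m T t ^ (2 * m) * (dD N g t - 2 * (1 / ((1 - m) * (T - t))) * fF N m u t + 2 * (1 / ((1 - m) * (T - t))) ^ 2 * hH N u t) * (Sg N r - Sg N q) := by
  have hl := lam_pos (m := m) h.hT ht.2
  have hq0 := hr.trans_le hq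
  have hT := h.hT
  have hm1 : 0 < 1 - m := by linarith [h.hm1]
  have hTt : 0 < T - t := by linarith [ht.2]
  set θ := 1 / ((1 - m) * (T - t)) with hθ
  obtain ⟨hi, he⟩ := deficit h ht θ
  have hc := MuP_cont h ht
  have h1 := CS_diff h.hN (y := fun x => u x t ^ m + θ * ∫ s in r..x, Mm N (fun x => u x t) s / Pw N s)
    (fun x hx => (h.fl.vr x hx t ht).add ((prim_hd hc hr hx).const_mul θ)) ((gslice h.fl ht).add (continuousOn_const.mul hc)) hi hr hq
  rw [he] at h1
  have h3 : lam m T t ^ m * θ = 1 / ((1 - m) * T) * lam m T t := by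
    have e1 : lam m T t = lam m T t ^ m * lam m T t ^ (1 - m) := by
      rw [← rpow_add hl, add_sub_cancel, rpow_one]
    have e2 : θ = 1 / ((1 - m) * T) * (T / (T - t)) := by rw [hθ]; field_simp
    nth_rewrite 2 [e1]
    rw [lam_one h.hm1 hT ht.2, e2]
    ring
  simp only [intervalIntegral.integral_same] at h1
  rw [yy_Q h ht hr hq0, mul_assoc]
  refine le_trans (le_of_eq ?_) (mul_le_mul_of_nonneg_left h1 (by positivity))
  rw [← lam_sq hT ht.2, ← mul_pow]
  congr 1
  unfold yy
  linear_combination (∫ s in r..q, Mm N (fun x => u x t) s / Pw N s) * h3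
lemma Qdiff (h : FDC N m T u g ut) {t σ : ℝ} (hσ : 0 < σ) (hst : σ ≤ t) (ht : t < T) {r q : ℝ} (hr : 0 < r) (hq : 0 < q) {B : ℝ}
    (hB : ∀ s ∈ Icc σ t, u r s ^ m ≤ B ∧ u q s ^ m ≤ B) :
    |(∫ s in r..q, Mm N (fun x => u x t) s / Pw N s) - ∫ s in r..q, Mm N (fun x => u x σ) s / Pw N s| ≤ (t - σ) * B := by
  have ht' : t ∈ Ioo 0 T := ⟨hσ.trans_le hst, ht⟩
  have hσ' : σ ∈ Ioo 0 T := ⟨hσ, hst.trans_lt ht⟩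
  have hsb : uIcc σ t ⊆ Ioo 0 T := by rw [uIcc_of_le hst]; exact fun x hx => ⟨hσ.trans_le hx.1, hx.2.trans_lt ht⟩
  have hsb2 := uIcc_sub_Ioi hr hq
  have hsw : ∀ {f : ℝ × ℝ → ℝ}, ContinuousOn f (IP ×ˢ Ioo 0 T) → ContinuousOn (fun x : ℝ × ℝ => f (x.2, x.1)) (Ioo 0 T ×ˢ IP) := fun hf =>
    hf.comp (by fun_prop) fun x hx => ⟨hx.2, hx.1⟩
  have hΨ : ∀ x ∈ uIcc r q, HasDerivAt (fun x => ∫ s in σ..t, u x s ^ m) (Mm N (fun y => u y t) x / Pw N x - Mm N (fun y => u y σ) x / Pw N x) x := fun x hx => by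
    have hx0 := hsb2 hx
    have h1 := paramD (φ := fun s x => u x s ^ m) (φ' := fun s x => g x s) isOpen_Ioi (hsw (vcont h m)) (hsw h.fl.gcont)
      (fun s hs x hx => h.fl.vr x hx s hs) hsb hx0
    refine h1.congr_deriv ?_
    have hgc : ContinuousOn (fun s => Pw N x * g x s) (uIcc σ t) := continuousOn_const.mul
      (h.fl.gcont.comp (f := fun s => (x, s)) (by fun_prop) fun s hs => ⟨hx0, hsb hs⟩)
    have h2 := intervalIntegral.integral_eq_sub_of_hasDerivAt (fun s hs => Mu_dt h.hN h.hm h.hk h.fl (hsb hs) (mem_Ioi.1 hx0)) hgc.intervalIntegrable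
    rw [intervalIntegral.integral_const_mul] at h2
    have := Pp N (mem_Ioi.1 hx0)
    rw [← sub_div, ← h2]
    field_simp
  have i1 := ((MuP_cont h ht').mono hsb2).intervalIntegrable (μ := volume)
  have i2 := ((MuP_cont h hσ').mono hsb2).intervalIntegrable (μ := volume)
  rw [← intervalIntegral.integral_sub i1 i2, intervalIntegral.integral_eq_sub_of_hasDerivAt hΨ (i1.sub i2)]
  have hb : ∀ x > 0, (∀ s ∈ Icc σ t, u x s ^ m ≤ B) → 0 ≤ ∫ s in σ..t, u x s ^ m ∧ ∫ s in σ..t, u x s ^ m ≤ (t - σ) * B := fun x hx hb => by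
    refine ⟨intervalIntegral.integral_nonneg hst fun s hs => rpow_nonneg (h.fl.upos x hx s (hsb (by rwa [uIcc_of_le hst]))).le _, ?_⟩
    have hvc : ContinuousOn (fun s => u x s ^ m) (uIcc σ t) := (vcont h m).comp (f := fun s => (x, s)) (by fun_prop) fun s hs => ⟨hx, hsb hs⟩
    refine (intervalIntegral.integral_mono_on hst hvc.intervalIntegrable intervalIntegrable_const hb).trans_eq ?_
    simp
  have b1 := hb r hr fun s hs => (hB s hs).1
  have b2 := hb q hq fun s hs => (hB s hs).2
  rw [abs_le]
  constructor <;> linarith [b1.1, b1.2, b2.1, b2.2]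
end

section
open Real
variable {r : ℝ} {t : ℝ}
variable {N : ℕ} {p c C : ℝ} {a b : ℝ → ℝ}
lemma EqC.prof (hN : 2 ≤ N) (hp : 1 < p) (hc : 0 < c) (hsub : ((N:ℝ) - 2) * p < N + 2) (hC : 0 < C) (h : EqC N C a)
    (he : ∀ r q, 0 < r → r ≤ q → a r - a q = c * ∫ s in r..q, Mm N (fun x => a x ^ p) s / Pw N s)
    (hb : ∃ Λ > 0, ∀ r ∈ Ioc 0 1, a r ≤ Λ) (hF : 0 < ∫ x in IP, Pw N x * (a x ^ p * a x)) : Prof N p c a := by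
  have hmc := h.mc hN hp hsub hC
  have hM0 : ∀ r > 0, 0 ≤ Mm N (fun x => a x ^ p) r := fun r hr => M_nonneg (fun x hx => rpow_nonneg (h.nn x hx) _) hr.le
  have hanti : ∀ r q, 0 < r → r ≤ q → a q ≤ a r := fun r q hr hq => by
    have h1 : 0 ≤ ∫ s in r..q, Mm N (fun x => a x ^ p) s / Pw N s := intervalIntegral.integral_nonneg hq fun s hs =>
      div_nonneg (hM0 s (hr.trans_le hs.1)) (Pw_pos (hr.trans_le hs.1)).le
    nlinarith [he r q hr hq, mul_nonneg hc.le h1]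
  obtain ⟨r0, hr0, har0⟩ : ∃ r0 > 0, 0 < a r0 := by
    by_contra hcon
    push Not at hcon
    refine hF.ne' (setIntegral_eq_zero_of_forall_eq_zero fun x hx => ?_)
    rw [le_antisymm (hcon x hx) (h.nn x hx), mul_zero, mul_zero]
  have hMp : ∀ r > 0, 0 < Mm N (fun x => a x ^ p) r := fun r hr => by
    have hm : 0 < min r r0 := lt_min hr hr0
    refine (intervalIntegral.intervalIntegral_pos_of_pos_on (h.mint hN hp hsub hC hm.le) (fun x hx => ?_) hm).trans_le
      (intervalIntegral.integral_mono_interval le_rfl hm.le (min_le_left r r0) ?_ (h.mint hN hp hsub hC hr.le))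
    · exact mul_pos (Pw_pos hx.1) (rpow_pos_of_pos (har0.trans_le (hanti x r0 hx.1 (hx.2.le.trans (min_le_right _ _)))) _)
    · filter_upwards [ae_restrict_mem measurableSet_Ioc] with x hx
      exact mul_nonneg (Pw_pos hx.1).le (rpow_nonneg (h.nn x hx.1) _)
  have hapos : ∀ r > 0, 0 < a r := fun r hr => by
    have h1 : 0 < ∫ s in r..(r + 1), Mm N (fun x => a x ^ p) s / Pw N s :=
      intervalIntegral.intervalIntegral_pos_of_pos_on (hmc.mono (uIcc_sub_Ioi hr (by linarith))).intervalIntegrable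
        (fun s hs => div_pos (hMp s (hr.trans hs.1)) (Pw_pos (hr.trans hs.1))) (by linarith)
    nlinarith [he r (r + 1) hr (by linarith), mul_pos hc h1, h.nn (r + 1) (by linarith)]
  obtain ⟨Λ, hΛ, hb⟩ := hb
  refine ⟨hN, hp, hc, hsub, hapos, ⟨Λ, hΛ, fun r hr => ?_⟩, ⟨C, hC, h.le⟩, fun r hr => ?_⟩
  · rcases le_total r 1 with h1 | h1
    · exact hb r ⟨hr, h1⟩
    · exact (hanti 1 r one_pos h1).trans (hb 1 ⟨one_pos, le_rfl⟩)
  · have h1 := ((prim_hd hmc hr hr).const_mul c).const_sub (a r)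
    refine (h1.congr_of_eventuallyEq ?_).congr_deriv (by ring)
    filter_upwards [eventually_gt_nhds hr] with x hx
    rcases le_total r x with h2 | h2
    · linarith [he r x hr h2]
    · rw [intervalIntegral.integral_symm]
      linarith [he x r hx h2]
lemma EqC.inj (hN : 2 ≤ N) (hp : 1 < p) (hsub : ((N:ℝ) - 2) * p < N + 2) (hC : 0 < C) (ha : EqC N C a) (hb : EqC N C b)
    (he : ∀ r q, 0 < r → r ≤ q → ∫ s in r..q, Mm N (fun x => a x ^ p) s / Pw N s = ∫ s in r..q, Mm N (fun x => b x ^ p) s / Pw N s)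
    (hr : 0 < r) : a r = b r := by
  have hM : ∀ x > 0, Mm N (fun x => a x ^ p) x = Mm N (fun x => b x ^ p) x := fun x hx => by
    have h2 := prim_hd (hb.mc hN hp hsub hC) (half_pos hx) hx
    have h1 := prim_hd (ha.mc hN hp hsub hC) (half_pos hx) hx
    have h3 := h1.unique (h2.congr_of_eventuallyEq (by
      filter_upwards [eventually_gt_nhds (half_lt_self hx)] with z hz
      exact he _ _ (half_pos hx) hz.le))
    exact (div_left_inj' (Pw_pos hx).ne').1 h3
  have h1 := (ha.md hN hp hsub hC hr).unique ((hb.md hN hp hsub hC hr).congr_of_eventuallyEq (by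
      filter_upwards [eventually_gt_nhds hr] with z hz
      exact hM z hz))
  exact (rpow_left_inj (ha.nn r hr) (hb.nn r hr) (by linarith)).1 (mul_left_cancel₀ (Pw_pos hr).ne' h1)
end

section
open Real
variable {r : ℝ} {t : ℝ}
variable {N : ℕ} {m T C : ℝ} {u g ut : ℝ → ℝ → ℝ}
lemma lam_ratio (hT : 0 < T) {s t : ℝ} (hs : s < T) (ht : t < T) :
    lam m T s = lam m T t * ((T - t) / (T - s)) ^ (1 / (1 - m)) := by
  have h1 : 0 < T - s := by linarith
  have h2 : 0 < T - t := by linarith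
  have e : (T - t) / T = (T - t) / (T - s) * ((T - s) / T) := by field_simp
  have h3 : 0 < (T - t) / (T - s) := by positivity
  rw [lam, lam, e, mul_rpow h3.le (by positivity), rpow_neg h3.le]
  have := (rpow_pos_of_pos h3 (1 / (1 - m))).ne'
  field_simp
lemma lam_mono (hm1 : m < 1) (hT : 0 < T) {s t : ℝ} (hst : s ≤ t) (ht : t < T) : lam m T s ≤ lam m T t := by
  have h1 : 0 < T - s := by linarith
  have h2 : 0 < T - t := by linarith
  rw [lam_ratio hT (hst.trans_lt ht) ht]
  refine mul_le_of_le_one_right (lam_pos hT ht).le (rpow_le_one (by positivity) ((div_le_one h1).2 (by linarith)) ?_)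
  exact one_div_nonneg.2 (by linarith)
lemma core (h : FDC N m T u g ut) {V : ℝ → ℝ} (hV : Prof N (1 / m) (1 / ((1 - m) * T)) V) (hC : 0 < C) {Λ t0 : ℝ} (hΛ : 0 < Λ) (ht0 : 0 < t0)
    (hG : ∀ t ∈ Ioo t0 T, EqC N C (yy m T u t) ∧ ∀ r ∈ Ioc 0 1, yy m T u t r ≤ Λ) {s t e : ℕ → ℝ} (hs : ∀ n, t0 < s n) (hst : ∀ n, s n ≤ t n) (ht : ∀ n, t n < T)
    (he : Tendsto e atTop (𝓝 0)) (hd : ∀ n, lam m T (s n) ^ (2 * m) * (dD N g (s n) - 2 * (1 / ((1 - m) * (T - s n))) * fF N m u (s n)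
      + 2 * (1 / ((1 - m) * (T - s n))) ^ 2 * hH N u (s n)) ≤ e n)
    (hx : Tendsto (fun n => (T - t n) / (T - s n)) atTop (𝓝 1)) (hsT : Tendsto s atTop (𝓝[<] T)) {a b : ℝ → ℝ}
    (ha : ∀ r > 0, Tendsto (fun n => yy m T u (s n) r) atTop (𝓝 (a r))) (hb : ∀ r > 0, Tendsto (fun n => yy m T u (t n) r) atTop (𝓝 (b r)))
    (hr : 0 < r) : b r = V r := by
  have hN := h.hN
  have hp := h.hp
  have hsub := h.hsub
  have hT := h.hT
  have hs1 : ∀ n, s n ∈ Ioo t0 T := fun n => ⟨hs n, (hst n).trans_lt (ht n)⟩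
  have ht1 : ∀ n, t n ∈ Ioo t0 T := fun n => ⟨(hs n).trans_le (hst n), ht n⟩
  have hs0 : ∀ n, s n ∈ Ioo 0 T := fun n => ⟨ht0.trans (hs1 n).1, (hs1 n).2⟩
  have ht0' : ∀ n, t n ∈ Ioo 0 T := fun n => ⟨ht0.trans (ht1 n).1, (ht1 n).2⟩
  have hYs := fun n => (hG _ (hs1 n)).1
  have hYt := fun n => (hG _ (ht1 n)).1
  have hEa := EqC.lim hYs ha
  have hEb := EqC.lim hYt hb
  have haV : ∀ r > 0, a r = V r := fun r hr => by
    refine uniq (EqC.prof hN hp hV.hc hsub hC hEa (fun r q hr hq => ?_) ⟨Λ, hΛ, fun r hr => ?_⟩ ?_) hV hr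
    · have hq0 := hr.trans_le hq
      have h1 := (((ha r hr).sub (ha q hq0)).sub ((EqC.qlim hN hp hsub hC hYs ha hr hq0).const_mul (1 / ((1 - m) * T)))).pow 2
      have h2 : 0 ≤ Sg N r - Sg N q := sub_nonneg.2 ((Sg_strictAnti hN).antitoneOn hr hq0 hq)
      have h3 := le_of_tendsto_of_tendsto' h1 (he.mul_const (Sg N r - Sg N q)) fun n =>
        (yy_good h (hs0 n) hr hq).trans (mul_le_mul_of_nonneg_right (hd n) h2)
      rw [zero_mul] at h3
      exact sub_eq_zero.1 (pow_eq_zero_iff two_ne_zero |>.1 (le_antisymm h3 (sq_nonneg _)))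
    · exact le_of_tendsto' (ha r hr.1) fun n => (hG _ (hs1 n)).2 r hr
    · obtain ⟨_, _, F, hF, _, _, _, _, hFl, _⟩ := ts_lim h.ts
      have h1 := EqC.flim hN hp hsub hC hYs ha
      rwa [tendsto_nhds_unique (h1.congr fun n => yy_F h (hs0 n)) (hFl.comp hsT)]
  rw [← haV r hr]
  refine (EqC.inj hN hp hsub hC hEa hEb (fun r q hr hq => ?_) hr).symm
  have hq0 := hr.trans_le hq
  have hA := (EqC.qlim hN hp hsub hC hYs ha hr hq0).congr fun n => yy_Q h (hs0 n) hr hq0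
  have hB := (EqC.qlim hN hp hsub hC hYt hb hr hq0).congr fun n => yy_Q h (ht0' n) hr hq0
  have hR := hB.mul (hx.rpow_const (p := 1 / (1 - m)) (Or.inl one_ne_zero))
  rw [one_rpow, mul_one] at hR
  have hz : Tendsto (fun n => T * (1 - (T - t n) / (T - s n)) * (C * √(Sg N r))) atTop (𝓝 0) := by
    have := ((hx.const_sub 1).const_mul T).mul_const (C * √(Sg N r))
    rwa [sub_self, mul_zero, zero_mul] at this
  have hd0 := (hR.sub hA).abs
  have h4 := le_of_tendsto_of_tendsto' hd0 hz fun n => ?_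
  · exact (sub_eq_zero.1 (abs_eq_zero.1 (le_antisymm h4 (abs_nonneg _)))).symm
  · have hl := lam_pos (m := m) hT (hs1 n).2
    have hTs : 0 < T - s n := by linarith [(hs1 n).2]
    have h1 := Qdiff h (hs0 n).1 (hst n) (ht n) hr hq0 (B := (lam m T (s n) ^ m)⁻¹ * (C * √(Sg N r))) fun x hx => by
      have hx1 : x ∈ Ioo t0 T := ⟨(hs n).trans_le hx.1, hx.2.trans_lt (ht n)⟩
      have hlx := rpow_le_rpow hl.le (lam_mono h.hm1 hT hx.1 hx1.2) h.hm.le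
      have hE := (hG x hx1).1
      have : ∀ z, r ≤ z → u z x ^ m ≤ (lam m T (s n) ^ m)⁻¹ * (C * √(Sg N r)) := fun z hz => by
        have hz0 := hr.trans_le hz
        have e1 := hE.le z hz0
        have e2 : √(Sg N z) ≤ √(Sg N r) := sqrt_le_sqrt ((Sg_strictAnti hN).antitoneOn hr hz0 hz)
        have hu := h.fl.upos z hz0 x ⟨ht0.trans hx1.1, hx1.2⟩
        rw [le_inv_mul_iff₀ (by positivity)]
        calc _ ≤ lam m T x ^ m * u z x ^ m := by gcongr
          _ ≤ _ := e1
          _ ≤ _ := by gcongr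
      exact ⟨this r le_rfl, this q hq⟩
    have e1 : lam m T (s n) = lam m T (s n) ^ m * lam m T (s n) ^ (1 - m) := by
      rw [← rpow_add hl, add_sub_cancel, rpow_one]
    have e2 := lam_one h.hm1 hT (hs1 n).2
    have h5 := mul_le_mul_of_nonneg_left h1 hl.le
    have hlm : lam m T (s n) ^ m ≠ 0 := (rpow_pos_of_pos hl m).ne'
    have e3 : lam m T (s n) * ((t n - s n) * ((lam m T (s n) ^ m)⁻¹ * (C * √(Sg N r)))) = T * (1 - (T - t n) / (T - s n)) * (C * √(Sg N r)) := by
      nth_rewrite 1 [e1]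
      rw [e2]
      field_simp
      ring
    rw [e3] at h5
    refine le_trans (le_of_eq ?_) h5
    rw [← abs_of_pos hl, ← abs_mul, abs_of_pos hl, mul_sub]
    nth_rewrite 2 [lam_ratio (m := m) hT (hs1 n).2 (ht1 n).2]
    congr 1
    ring
end

section
open Real
variable {r : ℝ} {t : ℝ}
variable {N : ℕ} {m T C : ℝ} {u g ut : ℝ → ℝ → ℝ}
lemma yy_resc (h : FDC N m T u g ut) {τ : ℝ} (hτ : 0 < τ) (hr : 0 < r) : rescaled m T u r τ ^ m = yy m T u (tt T τ) r := by
  have hu := h.fl.upos r hr _ (tt_mem h.hT hτ)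
  rw [rescaled_eq, ← lam_tt h.hT h.hm1, yy, mul_rpow (lam_pos h.hT (tt_mem h.hT hτ).2).le hu.le]
lemma setup (h : FDC N m T u g ut) : ∃ C > 0, ∃ Λ > 0, ∃ t0 ∈ Ioo 0 T, ∃ τ1 > 0,
    (∀ t ∈ Ioo t0 T, EqC N C (yy m T u t) ∧ ∀ r ∈ Ioc 0 1, yy m T u t r ≤ Λ) ∧ ∀ τ ≥ τ1, tt T τ ∈ Ioo t0 T := by
  have hT := h.hT
  have hex : ∀ l < T, ∃ τ1 > 0, ∀ τ ≥ τ1, tt T τ ∈ Ioo l T := fun l hl => by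
    obtain ⟨τ1, h1⟩ := eventually_atTop.1 ((tt_lim hT).eventually (Ioo_mem_nhdsLT hl))
    exact ⟨max τ1 1, by positivity, fun τ hτ => h1 τ ((le_max_left _ _).trans hτ)⟩
  obtain ⟨C0, hC0, hD⟩ := ts_D h.ts
  obtain ⟨l, hl, hD⟩ := (mem_nhdsLT_iff_exists_Ioo_subset).1 hD
  have hC : 0 < √C0 := sqrt_pos.2 hC0
  have hE : ∀ t ∈ Ioo (max l 0) T, EqC N (√C0) (yy m T u t) := fun t ht =>
    yy_eqc h ⟨(le_max_right _ _).trans_lt ht.1, ht.2⟩ hC (by rw [sq_sqrt hC0.le]; exact hD ⟨(le_max_left _ _).trans_lt ht.1, ht.2⟩)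
  obtain ⟨τ1, hτ1, h1⟩ := hex (max l 0) (max_lt hl hT)
  obtain ⟨zr, zt, hz⟩ := h.zf
  obtain ⟨Λ, hΛ, hb⟩ := hz.Linf hτ1 hC fun r hr τ hτ => by
    rw [yy_resc h (hτ1.trans_le hτ) hr.1]
    exact (hE _ (h1 τ hτ)).le r hr.1
  have h10 := h1 τ1 le_rfl
  obtain ⟨τ2, hτ2, h2⟩ := hex (tt T τ1) h10.2
  refine ⟨√C0, hC, Λ, hΛ, tt T τ1, tt_mem hT hτ1, τ2, hτ2, fun t ht => ⟨hE t ⟨h10.1.trans ht.1, ht.2⟩, fun r hr => ?_⟩, h2⟩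
  have hTt : 0 < T - t := by linarith [ht.2]
  obtain ⟨τ, hτ⟩ : ∃ τ, tt T τ = t := ⟨-(T * log ((T - t) / T)), by
    rw [tt, neg_neg, mul_div_cancel_left₀ _ hT.ne', exp_log (by positivity)]
    field_simp
    ring⟩
  have hττ : τ1 ≤ τ := by
    by_contra hcon
    have := tt_mono hT (not_le.1 hcon).le
    rw [hτ] at this
    linarith [ht.1]
  have := hb r hr τ hττ
  rwa [yy_resc h (hτ1.trans_le hττ) hr.1, hτ] at this
lemma conv (h : FDC N m T u g ut) {V : ℝ → ℝ} (hV : Prof N (1 / m) (1 / ((1 - m) * T)) V) (hr : 0 < r) :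
    Tendsto (fun t => yy m T u t r) (𝓝[<] T) (𝓝 (V r)) := by
  obtain ⟨C, hC, Λ, hΛ, t0, ht0, -, -, hG, -⟩ := setup h
  refine tendsto_of_subseq_tendsto fun ns hns => ?_
  have hε : ∀ n : ℕ, (0:ℝ) < 1 / ((n:ℝ) + 1) := fun n => by positivity
  have hθ : ∀ n : ℕ, 1 / ((n:ℝ) + 2) ≤ 1 / 2 := fun n => one_div_le_one_div_of_le two_pos (by linarith [n.cast_nonneg (α := ℝ)])
  have hθ0 : ∀ n : ℕ, 0 < 1 / ((n:ℝ) + 2) := fun n => by positivity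
  obtain ⟨φ, hφ, hP⟩ := extraction_forall_of_eventually fun n : ℕ => (hns.eventually (Ioo_mem_nhdsLT (show (T + t0) / 2 < T by linarith [ht0.2]))).and
    (hns.eventually (ts_good h.ts (hε n) (θ := 1 - 1 / ((n:ℝ) + 2)) (by linarith [hθ n]) (by linarith [hθ0 n])))
  choose hP1 σ hσ0 hσ1 hσ2 hσ3 using hP
  have hσT : ∀ n, 2 * ns (φ n) - T ≤ σ n := fun n => by
    have h1 : 0 < T - σ n := by linarith [(hσ0 n).2]
    nlinarith [hσ2 n, hθ n]
  have hσt0 : ∀ n, t0 < σ n := fun n => by linarith [hσT n, (hP1 n).1]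
  have htl : Tendsto (fun n => ns (φ n)) atTop (𝓝 T) := (hns.mono_right nhdsWithin_le_nhds).comp hφ.tendsto_atTop
  have hσl : Tendsto σ atTop (𝓝[<] T) := by
    refine tendsto_nhdsWithin_iff.2 ⟨?_, Eventually.of_forall fun n => (hσ0 n).2⟩
    have h2 := (htl.const_mul 2).sub_const T
    rw [show 2 * T - T = T by ring] at h2
    exact tendsto_of_tendsto_of_tendsto_of_le_of_le h2 tendsto_const_nhds hσT fun n => (hσ0 n).2.le
  have hxl : Tendsto (fun n => (T - ns (φ n)) / (T - σ n)) atTop (𝓝 1) := by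
    have h2 : Tendsto (fun n : ℕ => 1 - 1 / ((n:ℝ) + 2)) atTop (𝓝 1) := by
      have h3 : Tendsto (fun n : ℕ => (n:ℝ) + 2) atTop atTop := tendsto_natCast_atTop_atTop.atTop_add tendsto_const_nhds
      have := (h3.inv_tendsto_atTop).const_sub 1
      rw [sub_zero] at this
      exact this.congr fun n => by simp
    refine tendsto_of_tendsto_of_tendsto_of_le_of_le h2 tendsto_const_nhds (fun n => ?_) fun n => ?_
    · exact (le_div_iff₀ (by linarith [(hσ0 n).2])).2 (hσ2 n)
    · exact (div_le_one (by linarith [(hσ0 n).2])).2 (by linarith [hσ1 n])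
  obtain ⟨ψ1, hψ1, a, ha⟩ := EqC.subseq h.hN fun n => (hG (σ n) ⟨hσt0 n, (hσ0 n).2⟩).1
  obtain ⟨ψ2, hψ2, b, hb⟩ := EqC.subseq h.hN fun n => (hG (ns (φ (ψ1 n))) ⟨(hσt0 _).trans_le (hσ1 _), (hP1 _).2⟩).1
  have hψ := hψ1.tendsto_atTop.comp hψ2.tendsto_atTop
  refine ⟨fun n => φ (ψ1 (ψ2 n)), ?_⟩
  have := core h hV hC hΛ ht0.1 hG (s := fun n => σ (ψ1 (ψ2 n))) (t := fun n => ns (φ (ψ1 (ψ2 n)))) (e := fun n => 1 / (((ψ1 (ψ2 n) : ℕ) : ℝ) + 1))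
    (fun n => hσt0 _) (fun n => hσ1 _) (fun n => (hP1 _).2) (tendsto_one_div_add_atTop_nhds_zero_nat.comp hψ) (fun n => (hσ3 _).le)
    (hxl.comp hψ) (hσl.comp hψ) (fun r hr => (ha r hr).comp hψ2.tendsto_atTop) hb hr
  rw [← this]
  exact hb r hr
lemma mainP (N : ℕ) (hN : 2 ≤ N) (m T : ℝ)
    (hm : m ∈ Set.Ioo (((N : ℝ) - 2) / ((N : ℝ) + 2)) 1) (hT : 0 < T)
    (u : ℝ → ℝ → ℝ) (hu : IsRadialEnergySolution N m T u)
    (V : ℝ → ℝ) (hV : IsStationaryProfile N m T V) :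
    ∀ K : Set ℝ, IsCompact K → K ⊆ Set.Ici 0 → ∀ ε > (0:ℝ), ∃ τ₀ : ℝ, ∀ τ ≥ τ₀,
      ∀ r ∈ K, |rescaled m T u r τ ^ m - V r| ≤ ε := by
  intro K hK hK0 ε hε
  have hN2 : (2:ℝ) ≤ N := by exact_mod_cast hN
  have hm0 : 0 < m := (div_nonneg (by linarith) (by linarith)).trans_lt hm.1
  have hsub : ((N:ℝ) - 2) * (1 / m) < N + 2 := by
    have := (div_lt_iff₀ (by linarith : (0:ℝ) < N + 2)).1 hm.1
    rw [mul_one_div, div_lt_iff₀ hm0]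
    linarith
  obtain ⟨g, ut, hfl⟩ := flow_exists hN hT hu
  have h : FDC N m T u g ut := ⟨hN, hm0, hm.2, hT, hsub, hfl⟩
  have hP := prof_V hN hm0 hm.2 hT hsub hV
  obtain ⟨C, hC, Λ, hΛ, t0, ht0, τ1, hτ1, hG, htt⟩ := setup h
  obtain ⟨zr, zt, hz⟩ := h.zf
  obtain ⟨α, hα, hVα, -⟩ := hP.lim0
  have hcy : ∀ r > 0, Tendsto (fun τ => yy m T u (tt T τ) r) atTop (𝓝 (V r)) := fun r hr => (conv h hP hr).comp (tt_lim hT)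
  have hcv : ∀ r > 0, Tendsto (fun τ => rescaled m T u r τ ^ m) atTop (𝓝 (V r)) := fun r hr =>
    (hcy r hr).congr' (by filter_upwards [eventually_gt_atTop 0] with τ hτ; exact (yy_resc h hτ hr).symm)
  obtain ⟨ρ1, hρ1, τa, hna⟩ := hz.near hτ1 hΛ (fun r hr τ hτ => by
    rw [yy_resc h (hτ1.trans_le hτ) hr.1]
    exact (hG _ (htt τ hτ)).2 r hr) hVα hα hcv (half_pos hε)
  obtain ⟨ρ2, hρ2, hV2⟩ := mem_nhdsGT_iff_exists_Ioo_subset.1 (Metric.tendsto_nhds.1 hVα (ε / 2) (half_pos hε))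
  obtain ⟨R, hR⟩ := hK.bddAbove
  set ρ := min ρ1 (ρ2 / 2) with hρ
  have hρ2' : 0 < ρ2 := hρ2
  have hρ0 : 0 < ρ := lt_min hρ1.1 (by linarith)
  have hunif : TendstoLocallyUniformlyOn (fun τ r => yy m T u (tt T τ) r) V atTop (Icc ρ R) := by
    refine Metric.tendstoLocallyUniformlyOn_iff.2 fun η hη x hx => ?_
    have hx0 : 0 < x := hρ0.trans_le hx.1
    have hη3 : 0 < η / 3 := by positivity
    refine ⟨_, mem_nhdsWithin_of_mem_nhds ((eqc_mod hN C hx0 hη3).and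
      (Metric.tendsto_nhds.1 (hP.yc.continuousAt (Ioi_mem_nhds hx0)) (η / 3) hη3)), ?_⟩
    filter_upwards [eventually_ge_atTop τ1, Metric.tendsto_nhds.1 (hcy x hx0) (η / 3) hη3] with τ hτ hd y hy
    have h1 := (hG _ (htt τ hτ)).1.abs hx0 hy.1.1
    have h2 := hy.1.2
    have h3 := hy.2
    simp only [dist_eq] at hd h3 ⊢
    rw [abs_lt] at hd h3 ⊢
    rw [abs_le] at h1
    constructor <;> linarith [hd.1, hd.2, h3.1, h3.2, h1.1, h1.2]
  rw [tendstoLocallyUniformlyOn_iff_tendstoUniformlyOn_of_compact isCompact_Icc] at hunif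
  obtain ⟨τb, hτb⟩ := eventually_atTop.1 (Metric.tendstoUniformlyOn_iff.1 hunif ε hε)
  refine ⟨max τ1 (max τa τb), fun τ hτ => ?_⟩
  have hτ1' : τ1 ≤ τ := (le_max_left _ _).trans hτ
  have hτa' : τa ≤ τ := (le_max_left _ _).trans ((le_max_right _ _).trans hτ)
  have hτb' : τb ≤ τ := (le_max_right _ _).trans ((le_max_right _ _).trans hτ)
  have hτ0 := hτ1.trans_le hτ1'
  have hsm : ∀ r ∈ Ioc 0 ρ, |rescaled m T u r τ ^ m - V r| ≤ ε := fun r hr => by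
    have h1 := hna τ hτa' r ⟨hr.1, hr.2.trans (min_le_left _ _)⟩
    have h2 : dist (V r) α < ε / 2 := hV2 ⟨hr.1, (hr.2.trans (min_le_right _ _)).trans_lt (by linarith)⟩
    rw [dist_eq, abs_lt] at h2
    rw [abs_le] at h1 ⊢
    constructor <;> linarith [h1.1, h1.2, h2.1, h2.2]
  intro r hr
  rcases (mem_Ici.1 (hK0 hr)).eq_or_lt with rfl | hr0
  · have ht := tt_mem hT hτ0
    have hc1 : ContinuousWithinAt (fun r => u r (tt T τ)) (Ici 0) 0 :=
      (hu.continuousOn (0, tt T τ) ⟨self_mem_Ici, ⟨ht.1.le, ht.2.le⟩⟩).comp (f := fun r => (r, tt T τ)) (by fun_prop) fun r hr => ⟨hr, ⟨ht.1.le, ht.2.le⟩⟩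
    have hc2 : ContinuousWithinAt (fun r => |rescaled m T u r τ ^ m - V r|) (Ici 0) 0 :=
      (((continuousWithinAt_const.mul hc1).rpow_const (Or.inr hm0.le)).sub (hV.smooth.continuousOn 0 self_mem_Ici)).abs
    refine le_of_tendsto (hc2.tendsto.mono_left (nhdsWithin_mono 0 Ioi_subset_Ici_self)) ?_
    filter_upwards [Ioc_mem_nhdsGT hρ0] with r hr
    exact hsm r hr
  · rcases le_total r ρ with h1 | h1
    · exact hsm r ⟨hr0, h1⟩
    · have := hτb τ hτb' r ⟨h1, hR hr⟩
      rw [dist_comm, dist_eq, ← yy_resc h hτ0 hr0] at this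
      exact this.le
end

/-- Local uniform convergence of the rescaled solution to the stationary profile. -/
theorem rescaled_local_uniform_convergence
    (N : ℕ) (hN : 2 ≤ N) (m T : ℝ)
    (hm : m ∈ Set.Ioo (((N : ℝ) - 2) / ((N : ℝ) + 2)) 1) (hT : 0 < T)
    (u : ℝ → ℝ → ℝ) (hu : IsRadialEnergySolution N m T u)
    (V : ℝ → ℝ) (hV : IsStationaryProfile N m T V) :
    ∀ K : Set ℝ, IsCompact K → K ⊆ Set.Ici 0 → ∀ ε > (0:ℝ), ∃ τ₀ : ℝ, ∀ τ ≥ τ₀,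
      ∀ r ∈ K, |rescaled m T u r τ ^ m - V r| ≤ ε := by
  exact mainP N hN m T hm hT u hu V hV
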